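/- Let H be a semisimple and cosemisimple Hopf algebra over an algebraically closed field K (of arbitrary characteristic). If H has a simple module of even dimension, then the dimension of H is even. -/

import Mathlib

open scoped TensorProduct
open WithConv Coalgebra

namespace HopfEven

section Basic
variable {K H : Type*} [Field K] [Ring H] [HopfAlgebra K H]

/-- the map `λ ⊗ 1 : H ⊗ M → M` -/
noncomputable def lam1 {M : Type*} [AddCommGroup M] [Module K M] (l : H →ₗ[K] K) : H ⊗[K] M →ₗ[K] M :=
  (TensorProduct.lid K M).toLinearMap ∘ₗ l.rTensor M

noncomputable def lam2 {M : Type*} [AddCommGroup M] [Module K M] (l : H →ₗ[K] K) : M ⊗[K] H →ₗ[K] M :=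
  (TensorProduct.rid K M).toLinearMap ∘ₗ l.lTensor M

@[simp] lemma lam1_tmul {M : Type*} [AddCommGroup M] [Module K M] (l : H →ₗ[K] K) (h : H) (m : M) :
    lam1 l (h ⊗ₜ m) = l h • m := by simp [lam1]

@[simp] lemma lam2_tmul {M : Type*} [AddCommGroup M] [Module K M] (l : H →ₗ[K] K) (h : H) (m : M) :
    lam2 l (m ⊗ₜ h) = l h • m := by simp [lam2]

lemma lam1_mul_right {E : Type*} [Ring E] [Algebra K E] (l : H →ₗ[K] K) (t : H ⊗[K] E) (y : E) :
    lam1 l (t * (1 ⊗ₜ y)) = lam1 l t * y := by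
  induction t with
  | zero => simp
  | tmul a b => simp
  | add a b ha hb => simp [add_mul, ha, hb]

lemma lam1_mul_left {E : Type*} [Ring E] [Algebra K E] (l : H →ₗ[K] K) (t : H ⊗[K] E) (y : E) :
    lam1 l ((1 ⊗ₜ y) * t) = y * lam1 l t := by
  induction t with
  | zero => simp
  | tmul a b => simp
  | add a b ha hb => simp [mul_add, ha, hb]

lemma lam2_mul_right {E : Type*} [Ring E] [Algebra K E] (l : H →ₗ[K] K) (t : E ⊗[K] H) (y : E) :
    lam2 l (t * (y ⊗ₜ 1)) = lam2 l t * y := by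
  induction t with
  | zero => simp
  | tmul a b => simp
  | add a b ha hb => simp [add_mul, ha, hb]

lemma lam2_mul_left {E : Type*} [Ring E] [Algebra K E] (l : H →ₗ[K] K) (t : E ⊗[K] H) (y : E) :
    lam2 l ((y ⊗ₜ 1) * t) = y * lam2 l t := by
  induction t with
  | zero => simp
  | tmul a b => simp
  | add a b ha hb => simp [mul_add, ha, hb]

variable (K H) in
noncomputable def i1 : H →ₐ[K] H ⊗[K] H := Algebra.TensorProduct.includeLeft
variable (K H) in
noncomputable def i2 : H →ₐ[K] H ⊗[K] H := Algebra.TensorProduct.includeRight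

lemma i1_mul_i2 : toConv (i1 K H).toLinearMap * toConv (i2 K H).toLinearMap
    = toConv (comul (R := K) (A := H)) := by
  ext h
  rw [Coalgebra.Repr.convMul_apply (ℛ K h)]
  simp [i1, i2, (ℛ K h).eq]

lemma conv_alg_left {A : Type*} [Ring A] [Algebra K A] (f : H →ₐ[K] A) :
    toConv (f.toLinearMap ∘ₗ HopfAlgebra.antipode K (A := H)) * toConv f.toLinearMap = 1 := by
  ext h
  rw [Coalgebra.Repr.convMul_apply (ℛ K h)]
  simp only [LinearMap.comp_apply, AlgHom.toLinearMap_apply, ← map_mul, ← map_sum]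
  rw [HopfAlgebra.sum_antipode_mul_eq_smul]
  simp [LinearMap.convOne_def, Algebra.smul_def]

lemma conv_alg_right {A : Type*} [Ring A] [Algebra K A] (f : H →ₐ[K] A) :
    toConv f.toLinearMap * toConv (f.toLinearMap ∘ₗ HopfAlgebra.antipode K (A := H)) = 1 := by
  ext h
  rw [Coalgebra.Repr.convMul_apply (ℛ K h)]
  simp only [LinearMap.comp_apply, AlgHom.toLinearMap_apply, ← map_mul, ← map_sum]
  rw [HopfAlgebra.sum_mul_antipode_eq_smul]
  simp [LinearMap.convOne_def, Algebra.smul_def]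

lemma i1_eq : toConv (i1 K H).toLinearMap = toConv (comul (R := K) (A := H)) *
    toConv ((i2 K H).toLinearMap ∘ₗ HopfAlgebra.antipode K (A := H)) := by
  rw [← i1_mul_i2, mul_assoc, conv_alg_right, mul_one]

lemma i2_eq : toConv (i2 K H).toLinearMap = 
    toConv ((i1 K H).toLinearMap ∘ₗ HopfAlgebra.antipode K (A := H)) * toConv (comul (R := K) (A := H)) := by
  rw [← i1_mul_i2, ← mul_assoc, conv_alg_left, one_mul]

/-- `Δ ∘ S = (S ⊗ S) ∘ swap ∘ Δ` -/
lemma comul_antipode : (comul (R := K) (A := H)) ∘ₗ HopfAlgebra.antipode K (A := H) =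
    TensorProduct.map (HopfAlgebra.antipode K (A := H)) (HopfAlgebra.antipode K (A := H)) ∘ₗ
      (TensorProduct.comm K H H).toLinearMap ∘ₗ comul := by
  have h1 := LinearMap.comul_right_inv (R := K) (C := H)
  have h3 : toConv ((i2 K H).toLinearMap ∘ₗ HopfAlgebra.antipode K (A := H)) *
      toConv ((i1 K H).toLinearMap ∘ₗ HopfAlgebra.antipode K (A := H)) =
      toConv (TensorProduct.map (HopfAlgebra.antipode K (A := H)) (HopfAlgebra.antipode K (A := H)) ∘ₗ
      (TensorProduct.comm K H H).toLinearMap ∘ₗ comul) := by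
    ext h
    rw [Coalgebra.Repr.convMul_apply (ℛ K h)]
    simp [i1, i2]
    conv_rhs => rw [← (ℛ K h).eq]
    simp
  have h2 : toConv ((i2 K H).toLinearMap ∘ₗ HopfAlgebra.antipode K (A := H)) *
      toConv ((i1 K H).toLinearMap ∘ₗ HopfAlgebra.antipode K (A := H)) * toConv (comul (R := K) (A := H)) = 1 := by
    rw [mul_assoc, ← i2_eq, conv_alg_left]
  rw [h3] at h2
  have := left_inv_eq_right_inv h2 h1
  exact (WithConv.toConv_injective this).symm

end Basic
end HopfEven

open scoped TensorProduct
open WithConv Coalgebra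

namespace HopfEven

section Basic
set_option linter.unusedSectionVars false
variable {K H : Type*} [Field K] [Ring H] [HopfAlgebra K H]

local notation "S" => HopfAlgebra.antipode K (A := H)
local notation "Δ" => comul (R := K) (A := H)
local notation "ε" => counit (R := K) (A := H)

lemma conv_mul_const {A : Type*} [Ring A] [Algebra K A] (f g : WithConv (H →ₗ[K] A)) (c : A)
    (hg : ∀ h, g.ofConv h * c = ε h • c) (h : H) : (f * g).ofConv h * c = f.ofConv h * c := by
  have : (f * g).ofConv h = _ := Coalgebra.Repr.convMul_apply (ℛ K h) f g
  rw [this, Finset.sum_mul]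
  simp_rw [mul_assoc]
  have : ∀ i, g ((ℛ K h).right i) * c = ε ((ℛ K h).right i) • c := fun i => hg _
  simp_rw [this, mul_smul_comm, ← smul_mul_assoc, ← Finset.sum_mul]
  congr 1
  have h2 := LinearMap.congr_fun (congrArg ofConv (mul_one f)) h
  rw [← h2]
  erw [Coalgebra.Repr.convMul_apply (ℛ K h)]
  simp [LinearMap.convOne_def, Algebra.smul_def, Algebra.commutes]

lemma const_mul_conv {A : Type*} [Ring A] [Algebra K A] (f g : WithConv (H →ₗ[K] A)) (c : A)
    (hf : ∀ h, c * f.ofConv h = ε h • c) (h : H) : c * (f * g).ofConv h = c * g.ofConv h := by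
  have : (f * g).ofConv h = _ := Coalgebra.Repr.convMul_apply (ℛ K h) f g
  rw [this, Finset.mul_sum]
  simp_rw [← mul_assoc]
  have : ∀ i, c * f ((ℛ K h).left i) = ε ((ℛ K h).left i) • c := fun i => hf _
  simp_rw [this, smul_mul_assoc, ← mul_smul_comm, ← Finset.mul_sum]
  congr 1
  have h2 := Coalgebra.sum_counit_smul (R := K) (ℛ K h)
  conv_rhs => rw [← h2]
  simp

lemma int_A {L : H} (hL : ∀ h, h * L = ε h • L) (h : H) :
    ((1 : H) ⊗ₜ[K] h) * Δ L = (S h ⊗ₜ 1) * Δ L := by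
  have := conv_mul_const (K := K) (H := H) (toConv ((i1 K H).toLinearMap ∘ₗ S)) (toConv Δ) (Δ L)
    (by intro h; simp [← Bialgebra.comul_mul, hL]) h
  rw [← i2_eq] at this
  simpa [i1, i2] using this

lemma int_B {L : H} (hL : ∀ h, L * h = ε h • L) (h : H) :
    Δ L * (h ⊗ₜ[K] (1 : H)) = Δ L * (1 ⊗ₜ S h) := by
  have := const_mul_conv (K := K) (H := H) (toConv Δ) (toConv ((i2 K H).toLinearMap ∘ₗ S)) (Δ L)
    (by intro h; simp [← Bialgebra.comul_mul, hL]) h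
  rw [← i1_eq] at this
  simpa [i1, i2] using this

/-- left and right normalized cointegrals coincide -/
lemma lam_unique {l r : H →ₗ[K] K} (hl : ∀ x, lam1 l (Δ x) = l x • (1 : H)) (l1 : l 1 = 1)
    (hr : ∀ x, lam2 r (Δ x) = r x • (1 : H)) (r1 : r 1 = 1) : l = r := by
  ext x
  have e1 : ∀ t : H ⊗[K] H, r (lam1 l t) = l (lam2 r t) := by
    intro t
    induction t with
    | zero => simp
    | tmul a b => simp [mul_comm]
    | add a b ha hb => simp [ha, hb]
  have := e1 (Δ x)
  simpa [hl, hr, l1, r1] using this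

lemma lam1_C {l : H →ₗ[K] K} (hl : ∀ x, lam1 l (Δ x) = l x • (1 : H)) (h g : H) :
    lam1 l (Δ h * (g ⊗ₜ 1)) = ∑ i ∈ (ℛ K g).index, l (h * (ℛ K g).left i) • S ((ℛ K g).right i) := by
  have h1 : g ⊗ₜ[K] (1 : H) = _ := congrArg (fun f => f.ofConv g) (i1_eq (K := K) (H := H))
  have h2 := Coalgebra.Repr.convMul_apply (ℛ K g) (toConv Δ) (toConv ((i2 K H).toLinearMap ∘ₗ S))
  rw [h1]
  erw [h2]
  simp only [Finset.mul_sum, map_sum]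
  refine Finset.sum_congr rfl fun i _ => ?_
  change lam1 l (Δ h * (Δ _ * (1 ⊗ₜ _))) = _
  rw [← mul_assoc, lam1_mul_right, ← Bialgebra.comul_mul, hl]
  simp
  
lemma lam_nondeg_aux [FiniteDimensional K H] {l : H →ₗ[K] K} (hl : ∀ x, lam1 l (Δ x) = l x • (1 : H))
    (l1 : l 1 = 1) (h : H) (hh : ∀ g, l (h * g) = 0) :
    ∃ r : Coalgebra.Repr K h (Fin (Module.finrank K H)), (∀ k g, l (r.left k * g) = 0) ∧ ε h = 0 := by
  let b := Module.finBasis K H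
  obtain ⟨a, ha⟩ : ∃ a : Fin (Module.finrank K H) → H, ∑ k, a k ⊗ₜ[K] b k = Δ h := by
    generalize Δ h = t
    induction t with
    | zero => exact ⟨0, by simp⟩
    | tmul x y =>
      refine ⟨fun k => b.repr y k • x, ?_⟩
      simp_rw [TensorProduct.smul_tmul, ← TensorProduct.tmul_sum]
      rw [b.sum_repr]
    | add s t hs ht =>
      obtain ⟨a, ha⟩ := hs
      obtain ⟨c, hc⟩ := ht
      exact ⟨a + c, by simp [TensorProduct.add_tmul, Finset.sum_add_distrib, ha, hc]⟩
  have key : ∀ k g, l (a k * g) = 0 := by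
    intro k g
    have h1 := lam1_C hl h g
    rw [← ha] at h1
    simp only [hh, zero_smul, Finset.sum_const_zero, Finset.sum_mul, map_sum] at h1
    simp only [Algebra.TensorProduct.tmul_mul_tmul, mul_one, lam1_tmul] at h1
    have := Fintype.linearIndependent_iff.1 b.linearIndependent _ h1 k
    exact this
  refine ⟨⟨Finset.univ, a, b, ha⟩, key, ?_⟩
  have := HopfAlgebra.sum_mul_antipode_eq_smul (R := K)
    (⟨Finset.univ, a, b, ha⟩ : Coalgebra.Repr K h (Fin (Module.finrank K H)))
  have := congrArg l this
  simpa [key, l1] using this.symm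

lemma lam_nondeg [FiniteDimensional K H] {l : H →ₗ[K] K} (hl : ∀ x, lam1 l (Δ x) = l x • (1 : H))
    (l1 : l 1 = 1) (h : H) (hh : ∀ g, l (h * g) = 0) : h = 0 := by
  obtain ⟨r, hr, -⟩ := lam_nondeg_aux hl l1 h hh
  have ea : ∀ k, ε (r.left k) = 0 := fun k => (lam_nondeg_aux hl l1 _ (hr k)).choose_spec.2
  have := Coalgebra.sum_counit_smul (R := K) r
  rw [← this]
  exact Finset.sum_eq_zero fun i _ => by simp [ea]

/-- Two-sided normalized integral in `H`. -/
structure IsHopfInt (L : H) : Prop where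
  left : ∀ h, h * L = ε h • L
  right : ∀ h, L * h = ε h • L
  one : ε L = 1

lemma lam_L_ne [FiniteDimensional K H] {l : H →ₗ[K] K} (hl : ∀ x, lam1 l (Δ x) = l x • (1 : H))
    (l1 : l 1 = 1) {L : H} (hL : IsHopfInt (K := K) L) : l L ≠ 0 := by
  intro h0
  have : L = 0 := lam_nondeg hl l1 L (by intro g; simp [hL.right, h0])
  have h1 := hL.one
  simp [this] at h1

lemma S_injective [FiniteDimensional K H] {l : H →ₗ[K] K} (hl : ∀ x, lam1 l (Δ x) = l x • (1 : H))
    (l1 : l 1 = 1) {L : H} (hL : IsHopfInt (K := K) L) : Function.Injective S := by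
  rw [injective_iff_map_eq_zero]
  intro h hh
  have h1 := congrArg (lam1 l) (int_A hL.left h)
  rw [hh, lam1_mul_left, hl] at h1
  simpa [lam_L_ne hl l1 hL] using h1

lemma lam_S [FiniteDimensional K H] {l : H →ₗ[K] K} (hl : ∀ x, lam1 l (Δ x) = l x • (1 : H))
    (l1 : l 1 = 1) {L : H} (hL : IsHopfInt (K := K) L) :
    (∀ x, l (S x) = l x) ∧ ∀ x, lam2 l (Δ x) = l x • (1 : H) := by
  have hr : ∀ x, lam1 l (Δ (S x)) = S (lam2 (l ∘ₗ S) (Δ x)) := by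
    intro x
    have := LinearMap.congr_fun (comul_antipode (K := K) (H := H)) x
    simp only [LinearMap.comp_apply] at this
    rw [this]
    generalize Δ x = t
    induction t with
    | zero => simp
    | tmul a b => simp
    | add a b ha hb => simp [ha, hb] at *
  have h2 : ∀ x, lam2 (l ∘ₗ S) (Δ x) = (l ∘ₗ S) x • (1 : H) := by
    intro x
    apply S_injective hl l1 hL
    rw [← hr, hl]
    simp
  have h3 := lam_unique hl l1 h2 (by simpa using l1)
  rw [← h3] at h2
  exact ⟨fun x => (LinearMap.congr_fun h3 x).symm, h2⟩

/-- A compatible pair of (two-sided) integrals. -/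
structure Frob (L : H) (l : H →ₗ[K] K) : Prop where
  int : IsHopfInt (K := K) L
  left : ∀ x, lam1 l (Δ x) = l x • (1 : H)
  right : ∀ x, lam2 l (Δ x) = l x • (1 : H)
  norm : l L = 1
  one : l 1 ≠ 0
  S_eq : ∀ x, l (S x) = l x
  nondeg : ∀ h, (∀ g, l (h * g) = 0) → h = 0

lemma exists_frob [FiniteDimensional K H] {l : H →ₗ[K] K} (hl : ∀ x, lam1 l (Δ x) = l x • (1 : H))
    (l1 : l 1 = 1) {L : H} (hL : IsHopfInt (K := K) L) : ∃ c : K, Frob L (c • l) := by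
  have h0 := lam_L_ne hl l1 hL
  have hs := lam_S hl l1 hL
  have e1 : ∀ c : K, ∀ t : H ⊗[K] H, lam1 (c • l) t = c • lam1 l t := by
    intro c t
    induction t with
    | zero => simp
    | tmul a b => simp [mul_smul]
    | add a b ha hb => simp [ha, hb]
  have e2 : ∀ c : K, ∀ t : H ⊗[K] H, lam2 (c • l) t = c • lam2 l t := by
    intro c t
    induction t with
    | zero => simp
    | tmul a b => simp [mul_smul]
    | add a b ha hb => simp [ha, hb]
  refine ⟨(l L)⁻¹, hL, ?_, ?_, ?_, ?_, ?_, ?_⟩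
  · intro x; simp [e1, hl, mul_smul]
  · intro x; simp [e2, hs.2, mul_smul]
  · simp [h0]
  · simp [h0, l1]
  · intro x; simp [hs.1]
  · intro h hh
    exact lam_nondeg hl l1 h (by intro g; simpa [h0] using hh g)

namespace Frob
variable [FiniteDimensional K H] {L : H} {l : H →ₗ[K] K}

lemma S_formula (F : Frob L l) (g : H) : lam1 l (Δ L * (g ⊗ₜ 1)) = S g := by
  rw [int_B F.int.right, lam1_mul_right, F.left, F.norm]; simp

lemma id_formula (F : Frob L l) (h : H) : lam1 l ((S h ⊗ₜ 1) * Δ L) = h := by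
  rw [← int_A F.int.left, lam1_mul_left, F.left, F.norm]; simp

lemma id_formula' (F : Frob L l) (h : H) : lam2 l (Δ L * (1 ⊗ₜ S h)) = h := by
  rw [← int_B F.int.right, lam2_mul_right, F.right, F.norm]; simp

/-- every functional is `l (· * g)` -/
lemma exists_rep (F : Frob L l) (p : H →ₗ[K] K) : ∃ g, ∀ x, p x = l (x * g) := by
  let T : H →ₗ[K] Module.Dual K H := (LinearMap.mul K H).compr₂ l
  have hT : Function.Injective T := by
    rw [injective_iff_map_eq_zero]
    intro h hh
    exact F.nondeg h fun g => LinearMap.congr_fun hh g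
  have hT' : Function.Injective T.flip := by
    rw [injective_iff_map_eq_zero]
    intro g hg
    have hs : Function.Surjective T :=
      (LinearMap.injective_iff_surjective_of_finrank_eq_finrank
        (Subspace.dual_finrank_eq (K := K) (V := H)).symm).1 hT
    rw [← Module.forall_dual_apply_eq_zero_iff K]
    intro f
    obtain ⟨h, rfl⟩ := hs f
    exact LinearMap.congr_fun hg h
  have hs : Function.Surjective T.flip :=
      (LinearMap.injective_iff_surjective_of_finrank_eq_finrank
        (Subspace.dual_finrank_eq (K := K) (V := H)).symm).1 hT'
  obtain ⟨g, hg⟩ := hs p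
  exact ⟨g, fun x => by rw [← hg]; rfl⟩

lemma lam1_comp_mulRight (l : H →ₗ[K] K) (g : H) (t : H ⊗[K] H) :
    lam1 (l ∘ₗ LinearMap.mulRight K g) t = lam1 l (t * (g ⊗ₜ 1)) := by
  induction t with
  | zero => simp
  | tmul a b => simp
  | add a b ha hb => simp [add_mul, ha, hb]

lemma lam1_comp_mulLeft (l : H →ₗ[K] K) (g : H) (t : H ⊗[K] H) :
    lam1 (l ∘ₗ LinearMap.mulLeft K g) t = lam1 l ((g ⊗ₜ 1) * t) := by
  induction t with
  | zero => simp
  | tmul a b => simp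
  | add a b ha hb => simp [mul_add, ha, hb]

lemma lam2_comp_mulRight (l : H →ₗ[K] K) (g : H) (t : H ⊗[K] H) :
    lam2 (l ∘ₗ LinearMap.mulRight K g) t = lam2 l (t * (1 ⊗ₜ g)) := by
  induction t with
  | zero => simp
  | tmul a b => simp
  | add a b ha hb => simp [add_mul, ha, hb]

lemma S_inj (F : Frob L l) : Function.Injective S := by
  rw [injective_iff_map_eq_zero]
  intro h hh
  rw [← F.id_formula h, hh]
  simp

lemma nakayama (F : Frob L l) (x g : H) : l (x * g) = l (S (S g) * x) := by
  have e : ∀ p : H →ₗ[K] K, lam1 p (Δ L) = 0 → p = 0 := by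
    intro p hp
    obtain ⟨g, hg⟩ := F.exists_rep p
    have : p = l ∘ₗ LinearMap.mulRight K g := by ext x; simp [hg]
    rw [this, lam1_comp_mulRight, F.S_formula] at hp
    have := F.S_inj (hp.trans (map_zero _).symm)
    ext x
    simp [hg, this]
  have h1 : lam1 (l ∘ₗ LinearMap.mulRight K g - l ∘ₗ LinearMap.mulLeft K (S (S g))) (Δ L) = 0 := by
    have : ∀ p q : H →ₗ[K] K, ∀ t : H ⊗[K] H, lam1 (p - q) t = lam1 p t - lam1 q t := by
      intro p q t; simp [lam1, LinearMap.rTensor_sub]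
    rw [this, lam1_comp_mulRight, lam1_comp_mulLeft, F.S_formula, F.id_formula, sub_self]
  have := LinearMap.congr_fun (e _ h1) x
  simpa [sub_eq_zero] using this

lemma S4 (F : Frob L l) (x : H) : S (S (S (S x))) = x := by
  rw [← sub_eq_zero]
  apply F.nondeg
  intro g
  have h1 : l (x * g) = l (S (S (S (S x))) * g) := by
    rw [← F.S_eq, HopfAlgebra.antipode_mul_antidistrib, F.nakayama,
      ← HopfAlgebra.antipode_mul_antidistrib, F.S_eq, F.nakayama]
  rw [sub_mul, map_sub, h1, sub_self]

lemma S_L (F : Frob L l) : S L = L := by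
  have := F.S_formula 1
  have h2 := F.int.left (S L)
  have h3 : ∀ h, S L * S h = ε h • S L := by
    intro h; rw [← HopfAlgebra.antipode_mul_antidistrib, F.int.left]; simp
  have h4 : S L * L = S L := by
    have := h3 (S (S (S L)))
    rw [F.S4] at this
    simpa [F.int.one] using this
  rw [← h4, h2]
  simp [F.int.one]

/-- trace formula -/
lemma trace_formula (F : Frob L l) (f : H →ₗ[K] H) : LinearMap.trace K H f = 
    l (LinearMap.mul' K H (TensorProduct.map LinearMap.id (S ∘ₗ f) (TensorProduct.comm K H H (Δ L)))) := by
  let r := ℛ K L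
  have hid : ∀ h, h = ∑ i ∈ r.index, l (r.right i * S h) • r.left i := by
    intro h
    conv_lhs => rw [← F.id_formula' h, ← r.eq]
    simp [Finset.sum_mul]
  have hf : f = ∑ i ∈ r.index, 
      (l ∘ₗ LinearMap.mulLeft K (r.right i) ∘ₗ S).smulRight (f (r.left i)) := by
    ext h
    conv_lhs => rw [hid h]
    simp
  conv_lhs => rw [hf]
  rw [← r.eq]
  simp only [map_sum, LinearMap.trace_smulRight]
  simp

lemma lam1_comul (p : H →ₗ[K] K) : lam1 p ∘ₗ Δ = 
    (toConv (Algebra.linearMap K H ∘ₗ p) * toConv LinearMap.id).ofConv := by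
  ext x
  erw [Coalgebra.Repr.convMul_apply (ℛ K x)]
  rw [LinearMap.comp_apply, ← (ℛ K x).eq]
  simp [Algebra.smul_def]

lemma trace_S2 (F : Frob L l) (p : H →ₗ[K] K) : LinearMap.trace K H (S ∘ₗ S ∘ₗ lam1 p ∘ₗ Δ) = l 1 * p L := by
  rw [F.trace_formula, ← F.S_eq]
  have h1 : p L • (1 : H) = ((toConv (Algebra.linearMap K H ∘ₗ p) * toConv LinearMap.id) * toConv S).ofConv L := by
    rw [mul_assoc, LinearMap.id_mul_antipode, mul_one]
    simp [Algebra.smul_def]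
  have h2 : l 1 * p L = l (p L • (1 : H)) := by simp [mul_comm]
  rw [h2, h1]
  erw [Coalgebra.Repr.convMul_apply (ℛ K L)]
  rw [← lam1_comul, ← (ℛ K L).eq]
  simp [HopfAlgebra.antipode_mul_antidistrib, F.S4]

lemma trace_lam1 (F : Frob L l) (hS : ∀ x, S (S x) = x) (p : H →ₗ[K] K) :
    LinearMap.trace K H (lam1 p ∘ₗ Δ) = l 1 * p L := by
  rw [← F.trace_S2]
  congr 1
  ext x
  simp [hS]

lemma conv_comm_L (F : Frob L l) (hS : ∀ x, S (S x) = x) (p q : H →ₗ[K] K) :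
    (toConv p * toConv q).ofConv L = (toConv q * toConv p).ofConv L := by
  obtain ⟨g, hg⟩ := F.exists_rep p
  have hp : p = l ∘ₗ LinearMap.mulRight K g := by ext x; simp [hg]
  have h1 : (toConv p * toConv q).ofConv L = q (lam1 p (Δ L)) := by
    erw [Coalgebra.Repr.convMul_apply (ℛ K L)]
    rw [← (ℛ K L).eq]
    simp
  have h2 : (toConv q * toConv p).ofConv L = q (lam2 p (Δ L)) := by
    erw [Coalgebra.Repr.convMul_apply (ℛ K L)]
    rw [← (ℛ K L).eq]
    simp [mul_comm]
  rw [h1, h2, hp, lam1_comp_mulRight, lam2_comp_mulRight, F.S_formula, ← F.id_formula' (S g), hS]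

end Frob

end Basic
end HopfEven

open scoped TensorProduct
open WithConv Coalgebra

namespace HopfEven

section Idem
variable {K V : Type*} [Field K] [AddCommGroup V] [Module K V] [FiniteDimensional K V]

lemma trace_idem (e : V →ₗ[K] V) (he : e ∘ₗ e = e) :
    ∃ r : ℕ, r ≤ Module.finrank K V ∧ LinearMap.trace K V e = r ∧ (r = 0 → e = 0) ∧
      (r = Module.finrank K V → e = LinearMap.id) := by
  have hp : LinearMap.IsProj (LinearMap.range e) e := ⟨fun x => ⟨x, rfl⟩, by
    rintro _ ⟨x, rfl⟩
    exact LinearMap.congr_fun he x⟩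
  refine ⟨Module.finrank K (LinearMap.range e), Submodule.finrank_le _, ?_, ?_, ?_⟩
  · exact hp.trace
  · intro h
    rw [Submodule.finrank_eq_zero] at h
    exact LinearMap.range_eq_bot.1 h
  · intro h
    have h1 := Submodule.eq_top_of_finrank_eq h
    ext x
    exact hp.map_id x (by rw [h1]; trivial)

/-- Traces of maps with `F³ = F`. -/
lemma trace_cube (h2 : (2 : K) ≠ 0) (F : V →ₗ[K] V) (hF : F ∘ₗ F ∘ₗ F = F) :
    ∃ r s : ℕ, LinearMap.trace K V F = (r : K) - s ∧ LinearMap.trace K V (F ∘ₗ F) = (r : K) + s := by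
  have hF' : ∀ x, F (F (F x)) = F x := fun x => LinearMap.congr_fun hF x
  obtain ⟨r, -, hr, -⟩ := trace_idem ((2 : K)⁻¹ • (F ∘ₗ F + F)) (by
    ext x
    simp only [LinearMap.comp_apply, LinearMap.smul_apply, LinearMap.add_apply, map_smul, map_add, hF', smul_smul, ← smul_add]
    have : F (F x) + F x + (F x + F (F x)) = (2 : K) • (F (F x) + F x) := by rw [two_smul]; abel
    rw [this, smul_smul]
    congr 1
    field_simp)
  obtain ⟨s, -, hs, -⟩ := trace_idem ((2 : K)⁻¹ • (F ∘ₗ F - F)) (by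
    ext x
    simp only [LinearMap.comp_apply, LinearMap.smul_apply, LinearMap.sub_apply, map_smul, map_sub, hF', smul_smul, ← smul_sub]
    have : F (F x) - F x - (F x - F (F x)) = (2 : K) • (F (F x) - F x) := by rw [two_smul]; abel
    rw [this, smul_smul]
    congr 1
    field_simp)
  refine ⟨r, s, ?_, ?_⟩
  · rw [← hr, ← hs, ← map_sub]
    congr 1
    ext x
    simp only [LinearMap.smul_apply, LinearMap.sub_apply, LinearMap.add_apply]
    rw [← smul_sub, inv_smul_eq_iff₀ h2 |>.2]
    rw [two_smul]; abel
  · rw [← hr, ← hs, ← map_add]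
    congr 1
    ext x
    simp only [LinearMap.smul_apply, LinearMap.sub_apply, LinearMap.add_apply]
    rw [← smul_add, inv_smul_eq_iff₀ h2 |>.2]
    rw [two_smul]; abel

end Idem

section Char0
set_option linter.unusedSectionVars false
variable {K H : Type*} [Field K] [Ring H] [HopfAlgebra K H] [FiniteDimensional K H]
local notation "S" => HopfAlgebra.antipode K (A := H)
local notation "Δ" => comul (R := K) (A := H)
local notation "ε" => counit (R := K) (A := H)

variable (K H) in
/-- regular character -/
noncomputable def regc : H →ₗ[K] K := LinearMap.trace K H ∘ₗ LinearMap.mul K H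

lemma regc_conv (h : H) : (toConv (regc K H) * toConv (regc K H)).ofConv h = Module.finrank K H * regc K H h := by
  let T : H ⊗[K] H →ₗ[K] H ⊗[K] H := TensorProduct.lift
    (((LinearMap.mul K (H ⊗[K] H)).compl₂ (i2 K H).toLinearMap) ∘ₗ Δ)
  have hT : ∀ a b, T (a ⊗ₜ b) = Δ a * (1 ⊗ₜ b) := fun a b => rfl
  have hs : Function.Surjective T := by
    intro t
    induction t with
    | zero => exact ⟨0, map_zero _⟩
    | add a b ha hb =>
      obtain ⟨x, rfl⟩ := ha
      obtain ⟨y, rfl⟩ := hb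
      exact ⟨x + y, map_add _ _ _⟩
    | tmul a b =>
      refine ⟨∑ i ∈ (ℛ K a).index, (ℛ K a).left i ⊗ₜ (S ((ℛ K a).right i) * b), ?_⟩
      have h1 : a ⊗ₜ[K] (1 : H) = _ := congrArg (fun f => f.ofConv a) (i1_eq (K := K) (H := H))
      have h2 := Coalgebra.Repr.convMul_apply (ℛ K a) (toConv Δ) (toConv ((i2 K H).toLinearMap ∘ₗ S))
      have h3 : a ⊗ₜ[K] b = (a ⊗ₜ 1) * (1 ⊗ₜ b) := by simp
      rw [h3, h1]
      erw [h2]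
      simp only [map_sum, hT, Finset.sum_mul]
      refine Finset.sum_congr rfl fun i _ => ?_
      simp [i2, mul_assoc]
  have hi : Function.Injective T := LinearMap.injective_iff_surjective.2 hs
  let e := LinearEquiv.ofBijective T ⟨hi, hs⟩
  have h1 : e.conj (TensorProduct.map (LinearMap.mulLeft K h) LinearMap.id) = LinearMap.mulLeft K (Δ h) := by
    refine LinearMap.ext fun t => ?_
    obtain ⟨u, rfl⟩ := e.surjective t
    rw [LinearEquiv.conj_apply_apply, e.symm_apply_apply]
    change T _ = Δ h * T u
    induction u with
    | zero => simp
    | add a b ha hb => simp only [map_add, mul_add, ha, hb]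
    | tmul a b => simp [hT, mul_assoc]
  have h2 := LinearMap.trace_conj' (TensorProduct.map (LinearMap.mulLeft K h) LinearMap.id) e
  rw [h1, LinearMap.trace_tensorProduct', LinearMap.trace_id] at h2
  erw [Coalgebra.Repr.convMul_apply (ℛ K h)]
  have h3 : LinearMap.mulLeft K (Δ h) = ∑ i ∈ (ℛ K h).index,
      TensorProduct.map (LinearMap.mulLeft K ((ℛ K h).left i)) (LinearMap.mulLeft K ((ℛ K h).right i)) := by
    conv_lhs => rw [← (ℛ K h).eq]
    ext a b
    simp [Finset.sum_mul]
  rw [h3] at h2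
  simp only [map_sum, LinearMap.trace_tensorProduct'] at h2
  rw [mul_comm]
  exact h2

variable {L : H} {l : H →ₗ[K] K}

lemma regc_S2 (F : Frob L l) (h : H) : regc K H (S (S h)) = regc K H h := by
  let T : H →ₗ[K] H := S ∘ₗ S
  have hT : ∀ x y, T (x * y) = T x * T y := by
    intro x y; simp [T, HopfAlgebra.antipode_mul_antidistrib]
  have hi : Function.Bijective T := by
    refine ⟨F.S_inj.comp F.S_inj, fun x => ⟨T x, F.S4 x⟩⟩
  let e := LinearEquiv.ofBijective T hi
  have h2 := LinearMap.trace_conj' (LinearMap.mulLeft K h) e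
  have h3 : e.conj (LinearMap.mulLeft K h) = LinearMap.mulLeft K (T h) := by
    ext t
    obtain ⟨u, rfl⟩ := e.surjective t
    rw [LinearEquiv.conj_apply_apply, e.symm_apply_apply]
    exact hT _ _
  rw [h3] at h2
  exact h2

lemma regc_L (F : Frob L l) : regc K H L = 1 := by
  have : LinearMap.mulLeft K L = (ε).smulRight L := by
    ext x; simp [F.int.right]
  have h := congrArg (LinearMap.trace K H) this
  rw [LinearMap.trace_smulRight, F.int.one] at h
  exact h

lemma lam1_lam1 (p q : H →ₗ[K] K) (h : H) : lam1 p (Δ (lam1 q (Δ h))) =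
    lam1 (toConv q * toConv p).ofConv (Δ h) := by
  have h1 : ∀ t : H ⊗[K] H, Δ (lam1 q t) = lam1 q ((Δ).lTensor H t) := by
    intro t
    induction t with
    | zero => simp
    | add a b ha hb => simp only [map_add, ha, hb]
    | tmul a b => simp
  rw [h1, ← Coalgebra.coassoc_apply]
  generalize Δ h = t
  induction t with
  | zero => simp
  | add a b ha hb => simp only [map_add, ha, hb]
  | tmul a b => 
    simp only [LinearMap.rTensor_tmul, lam1_tmul]
    have : (toConv q * toConv p).ofConv a = _ := Coalgebra.Repr.convMul_apply (ℛ K a) (toConv q) (toConv p)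
    rw [this, ← (ℛ K a).eq]
    simp [TensorProduct.sum_tmul, Finset.sum_smul, mul_smul]

lemma comul_S2 (h : H) : Δ (S (S h)) = TensorProduct.map (S ∘ₗ S) (S ∘ₗ S) (Δ h) := by
  have h1 : ∀ x, Δ (S x) = _ := fun x => LinearMap.congr_fun (comul_antipode (K := K) (H := H)) x
  rw [h1]
  simp only [LinearMap.comp_apply]
  rw [h1]
  simp only [LinearMap.comp_apply]
  generalize Δ h = t
  induction t with
  | zero => simp
  | add a b ha hb => simp only [map_add, ha, hb]
  | tmul a b => simp

theorem S_sq [CharZero K] (F : Frob L l) (x : H) : S (S x) = x := by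
  let n : ℕ := Module.finrank K H
  have hn : (n : K) ≠ 0 := by
    have : Nontrivial H := ⟨⟨1, 0, fun h => F.one (by rw [h, map_zero])⟩⟩
    exact_mod_cast (Module.finrank_pos (R := K) (M := H)).ne'
  let G : H →ₗ[K] H := lam1 (regc K H) ∘ₗ Δ
  have hGG : ∀ h, G (G h) = (n : K) • G h := by
    intro h
    have h1 := lam1_lam1 (regc K H) (regc K H) h
    have h2 : (toConv (regc K H) * toConv (regc K H)).ofConv = (n : K) • regc K H := by
      ext h; exact regc_conv h
    have h3 : ∀ t : H ⊗[K] H, lam1 ((n : K) • regc K H) t = (n : K) • lam1 (regc K H) t := by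
      intro t
      simp [lam1, LinearMap.rTensor_smul]
    rw [h2, h3] at h1
    exact h1
  have hGS : ∀ h, G (S (S h)) = S (S (G h)) := by
    intro h
    simp only [G, LinearMap.comp_apply]
    rw [comul_S2]
    generalize Δ h = t
    induction t with
    | zero => simp
    | add a b ha hb => simp only [map_add, ha, hb]
    | tmul a b => simp [regc_S2 F]
  have htr : LinearMap.trace K H (S ∘ₗ S ∘ₗ G) = l 1 := by
    have := F.trace_S2 (regc K H)
    rw [regc_L F, mul_one] at this
    exact this
  have htr2 : LinearMap.trace K H (S ∘ₗ S) = l 1 := by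
    have := F.trace_S2 ε
    rw [F.int.one, mul_one] at this
    rw [← this]
    congr 1
    ext h
    have : lam1 ε (Δ h) = h := by
      rw [lam1, LinearMap.comp_apply, Coalgebra.rTensor_counit_comul]; simp
    simp [this]
  obtain ⟨r, s, h1, -⟩ := trace_cube (two_ne_zero) ((n : K)⁻¹ • (S ∘ₗ S ∘ₗ G)) (by
    ext h
    simp only [LinearMap.comp_apply, LinearMap.smul_apply, map_smul, hGS, hGG, F.S4, smul_smul]
    congr 1
    field_simp)
  obtain ⟨k, hk, h2, hk0, hk1⟩ := trace_idem ((2 : K)⁻¹ • (LinearMap.id + S ∘ₗ S)) (by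
    ext h
    simp only [LinearMap.comp_apply, LinearMap.smul_apply, LinearMap.add_apply, map_smul, map_add, F.S4, smul_smul,
      LinearMap.id_apply, ← smul_add]
    have : h + S (S h) + (S (S h) + h) = (2 : K) • (h + S (S h)) := by rw [two_smul]; abel
    rw [this, smul_smul]
    congr 1
    field_simp)
  rw [map_smul, htr, smul_eq_mul, inv_mul_eq_iff_eq_mul₀ hn] at h1
  rw [map_smul, map_add, htr2, smul_eq_mul, inv_mul_eq_iff_eq_mul₀ two_ne_zero, LinearMap.trace_id, h1] at h2
  have hl1 : (r : K) - s ≠ 0 := by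
    intro h0; rw [h0, mul_zero] at h1; exact F.one h1
  have h3 : (n : ℤ) + n * (r - s) = 2 * k := by exact_mod_cast h2
  have h4 : ((r : ℤ) - s) ≠ 0 := by exact_mod_cast hl1
  have hk' : k ≤ n := hk
  have hn' : 0 < n := Nat.pos_of_ne_zero (by exact_mod_cast hn)
  generalize (r : ℤ) - s = m at h3 h4
  have h5 : m ≤ 1 := by nlinarith
  have h6 : -1 ≤ m := by nlinarith
  have h7 : m = 1 ∨ m = -1 := by omega
  have hsmul : ∀ y : H, (2 : K)⁻¹ • (y + S (S y)) = y → S (S y) = y := by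
    intro y hy
    rw [inv_smul_eq_iff₀ two_ne_zero, two_smul] at hy
    exact add_left_cancel hy
  rcases h7 with rfl | rfl
  · have := hk1 (by change k = n; omega)
    exact hsmul x (LinearMap.congr_fun this x)
  · exfalso
    have := LinearMap.congr_fun (hk0 (by omega)) 1
    simp only [LinearMap.smul_apply, LinearMap.add_apply, LinearMap.comp_apply, LinearMap.id_apply,
      HopfAlgebra.antipode_one, LinearMap.zero_apply] at this
    rw [inv_smul_eq_iff₀ two_ne_zero, ← two_smul K, smul_zero] at this
    have h1 : (1 : H) = 0 := (smul_eq_zero_iff_right (two_ne_zero (α := K))).1 this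
    exact F.one (by rw [h1, map_zero])

lemma l_one [CharZero K] (F : Frob L l) : l 1 = Module.finrank K H := by
  have := F.trace_lam1 (S_sq F) ε
  rw [F.int.one, mul_one] at this
  rw [← this, ← LinearMap.trace_id]
  congr 1
  ext h
  have : lam1 ε (Δ h) = h := by
    rw [lam1, LinearMap.comp_apply, Coalgebra.rTensor_counit_comul]; simp
  simp [this]

end Char0
end HopfEven

open scoped TensorProduct
open WithConv Coalgebra

namespace HopfEven

section Integ
open Polynomial
variable {K : Type*} [Field K] [CharZero K]

lemma psum_formula {ι : Type*} [Fintype ι] (a : ι → K) (i : ι) :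
    ∃ q : K[X], (∀ k : ℕ, a i ^ k = ∑ j ∈ Finset.range (q.natDegree + 1), q.coeff j * ∑ t, a t ^ (k + j)) ∧
      ((∀ t, a t ∈ algebraicClosure ℚ K) → ∀ j, q.coeff j ∈ algebraicClosure ℚ K) := by
  classical
  let q₀ : K[X] := ∏ θ ∈ (Finset.univ.image a).erase (a i), (X - C θ)
  have h0 : ∀ t, a t ≠ a i → q₀.eval (a t) = 0 := by
    intro t ht
    rw [eval_prod]
    refine Finset.prod_eq_zero (i := a t) (by simp [ht]) (by simp)
  have h1 : q₀.eval (a i) ≠ 0 := by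
    rw [eval_prod, Finset.prod_ne_zero_iff]
    intro θ hθ
    simp only [eval_sub, eval_X, eval_C, ne_eq, sub_eq_zero]
    rw [Finset.mem_erase] at hθ
    exact fun h => hθ.1 h.symm
  let c : ℕ := (Finset.univ.filter fun t => a t = a i).card
  have hc : (c : K) ≠ 0 := by
    have : 0 < c := Finset.card_pos.2 ⟨i, by simp⟩
    exact_mod_cast this.ne'
  refine ⟨C (c * q₀.eval (a i))⁻¹ * q₀, fun k => ?_, fun h j => ?_⟩
  swap
  · rw [coeff_C_mul]
    refine mul_mem (inv_mem (mul_mem (natCast_mem _ _) ?_)) ?_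
    · rw [eval_prod]
      refine prod_mem fun θ hθ => ?_
      simp only [eval_sub, eval_X, eval_C]
      obtain ⟨t, -, rfl⟩ := Finset.mem_image.1 (Finset.mem_of_mem_erase hθ)
      exact sub_mem (h i) (h t)
    · have : q₀ ∈ lifts (algebraMap (algebraicClosure ℚ K) K) := by
        refine prod_mem fun θ hθ => ?_
        obtain ⟨t, -, rfl⟩ := Finset.mem_image.1 (Finset.mem_of_mem_erase hθ)
        exact ⟨X - C ⟨a t, h t⟩, by simp⟩
      obtain ⟨q', hq'⟩ := (mem_lifts _).1 this
      rw [← hq', coeff_map]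
      exact (q'.coeff j).2
  set q := C (c * q₀.eval (a i))⁻¹ * q₀ with hq
  have h2 : ∑ t, q.eval (a t) * a t ^ k = a i ^ k := by
    have h3 : ∀ t, q.eval (a t) * a t ^ k = if a t = a i then (c : K)⁻¹ * a i ^ k else 0 := by
      intro t
      split_ifs with h
      · rw [h, hq, eval_mul, eval_C]; field_simp
      · rw [hq, eval_mul, h0 t h]; simp
    simp_rw [h3]
    rw [← Finset.sum_filter, Finset.sum_const, nsmul_eq_mul]
    change (c : K) * _ = _
    field_simp
  rw [← h2]
  simp_rw [Finset.mul_sum]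
  rw [Finset.sum_comm]
  refine Finset.sum_congr rfl fun t _ => ?_
  rw [eval_eq_sum_range, Finset.sum_mul]
  refine Finset.sum_congr rfl fun j _ => ?_
  ring

lemma alg_of_psum {ι : Type*} [Fintype ι] (a : ι → K)
    (ha : ∀ k, 1 ≤ k → IsIntegral ℤ (∑ t, a t ^ k)) (i : ι) : IsIntegral ℚ (a i) := by
  obtain ⟨q, hq, -⟩ := psum_formula a i
  classical
  let B := algebraicClosure ℚ K
  have hB : ∀ k, ∑ t, a t ^ k ∈ B := by
    intro k
    rw [mem_algebraicClosure_iff]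
    rcases Nat.eq_zero_or_pos k with rfl | hk
    · simpa using isAlgebraic_natCast (R := ℚ) (A := K) _
    · exact ((ha k hk).tower_top (A := ℚ)).isAlgebraic
  suffices h : IsIntegral B (a i) by
    have : Algebra.IsAlgebraic ℚ B := algebraicClosure.isAlgebraic ℚ K
    have : Algebra.IsIntegral ℚ B := Algebra.IsAlgebraic.isIntegral
    exact isIntegral_trans (R := ℚ) (A := B) _ h
  let N : Submodule B K := Submodule.span B ((Finset.range (q.natDegree + 1)).image q.coeff : Finset K)
  have hN : ∀ k, a i ^ k ∈ N := by
    intro k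
    rw [hq k]
    refine Submodule.sum_mem _ fun j hj => ?_
    have : q.coeff j * ∑ t, a t ^ (k + j) = (⟨_, hB (k + j)⟩ : B) • q.coeff j := by
      rw [mul_comm]; rfl
    rw [this]
    refine Submodule.smul_mem _ _ (Submodule.subset_span ?_)
    exact Finset.mem_coe.2 (Finset.mem_image_of_mem _ hj)
  have hN1 : N.FG := ⟨_, rfl⟩
  have hle : Subalgebra.toSubmodule (Algebra.adjoin B {a i}) ≤ N := by
    rw [Algebra.adjoin_singleton_eq_range_aeval]
    rintro _ ⟨p, rfl⟩
    change aeval (a i) p ∈ N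
    rw [aeval_eq_sum_range]
    exact Submodule.sum_mem _ fun j _ => Submodule.smul_mem _ _ (hN j)
  have : Module.Finite B N := Module.Finite.iff_fg.2 hN1
  have hfg : (Subalgebra.toSubmodule (Algebra.adjoin B {a i})).FG := Submodule.FG.of_le hN1 hle
  exact IsIntegral.of_mem_of_fg _ hfg _ (Algebra.subset_adjoin rfl)

lemma int_of_almost (θ : K) (h1 : IsIntegral ℚ θ) (r : ℤ) (hr : r ≠ 0)
    (h : ∀ k : ℕ, IsIntegral ℤ ((r : K) * θ ^ k)) : IsIntegral ℤ θ := by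
  let F := IntermediateField.adjoin ℚ ({θ} : Set K)
  have : FiniteDimensional ℚ F := IntermediateField.adjoin.finiteDimensional h1
  have : NumberField F := { }
  let g : F := IntermediateField.AdjoinSimple.gen ℚ θ
  have hg : (algebraMap F K) g = θ := rfl
  have hinj : Function.Injective (algebraMap F K) := (algebraMap F K).injective
  have h2 : ∀ k : ℕ, IsIntegral ℤ ((r : F) * g ^ k) := by
    intro k
    rw [← isIntegral_algebraMap_iff (B := K) hinj]
    rw [map_mul, map_pow, hg, map_intCast]
    exact h k
  have h3 : IsAlmostIntegral (NumberField.RingOfIntegers F) g := by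
    refine ⟨(r : NumberField.RingOfIntegers F), ?_, fun k => ?_⟩
    · rw [mem_nonZeroDivisors_iff_ne_zero]
      exact_mod_cast hr
    · refine ⟨⟨_, h2 k⟩, ?_⟩
      rw [Algebra.smul_def, map_intCast]
      rfl
  have h4 : IsIntegral ℤ g := isIntegral_trans (R := ℤ) (A := NumberField.RingOfIntegers F) _ h3.isIntegral
  exact h4.map (IsScalarTower.toAlgHom ℤ F K)

lemma int_of_psum {ι : Type*} [Fintype ι] (a : ι → K)
    (ha : ∀ k, 1 ≤ k → IsIntegral ℤ (∑ t, a t ^ k)) (i : ι) : IsIntegral ℤ (a i) := by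
  obtain ⟨q, hq, hq2⟩ := psum_formula a i
  have halg : ∀ i, IsIntegral ℚ (a i) := alg_of_psum a ha
  have hq3 : ∀ j, ∃ y : ℤ, y ≠ 0 ∧ IsIntegral ℤ (y • q.coeff j) := by
    intro j
    have h1 := hq2 (fun t => by rw [mem_algebraicClosure_iff]; exact (halg t).isAlgebraic) j
    rw [mem_algebraicClosure_iff] at h1
    have h2 : IsAlgebraic ℤ (q.coeff j) := (IsFractionRing.isAlgebraic_iff ℤ ℚ K).2 h1
    obtain ⟨y, hy, h⟩ := h2.exists_integral_multiple
    exact ⟨y, hy, h⟩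
  choose y hy hyi using hq3
  let r := ∏ j ∈ Finset.range (q.natDegree + 1), y j
  refine int_of_almost (a i) (halg i) r (Finset.prod_ne_zero_iff.2 fun j _ => hy j) fun k => ?_
  rcases Nat.eq_zero_or_pos k with rfl | hk
  · rw [pow_zero, mul_one]
    exact isIntegral_algebraMap (R := ℤ) (A := K) (x := r)
  · rw [hq, Finset.mul_sum]
    refine IsIntegral.sum _ fun j hj => ?_
    rw [← mul_assoc]
    refine IsIntegral.mul ?_ (ha _ (by omega))
    have : (r : K) * q.coeff j = (((∏ j ∈ (Finset.range (q.natDegree + 1)).erase j, y j : ℤ)) : K) * (y j • q.coeff j) := by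
      have : r = _ := (Finset.prod_erase_mul _ _ hj).symm
      rw [this, zsmul_eq_mul]
      push_cast
      ring
    rw [this]
    exact IsIntegral.mul (isIntegral_algebraMap (R := ℤ) (A := K)) (hyi j)

set_option linter.unusedSectionVars false in
lemma two_dvd {ι : Type*} (s : Finset ι) (a : ι → K) (ha : ∀ i, IsIntegral ℤ (a i)) :
    ∃ e : K, IsIntegral ℤ e ∧ (∑ i ∈ s, a i) ^ 2 - ∑ i ∈ s, a i ^ 2 = 2 * e := by
  classical
  induction s using Finset.induction_on with
  | empty => exact ⟨0, isIntegral_zero, by simp⟩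
  | insert i s hi ih =>
    obtain ⟨e, he, h⟩ := ih
    refine ⟨e + a i * ∑ j ∈ s, a j, he.add ((ha i).mul (IsIntegral.sum _ fun j _ => ha j)), ?_⟩
    rw [Finset.sum_insert hi, Finset.sum_insert hi]
    linear_combination h

/-- Power traces as power sums. -/
lemma trace_pow_eq [IsAlgClosed K] {V : Type*} [AddCommGroup V] [Module K V] [FiniteDimensional K V]
    (T : Module.End K V) : ∃ (s : Finset K) (c : K → ℕ), ∀ k,
      LinearMap.trace K V (T ^ k) = ∑ t : (Σ μ : s, Fin (c μ)), (t.1 : K) ^ k := by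
  classical
  have hds : DirectSum.IsInternal T.maxGenEigenspace := by
    rw [DirectSum.isInternal_submodule_iff_iSupIndep_and_iSup_eq_top]
    exact ⟨T.independent_maxGenEigenspace, Module.End.iSup_maxGenEigenspace_eq_top T⟩
  have hfin : {μ | T.maxGenEigenspace μ ≠ ⊥}.Finite :=
      WellFoundedGT.finite_ne_bot_of_iSupIndep T.independent_maxGenEigenspace
  refine ⟨hfin.toFinset, fun μ => Module.finrank K (T.maxGenEigenspace μ), fun k => ?_⟩
  have hc : ∀ k, Commute T (T ^ k) := fun k => (Commute.refl T).pow_right k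
  rw [LinearMap.trace_eq_sum_trace_restrict' hds hfin
    (fun μ => T.mapsTo_maxGenEigenspace_of_comm (hc k) μ), Fintype.sum_sigma]
  rw [← Finset.sum_coe_sort]
  refine Finset.sum_congr rfl fun μ _ => ?_
  simp only [Finset.sum_const, Finset.card_univ, Fintype.card_fin, nsmul_eq_mul]
  have hm := T.mapsTo_maxGenEigenspace_of_comm (Commute.refl T) μ
  have e : (T ^ k).restrict (T.mapsTo_maxGenEigenspace_of_comm (hc k) μ) = (T.restrict hm) ^ k := by
    exact (Module.End.pow_restrict k hm _).symm
  rw [e]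
  have hn := T.isNilpotent_restrict_maxGenEigenspace_sub_algebraMap μ
  clear e
  induction k with
  | zero => simp [Module.End.one_eq_id]
  | succ k ih =>
    rw [pow_succ, Module.End.mul_eq_comp, LinearMap.trace_comp_eq_mul_of_commute_of_isNilpotent (μ : K)
      ((Commute.refl (T.restrict hm)).pow_left k) hn, ih]
    ring

theorem trace_two_dvd [IsAlgClosed K] {V : Type*} [AddCommGroup V] [Module K V] [FiniteDimensional K V]
    (T : Module.End K V) (hT : ∀ k, 1 ≤ k → IsIntegral ℤ (LinearMap.trace K V (T ^ k))) :
    ∃ e : K, IsIntegral ℤ e ∧ (LinearMap.trace K V T) ^ 2 - LinearMap.trace K V (T ^ 2) = 2 * e := by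
  obtain ⟨s, c, h⟩ := trace_pow_eq T
  have h1 := h 1
  simp only [pow_one] at h1
  rw [h1, h 2]
  exact two_dvd _ _ (int_of_psum _ (fun k hk => by rw [← h]; exact hT k hk))

lemma even_of_eq (n : ℕ) (m : ℤ) (hm : Odd m) (e : K) (he : IsIntegral ℤ e) (h : (n : K) * m = 2 * e) : Even n := by
  have h1 : e = algebraMap ℚ K ((n * m : ℤ) / 2 : ℚ) := by
    rw [map_div₀, map_intCast, map_ofNat]
    push_cast
    rw [h]
    field_simp
  rw [h1] at he
  have h2 : IsIntegral ℤ ((n * m : ℤ) / 2 : ℚ) :=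
    (isIntegral_algebraMap_iff (algebraMap ℚ K).injective).1 he
  obtain ⟨z, hz⟩ := IsIntegrallyClosed.isIntegral_iff.1 h2
  have h3 : (n : ℤ) * m = 2 * z := by
    have : ((n * m : ℤ) : ℚ) = 2 * z := by
      have : (z : ℚ) = (n * m : ℤ) / 2 := hz
      rw [this]; ring
    exact_mod_cast this
  have h4 : Even ((n : ℤ) * m) := ⟨z, by omega⟩
  rw [Int.even_mul] at h4
  rcases h4 with h4 | h4
  · exact_mod_cast h4
  · exact absurd hm (by simpa using h4)

end Integ
end HopfEven

open scoped TensorProduct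
open WithConv Coalgebra

namespace HopfEven

section Rep
set_option linter.unusedSectionVars false
variable {K H : Type*} [Field K] [Ring H] [HopfAlgebra K H] [FiniteDimensional K H]
local notation "S" => HopfAlgebra.antipode K (A := H)
local notation "Δ" => comul (R := K) (A := H)
local notation "ε" => counit (R := K) (A := H)

lemma trace_mulLeft_mulRight {d : ℕ} (A B : Matrix (Fin d) (Fin d) K) :
    LinearMap.trace K (Matrix (Fin d) (Fin d) K) (LinearMap.mulLeft K A ∘ₗ LinearMap.mulRight K B) = A.trace * B.trace := by
  rw [LinearMap.trace_eq_matrix_trace K (Matrix.stdBasis K (Fin d) (Fin d)), Matrix.trace]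
  simp only [Matrix.diag_apply, LinearMap.toMatrix_apply, Matrix.trace, Fintype.sum_prod_type,
    Finset.sum_mul_sum]
  refine Finset.sum_congr rfl fun i _ => Finset.sum_congr rfl fun j _ => ?_
  have : ∀ (M : Matrix (Fin d) (Fin d) K), (Matrix.stdBasis K (Fin d) (Fin d)).repr M (i, j) = M i j := by
    intro M; simp [Matrix.stdBasis]
  rw [this]
  simp only [Matrix.stdBasis_eq_single, LinearMap.comp_apply, LinearMap.mulLeft_apply, LinearMap.mulRight_apply, Matrix.mul_apply]
  rw [Finset.sum_eq_single i, Finset.sum_eq_single j]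
  · simp
  · intro b _ hb; simp [hb.symm]
  · simp
  · intro b _ hb; simp [hb.symm]
  · simp

variable {d : ℕ} (ρ : H →ₐ[K] Matrix (Fin d) (Fin d) K)

noncomputable def chi : H →ₗ[K] K := Matrix.traceLinearMap (Fin d) K K ∘ₗ ρ.toLinearMap

noncomputable def Theta : H ⊗[K] H →ₗ[K] Module.End K (Matrix (Fin d) (Fin d) K) :=
  TensorProduct.lift (((LinearMap.mul K (Module.End K (Matrix (Fin d) (Fin d) K))).compl₁₂
    ((LinearMap.mul K (Matrix (Fin d) (Fin d) K)) ∘ₗ ρ.toLinearMap)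
    ((LinearMap.mul K (Matrix (Fin d) (Fin d) K)).flip ∘ₗ ρ.toLinearMap ∘ₗ S)))

lemma Theta_tmul (a b : H) (f) : Theta ρ (a ⊗ₜ b) f = ρ a * (f * ρ (S b)) := rfl

lemma Theta_mul (s t : H ⊗[K] H) : Theta ρ (s * t) = Theta ρ s * Theta ρ t := by
  induction s with
  | zero => simp
  | add a b ha hb => simp only [add_mul, map_add, ha, hb]
  | tmul a b =>
    induction t with
    | zero => simp
    | add a b ha hb => simp only [mul_add, map_add, ha, hb]
    | tmul c e =>
      ext1 f
      simp [Theta_tmul, HopfAlgebra.antipode_mul_antidistrib, mul_assoc]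

noncomputable def omega : H →ₗ[K] K := LinearMap.trace K _ ∘ₗ Theta ρ ∘ₗ Δ

lemma trace_Theta (a b : H) : LinearMap.trace K _ (Theta ρ (a ⊗ₜ b)) = chi ρ a * chi ρ (S b) :=
  trace_mulLeft_mulRight _ _

lemma omega_eq (h : H) : omega ρ h = (toConv (chi ρ) * toConv (chi ρ ∘ₗ S)).ofConv h := by
  erw [Coalgebra.Repr.convMul_apply (ℛ K h)]
  rw [omega, LinearMap.comp_apply, LinearMap.comp_apply, ← (ℛ K h).eq]
  simp [trace_Theta]

lemma omega_idem (e : H) (he : e * e = e) : ∃ r : ℕ, omega ρ e = r := by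
  obtain ⟨r, -, h, -⟩ := trace_idem (Theta ρ (Δ e)) (by
    rw [← Module.End.mul_eq_comp, ← Theta_mul, ← Bialgebra.comul_mul, he])
  exact ⟨r, h⟩

lemma omega_one : omega ρ 1 = d ^ 2 := by
  simp only [omega, LinearMap.comp_apply, Bialgebra.comul_one]
  rw [Algebra.TensorProduct.one_def, trace_Theta]
  simp [chi, sq]

variable {L : H} {l : H →ₗ[K] K}

lemma omega_S (hS : ∀ x, S (S x) = x) (h : H) : omega ρ (S h) = omega ρ h := by
  simp only [omega, LinearMap.comp_apply]
  have h1 : ∀ x, Δ (S x) = _ := fun x => LinearMap.congr_fun (comul_antipode (K := K) (H := H)) x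
  rw [h1]
  simp only [LinearMap.comp_apply]
  generalize Δ h = t
  induction t with
  | zero => simp
  | add a b ha hb => simp only [map_add, ha, hb]
  | tmul a b => simp [trace_Theta, hS, mul_comm]

lemma Theta_mul_left (h : H) (t : H ⊗[K] H) (f) : ρ h * Theta ρ t f = Theta ρ ((h ⊗ₜ 1) * t) f := by
  rw [Theta_mul, Module.End.mul_apply, Theta_tmul]; simp

lemma Theta_mul_right (h : H) (t : H ⊗[K] H) (f) : Theta ρ t f * ρ (S h) = Theta ρ ((1 ⊗ₜ h) * t) f := by
  rw [Theta_mul, Module.End.mul_apply, Theta_tmul]; simp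

lemma Theta_comul_one (h : H) : Theta ρ (Δ h) 1 = ε h • (1 : Matrix (Fin d) (Fin d) K) := by
  have h1 := congrArg ρ (HopfAlgebra.sum_mul_antipode_eq_smul (R := K) (ℛ K h))
  conv_lhs => rw [← (ℛ K h).eq]
  simpa [Theta_tmul] using h1

lemma omega_L (F : Frob L l) (hS : ∀ x, S (S x) = x) (hρ : Function.Surjective ρ) (hd : d ≠ 0) : omega ρ L = 1 := by
  have hcomm : ∀ f M, M * Theta ρ (Δ L) f = Theta ρ (Δ L) f * M := by
    intro f M
    obtain ⟨h, rfl⟩ := hρ M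
    rw [Theta_mul_left]
    have := Theta_mul_right ρ (S h) (Δ L) f
    rw [hS] at this
    rw [this, int_A F.int.left, hS]
  have : NeZero d := ⟨hd⟩
  let c : Matrix (Fin d) (Fin d) K →ₗ[K] K := Matrix.entryLinearMap K K 0 0 ∘ₗ Theta ρ (Δ L)
  have hsc : Theta ρ (Δ L) = c.smulRight (1 : Matrix (Fin d) (Fin d) K) := by
    ext1 f
    have h1 : Theta ρ (Δ L) f ∈ Set.range (Matrix.scalar (Fin d)) := by
      rw [Matrix.mem_range_scalar_iff_commute_single]
      intro i j _
      exact hcomm f _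
    obtain ⟨x, hx⟩ := h1
    have : c f = x := by
      simp only [c, LinearMap.comp_apply, ← hx]; simp
    rw [LinearMap.smulRight_apply, this, ← hx]
    simp [Matrix.smul_one_eq_diagonal]
  rw [omega, LinearMap.comp_apply, LinearMap.comp_apply, hsc, LinearMap.trace_smulRight]
  simp [c, Theta_comul_one, F.int.one]

/-- counting -/
lemma odd_of_no_selfdual [CharZero K] (F : Frob L l) (hρ : Function.Surjective ρ) (hd : d ≠ 0)
    {ι : Type*} [Fintype ι] [DecidableEq ι] (e : ι → H) (he : ∀ i, e i * e i = e i) (he1 : ∑ i, e i = 1)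
    (σ : ι → ι) (hσ : ∀ i, S (e i) = e (σ i)) (hσσ : ∀ i, σ (σ i) = i) (j : ι) (hj : e j = L)
    (hσj : σ j = j)
    (hfix : ∀ i, σ i = i → i = j) : Odd d := by
  have hS := S_sq F
  choose r hr using fun i => omega_idem ρ (e i) (he i)
  have h1 : ∑ i, r i = d ^ 2 := by
    have := omega_one ρ
    rw [← he1, map_sum] at this
    simp_rw [hr] at this
    exact_mod_cast this
  have h2 : r j = 1 := by
    have := hr j
    rw [hj, omega_L ρ F hS hρ hd] at this
    exact_mod_cast this.symm
  have h3 : ∀ i, r (σ i) = r i := by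
    intro i
    have := hr (σ i)
    rw [← hσ, omega_S ρ hS, hr] at this
    exact_mod_cast this.symm
  have h4 : ∑ i ∈ Finset.univ.erase j, (r i : ZMod 2) = 0 := by
    refine Finset.sum_involution (fun i _ => σ i) ?_ ?_ ?_ ?_
    · intro i _
      simp only [h3]
      exact CharTwo.add_self_eq_zero _
    · intro i hi _ h
      exact (Finset.mem_erase.1 hi).1 (hfix i h)
    · intro i hi
      rw [Finset.mem_erase] at hi ⊢
      refine ⟨fun h => hi.1 ?_, Finset.mem_univ _⟩
      rw [← hσσ i, h, hσj]
    · intro i _; exact hσσ i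
  have h5 : ((d ^ 2 : ℕ) : ZMod 2) = 1 := by
    rw [← h1, Nat.cast_sum, ← Finset.add_sum_erase _ _ (Finset.mem_univ j), h4, h2]; simp
  have h6 : Odd (d ^ 2) := by
    rw [← Nat.not_even_iff_odd, even_iff_two_dvd, ← ZMod.natCast_eq_zero_iff, h5]
    exact one_ne_zero
  exact Nat.Odd.of_mul_left (by rwa [sq] at h6)

end Rep
end HopfEven

open scoped TensorProduct
open WithConv Coalgebra

namespace HopfEven

section SelfDual
set_option linter.unusedSectionVars false
variable {K H : Type*} [Field K] [Ring H] [HopfAlgebra K H] [FiniteDimensional K H]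
local notation "S" => HopfAlgebra.antipode K (A := H)
local notation "Δ" => comul (R := K) (A := H)
local notation "ε" => counit (R := K) (A := H)

/-- multiplicativity of convolution products of matrix-coefficient type functionals -/
lemma conv_mul_arg {α β : Type*} [Fintype α] [Fintype β] (p q : WithConv (H →ₗ[K] K))
    (p1 p2 : α → WithConv (H →ₗ[K] K)) (q1 q2 : β → WithConv (H →ₗ[K] K))
    (hp : ∀ g h, p.ofConv (g * h) = ∑ i, (p1 i).ofConv g * (p2 i).ofConv h)
    (hq : ∀ g h, q.ofConv (g * h) = ∑ i, (q1 i).ofConv g * (q2 i).ofConv h) (g h : H) :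
    (p * q).ofConv (g * h) = ∑ i, ∑ j, (p1 i * q1 j).ofConv g * (p2 i * q2 j).ofConv h := by
  have e : ∀ (a b : WithConv (H →ₗ[K] K)) x, (a * b).ofConv x =
    LinearMap.mul' K K (TensorProduct.map a.ofConv b.ofConv (Δ x)) := fun a b x => rfl
  simp only [e, Bialgebra.comul_mul]
  generalize Δ g = s
  generalize Δ h = t
  induction s with
  | zero => simp
  | add a b ha hb => simp only [add_mul, map_add, ha, hb, Finset.sum_add_distrib]
  | tmul a b =>
    induction t with
    | zero => simp
    | add a b ha hb => simp only [mul_add, map_add, ha, hb, Finset.sum_add_distrib]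
    | tmul c e =>
      simp only [Algebra.TensorProduct.tmul_mul_tmul, TensorProduct.map_tmul, LinearMap.mul'_apply, hp, hq,
        Finset.sum_mul_sum]
      refine Finset.sum_congr rfl fun i _ => Finset.sum_congr rfl fun j _ => ?_
      ring

variable {d : ℕ} (ρ : H →ₐ[K] Matrix (Fin d) (Fin d) K)

lemma sum_cons {m : ℕ} {M : Type*} [AddCommMonoid M] (f : (Fin (m+1) → Fin d) → M) :
    ∑ I, f I = ∑ a : Fin d, ∑ I : Fin m → Fin d, f (Fin.cons a I) := by
  rw [← (Fin.consEquiv (fun _ => Fin d)).sum_comp, Fintype.sum_prod_type]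
  rfl

/-- matrix coefficients -/
noncomputable def mc : Matrix (Fin d) (Fin d) (WithConv (H →ₗ[K] K)) := Matrix.of fun a b =>
  toConv (Matrix.entryLinearMap K K a b ∘ₗ ρ.toLinearMap)

noncomputable def wd {m : ℕ} (I J : Fin m → Fin d) : WithConv (H →ₗ[K] K) :=
  (List.ofFn fun k => mc ρ (I k) (J k)).prod

lemma wd_cons {m : ℕ} (a b : Fin d) (I J : Fin m → Fin d) :
    wd ρ (Fin.cons a I : Fin (m+1) → Fin d) (Fin.cons b J : Fin (m+1) → Fin d) = mc ρ a b * wd ρ I J := by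
  simp [wd, List.ofFn_succ]

lemma wd_snoc {m : ℕ} (a b : Fin d) (I J : Fin m → Fin d) :
    wd ρ (Fin.snoc I a : Fin (m+1) → Fin d) (Fin.snoc J b : Fin (m+1) → Fin d) = wd ρ I J * mc ρ a b := by
  rw [wd, List.ofFn_succ']
  simp [wd]

lemma wd_mul : ∀ {m : ℕ} (I J : Fin m → Fin d) (g h : H),
    (wd ρ I J).ofConv (g * h) = ∑ M : Fin m → Fin d, (wd ρ I M).ofConv g * (wd ρ M J).ofConv h := by
  intro m
  induction m with
  | zero =>
    intro I J g h
    simp [wd]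
  | succ m ih =>
    intro I J g h
    obtain ⟨a, I, rfl⟩ : ∃ a I', I = (Fin.cons a I' : Fin (m+1) → Fin d) := ⟨_, _, (Fin.cons_self_tail I).symm⟩
    obtain ⟨b, J, rfl⟩ : ∃ a I', J = (Fin.cons a I' : Fin (m+1) → Fin d) := ⟨_, _, (Fin.cons_self_tail J).symm⟩
    rw [wd_cons, conv_mul_arg _ _ (fun c => mc ρ a c) (fun c => mc ρ c b) (fun M => wd ρ I M) (fun M => wd ρ M J)
      ?_ (ih I J), sum_cons]
    · simp only [wd_cons]
    · intro g h
      simp [mc, Matrix.mul_apply]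

lemma wd_rot {L : H} {l : H →ₗ[K] K} (F : Frob L l) (hS : ∀ x, S (S x) = x) {m : ℕ} (I J : Fin (m+1) → Fin d) :
    (wd ρ (I ∘ finRotate _) (J ∘ finRotate _)).ofConv L = (wd ρ I J).ofConv L := by
  obtain ⟨a, I, rfl⟩ : ∃ a I', I = (Fin.cons a I' : Fin (m+1) → Fin d) := ⟨_, _, (Fin.cons_self_tail I).symm⟩
  obtain ⟨b, J, rfl⟩ : ∃ a I', J = (Fin.cons a I' : Fin (m+1) → Fin d) := ⟨_, _, (Fin.cons_self_tail J).symm⟩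
  have h1 : ∀ a (I : Fin m → Fin d), (Fin.cons a I : Fin (m+1) → Fin d) ∘ finRotate _ = Fin.snoc I a :=
    fun a I => (Fin.snoc_eq_cons_rotate I a).symm
  rw [h1, h1, wd_snoc, wd_cons]
  exact F.conv_comm_L hS _ _

lemma mc_pow {m : ℕ} (a b : Fin d) : (mc ρ ^ (m+1)) a b =
    ∑ I : Fin m → Fin d, wd ρ (Fin.cons a I : Fin (m+1) → Fin d) (Fin.snoc I b : Fin (m+1) → Fin d) := by
  induction m generalizing a b with
  | zero =>
    simp [wd, Fin.snoc]
  | succ m ih =>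
    rw [pow_succ', Matrix.mul_apply, sum_cons]
    refine Finset.sum_congr rfl fun c _ => ?_
    rw [ih, Finset.mul_sum]
    refine Finset.sum_congr rfl fun I _ => ?_
    rw [← Fin.cons_snoc_eq_snoc_cons, wd_cons]

lemma trace_mc_pow (m : ℕ) : (mc ρ ^ (m+1)).trace =
    ∑ I : Fin (m+1) → Fin d, wd ρ I (I ∘ finRotate _) := by
  rw [sum_cons, Matrix.trace]
  refine Finset.sum_congr rfl fun a _ => ?_
  rw [Matrix.diag_apply, mc_pow]
  refine Finset.sum_congr rfl fun I _ => ?_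
  rw [Fin.snoc_eq_cons_rotate]
  rfl

noncomputable def Pm (L : H) (m : ℕ) : Matrix (Fin (m+1) → Fin d) (Fin (m+1) → Fin d) K := fun I J =>
  (wd ρ I J).ofConv L

noncomputable def Fm (L : H) (m : ℕ) : Matrix (Fin (m+1) → Fin d) (Fin (m+1) → Fin d) K := fun I J =>
  (wd ρ I (J ∘ finRotate _)).ofConv L

variable {L : H} {l : H →ₗ[K] K} (F : Frob L l) (hS : ∀ x, S (S x) = x)

lemma L_mul_L (F : Frob L l) : L * L = L := by rw [F.int.left, F.int.one, one_smul]

lemma Fm_pow (F : Frob L l) (hS : ∀ x, S (S x) = x) (m k : ℕ) (I J) : (Fm ρ L m ^ (k+1)) I J =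
    (wd ρ I (J ∘ ((finRotate (m+1)) ^ (k+1) : Equiv.Perm _))).ofConv L := by
  induction k generalizing I J with
  | zero => simp [Fm]
  | succ k ih =>
    have h1 : ∀ M, Fm ρ L m M J = (wd ρ (M ∘ ((finRotate (m+1)) ^ (k+1) : Equiv.Perm _))
        (J ∘ ((finRotate (m+1)) ^ (k+2) : Equiv.Perm _))).ofConv L := by
      intro M
      have : ∀ j (A B : Fin (m+1) → Fin d), (wd ρ (A ∘ ((finRotate (m+1)) ^ j : Equiv.Perm _))
        (B ∘ ((finRotate (m+1)) ^ j : Equiv.Perm _))).ofConv L = (wd ρ A B).ofConv L := by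
        intro j
        induction j with
        | zero => intro A B; simp
        | succ j ih =>
          intro A B
          rw [pow_succ, Equiv.Perm.coe_mul, ← Function.comp_assoc, ← Function.comp_assoc, wd_rot ρ F hS, ih]
      rw [← this (k+1)]
      rw [Fm, this, ← this (k+1) M, Function.comp_assoc, ← Equiv.Perm.coe_mul, ← pow_succ']
    rw [pow_succ, Matrix.mul_apply]
    simp_rw [ih, h1]
    rw [← L_mul_L F, wd_mul, L_mul_L F]
    exact (Equiv.arrowCongr ((finRotate (m+1)) ^ (k+1) : Equiv.Perm _).symm (Equiv.refl (Fin d))).sum_comp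
      (fun M => (wd ρ I M).ofConv L * (wd ρ M _).ofConv L)

lemma isIntegral_trace [IsAlgClosed K] {n : Type*} [Fintype n] [DecidableEq n] (M : Matrix n n K) (k : ℕ) (hk : 1 ≤ k)
    (h : M ^ (k+1) = M) : IsIntegral ℤ M.trace := by
  rw [Matrix.trace_eq_sum_roots_charpoly]
  refine IsIntegral.multiset_sum ?_
  intro θ hθ
  have h1 : θ ∈ spectrum K M := by
    rw [Matrix.mem_spectrum_iff_isRoot_charpoly]
    exact (Polynomial.mem_roots (M.charpoly_monic.ne_zero)).1 hθ
  let f : Polynomial K := Polynomial.X ^ (k+1) - Polynomial.X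
  have h2 := spectrum.subset_polynomial_aeval M f ⟨θ, h1, rfl⟩
  have h3 : Polynomial.aeval M f = 0 := by simp [f, h]
  have hn : Nonempty n := by
    by_contra hn
    rw [not_nonempty_iff] at hn
    simp at h1
  rw [h3, spectrum.zero_eq] at h2
  have h4 : θ ^ (k+1) - θ = 0 := by simpa [f] using h2
  refine ⟨Polynomial.X ^ (k+1) - Polynomial.X, ?_, by simpa using h4⟩
  exact Polynomial.monic_X_pow_sub (by rw [Polynomial.degree_X]; exact_mod_cast Nat.lt_succ_of_le hk)

lemma trace_pow_int [IsAlgClosed K] (F : Frob L l) (hS : ∀ x, S (S x) = x) (m : ℕ) :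
    IsIntegral ℤ ((mc ρ ^ (m+1)).trace.ofConv L) := by
  have h1 : (mc ρ ^ (m+1)).trace.ofConv L = (Fm ρ L m).trace := by
    rw [trace_mc_pow, Matrix.trace]
    have : ∀ (s : Finset (Fin (m+1) → Fin d)) (f : (Fin (m+1) → Fin d) → WithConv (H →ₗ[K] K)),
      (∑ i ∈ s, f i).ofConv L = ∑ i ∈ s, (f i).ofConv L := by
      intro s f
      simp [WithConv.ofConv_sum]
    rw [this]
    rfl
  rw [h1]
  refine isIntegral_trace _ (orderOf (finRotate (m+1))) (orderOf_pos _) ?_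
  ext I J
  rw [Fm_pow ρ F hS, pow_succ, pow_orderOf_eq_one, one_mul]
  rfl

end SelfDual
end HopfEven

open scoped TensorProduct
open WithConv Coalgebra

namespace HopfEven

section TMs
variable {K A : Type*} [Field K] [Ring A] [Algebra K A] {d : ℕ}

noncomputable def TM (M : Matrix (Fin d) (Fin d) A) : Module.End K (Fin d → A) :=
  ∑ a, ∑ b, LinearMap.single K (fun _ : Fin d => A) a ∘ₗ LinearMap.mulLeft K (M a b) ∘ₗ
    LinearMap.proj (R := K) (φ := fun _ : Fin d => A) b

lemma TM_apply (M : Matrix (Fin d) (Fin d) A) (v : Fin d → A) : TM (K := K) M v = M.mulVec v := by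
  ext a
  simp [TM, Matrix.mulVec, dotProduct, Finset.sum_apply, Pi.single_apply]

lemma TM_pow (M : Matrix (Fin d) (Fin d) A) (k : ℕ) : TM (K := K) M ^ k = TM (M ^ k) := by
  induction k with
  | zero => refine LinearMap.ext fun v => ?_; simp only [TM_apply, pow_zero, Module.End.one_apply, Matrix.one_mulVec]
  | succ k ih =>
    refine LinearMap.ext fun v => ?_
    simp only [pow_succ, ih, Module.End.mul_apply, TM_apply, Matrix.mulVec_mulVec]

lemma TM_trace [FiniteDimensional K A] (M : Matrix (Fin d) (Fin d) A) : LinearMap.trace K _ (TM (K := K) M) =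
    LinearMap.trace K A (LinearMap.mulLeft K M.trace) := by
  have h1 : ∀ a b, LinearMap.trace K _ (LinearMap.single K (fun _ : Fin d => A) a ∘ₗ LinearMap.mulLeft K (M a b) ∘ₗ
    LinearMap.proj (R := K) (φ := fun _ : Fin d => A) b) = if a = b then
      LinearMap.trace K A (LinearMap.mulLeft K (M a a)) else 0 := by
    intro a b
    rw [LinearMap.trace_comp_comm', LinearMap.comp_assoc]
    split_ifs with h
    · subst h
      rw [LinearMap.proj_comp_single_same, LinearMap.comp_id]
    · rw [LinearMap.proj_comp_single_ne, LinearMap.comp_zero, map_zero]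
      exact fun h' => h h'.symm
  have h2 : LinearMap.mulLeft K M.trace = ∑ a, LinearMap.mulLeft K (M a a) := by
    ext x; simp [Matrix.trace, Finset.sum_mul]
  simp [TM, h1, h2]

end TMs

section SelfDual2
set_option linter.unusedSectionVars false
variable {K H : Type*} [Field K] [Ring H] [HopfAlgebra K H] [FiniteDimensional K H]
local notation "S" => HopfAlgebra.antipode K (A := H)
local notation "Δ" => comul (R := K) (A := H)
local notation "ε" => counit (R := K) (A := H)

variable {L : H} {l : H →ₗ[K] K}

instance finite_conv : FiniteDimensional K (WithConv (H →ₗ[K] K)) :=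
  Module.Finite.equiv (WithConv.linearEquiv K (H →ₗ[K] K)).symm

lemma trace_mulLeft_conv (F : Frob L l) (hS : ∀ x, S (S x) = x) (p : WithConv (H →ₗ[K] K)) :
    LinearMap.trace K _ (LinearMap.mulLeft K p) = l 1 * p.ofConv L := by
  rw [← F.trace_lam1 hS, ← LinearMap.trace_transpose' (lam1 p.ofConv ∘ₗ Δ),
    ← LinearMap.trace_conj' _ (WithConv.linearEquiv K (H →ₗ[K] K))]
  congr 1
  refine LinearMap.ext fun q => LinearMap.ext fun h => ?_
  have : (p * toConv q).ofConv h = q (lam1 p.ofConv (Δ h)) := by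
    have e : (p * toConv q).ofConv h = LinearMap.mul' K K (TensorProduct.map p.ofConv q (Δ h)) := rfl
    rw [e]
    generalize Δ h = t
    induction t with
    | zero => simp
    | add a b ha hb => simp only [map_add, ha, hb]
    | tmul a b => simp
  exact this

variable {d : ℕ} (ρ : H →ₐ[K] Matrix (Fin d) (Fin d) K)

lemma mc_trace : (mc ρ).trace = toConv (chi ρ) := by
  apply WithConv.ofConv_injective
  ext h
  simp [Matrix.trace, mc, chi]

theorem even_of_selfdual [IsAlgClosed K] [CharZero K] (F : Frob L l) (hL : chi ρ L = 0)
    (hLL : (toConv (chi ρ) * toConv (chi ρ)).ofConv L = 1) : Even (Module.finrank K H) := by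
  have hS := S_sq F
  have hn := l_one F
  have key : ∀ k, LinearMap.trace K _ (TM (K := K) (mc ρ) ^ k) = (Module.finrank K H : K) * ((mc ρ ^ k).trace).ofConv L := by
    intro k
    rw [TM_pow, TM_trace, trace_mulLeft_conv F hS, hn]
  obtain ⟨e, he, h⟩ := trace_two_dvd (TM (K := K) (mc ρ)) (by
    intro k hk
    obtain ⟨k, rfl⟩ := Nat.exists_eq_add_of_le' hk
    rw [key]
    exact (isIntegral_algebraMap (R := ℤ) (A := K) (x := (Module.finrank K H : ℤ))).mul (trace_pow_int ρ F hS k) |> fun h => by simpa using h)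
  have h1 := key 1
  rw [pow_one, pow_one, mc_trace] at h1
  simp only [hL, mul_zero] at h1
  -- indicator
  have hsum : ∀ {α : Type} (s : Finset α) (f : α → WithConv (H →ₗ[K] K)),
      (∑ i ∈ s, f i).ofConv L = ∑ i ∈ s, (f i).ofConv L := by
    intro α s f
    simp [WithConv.ofConv_sum]
  have hcube : Fm ρ L 1 ^ 3 = Fm ρ L 1 := by
    ext I J
    have hr : (finRotate 2) ^ 3 = finRotate 2 := by decide
    rw [Fm_pow ρ F hS 1 2, hr]
    rfl
  have hsq : (Fm ρ L 1 ^ 2).trace = 1 := by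
    have hr : (finRotate 2) ^ 2 = 1 := by decide
    rw [Matrix.trace, ← hLL, ← mc_trace, Matrix.trace, Finset.sum_mul_sum, hsum, sum_cons]
    refine Finset.sum_congr rfl fun a _ => ?_
    rw [hsum, sum_cons]
    refine Finset.sum_congr rfl fun b _ => ?_
    rw [Fintype.sum_unique, Matrix.diag_apply, Fm_pow ρ F hS 1 1, hr]
    simp [wd]
  obtain ⟨r, s, hr, hs⟩ := trace_cube two_ne_zero (Matrix.toLin' (Fm ρ L 1)) (by
    rw [← Matrix.toLin'_mul, ← Matrix.toLin'_mul, ← hcube]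
    congr 1
    rw [hcube]
    conv_rhs => rw [← hcube]
    simp [pow_succ, mul_assoc])
  rw [← Matrix.toLin'_mul, Matrix.trace_toLin'_eq, ← sq, hsq] at hs
  rw [Matrix.trace_toLin'_eq] at hr
  have h2 := key 2
  have h3 : (mc ρ ^ 2).trace.ofConv L = (Fm ρ L 1).trace := by
    rw [trace_mc_pow ρ 1, hsum]; rfl
  rw [h3, hr] at h2
  rw [h1, h2] at h
  have hrs : 1 = r + s := by exact_mod_cast hs
  refine even_of_eq (K := K) (Module.finrank K H) ((s : ℤ) - r) ?_ e he ?_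
  · have : (s : ℤ) - r = 2 * s - 1 := by omega
    rw [this]; exact ⟨s - 1, by ring⟩
  · rw [← h]; push_cast; ring

end SelfDual2
end HopfEven

open scoped TensorProduct
open WithConv Coalgebra

namespace HopfEven

lemma exists_integral_left {K A : Type*} [Field K] [Ring A] [Algebra K A] [IsSemisimpleRing A] (ε : A →ₐ[K] K) :
    ∃ L : A, (∀ h, h * L = ε h • L) ∧ ε L = 1 := by
  let k : Submodule A A := RingHom.ker ε
  obtain ⟨J, hJ⟩ := exists_isCompl k
  have h1 : (1 : A) ∈ k ⊔ J := by rw [hJ.sup_eq_top]; trivial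
  obtain ⟨y, hy, L, hL, hyL⟩ := Submodule.mem_sup.1 h1
  have hy' : ε y = 0 := hy
  refine ⟨L, fun h => ?_, ?_⟩
  · have h2 : (h - algebraMap K A (ε h)) * L ∈ k := by
      change ε _ = 0
      simp
    have h3 : (h - algebraMap K A (ε h)) * L ∈ J := J.smul_mem _ hL
    have := (Submodule.disjoint_def.1 hJ.disjoint) _ h2 h3
    rw [sub_mul, sub_eq_zero] at this
    rw [this, Algebra.smul_def]
  · have := congrArg ε hyL
    simpa [hy'] using this

lemma exists_integral {K A : Type*} [Field K] [Ring A] [Algebra K A] [IsSemisimpleRing A] (ε : A →ₐ[K] K) :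
    ∃ L : A, (∀ h, h * L = ε h • L) ∧ (∀ h, L * h = ε h • L) ∧ ε L = 1 := by
  obtain ⟨L, h1, h2⟩ := exists_integral_left ε
  obtain ⟨R, h3, h4⟩ := exists_integral_left (A := Aᵐᵒᵖ) 
    ((AlgEquiv.toOpposite K K).symm.toAlgHom.comp (AlgHom.op ε))
  have h3' : ∀ h, R.unop * h = ε h • R.unop := fun h => by
    have := congrArg MulOpposite.unop (h3 (MulOpposite.op h))
    simpa using this
  have h4' : ε R.unop = 1 := by simpa using h4
  have e : R.unop = L := by
    have := h1 R.unop
    rw [h3', h2, h4'] at this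
    simpa using this
  rw [e] at h3'
  exact ⟨L, h1, h3', h2⟩

lemma tracial_eq {K : Type*} [Field K] [CharZero K] {d : ℕ} (τ : Matrix (Fin d) (Fin d) K →ₗ[K] K)
    (h : ∀ x y, τ (x * y) = τ (y * x)) (h1 : τ 1 = d) (x) : τ x = x.trace := by
  rcases Nat.eq_zero_or_pos d with rfl | hd
  · simp [Subsingleton.elim x 0]
  have : NeZero d := ⟨hd.ne'⟩
  have h2 : ∀ a b, a ≠ b → τ (Matrix.single a b 1) = 0 := by
    intro a b hab
    have := h (Matrix.single a a 1) (Matrix.single a b 1)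
    simpa [Matrix.single_mul_single_of_ne, hab.symm] using this
  have h3 : ∀ a b, τ (Matrix.single a a 1) = τ (Matrix.single b b 1) := by
    intro a b
    have := h (Matrix.single a b 1) (Matrix.single b a 1)
    simpa using this
  have h5 : ∀ x : Matrix (Fin d) (Fin d) K, τ x = x.trace * τ (Matrix.single 0 0 1) := by
    intro x
    conv_lhs => rw [Matrix.matrix_eq_sum_single x]
    rw [map_sum, Matrix.trace, Finset.sum_mul]
    refine Finset.sum_congr rfl fun a _ => ?_
    rw [map_sum, Finset.sum_eq_single a]
    · have : Matrix.single a a (x a a) = x a a • Matrix.single a a (1 : K) := by simp [Matrix.smul_single]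
      rw [this, map_smul, h3 a 0]; rfl
    · intro b _ hb
      have : Matrix.single a b (x a b) = x a b • Matrix.single a b (1 : K) := by simp [Matrix.smul_single]
      rw [this, map_smul, h2 a b hb.symm, smul_zero]
    · simp
  have h6 := h5 1
  rw [h1, Matrix.trace_one, Fintype.card_fin] at h6
  have hd' : (d : K) ≠ 0 := by exact_mod_cast hd.ne'
  have : τ (Matrix.single 0 0 1) = 1 := by
    have := mul_left_cancel₀ hd' ((mul_one _).trans h6)
    exact this.symm
  rw [h5, this, mul_one]

section Blocks
set_option linter.unusedSectionVars false
variable {K H : Type*} [Field K] [Ring H] [Algebra K H] {ι : Type*} [Fintype ι] [DecidableEq ι]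
  {d : ι → ℕ} (φ : H ≃ₐ[K] (Π i, Matrix (Fin (d i)) (Fin (d i)) K))

noncomputable def blk (i : ι) : H := φ.symm (Pi.single i 1)

lemma blk_mul_self (i : ι) : blk φ i * blk φ i = blk φ i := by
  rw [blk, ← map_mul, ← Pi.single_mul, one_mul]

lemma blk_mul_ne (i j : ι) (h : i ≠ j) : blk φ i * blk φ j = 0 := by
  rw [blk, blk, ← map_mul]
  have : (Pi.single i 1 : Π i, Matrix (Fin (d i)) (Fin (d i)) K) * Pi.single j 1 = 0 := by
    ext1 k
    by_cases hk : k = i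
    · subst hk; simp [Pi.single_eq_of_ne h]
    · simp [Pi.single_eq_of_ne hk]
  rw [this, map_zero]

lemma blk_sum : ∑ i, blk φ i = 1 := by
  simp only [blk, ← map_sum]
  rw [← map_one φ.symm]
  congr 1
  ext1 k
  simp [Finset.univ_sum_single (fun i => (1 : Matrix (Fin (d i)) (Fin (d i)) K))]

lemma blk_comm (i : ι) (x : H) : blk φ i * x = x * blk φ i := by
  apply φ.injective
  ext1 k
  by_cases hk : k = i
  · subst hk; simp [blk]
  · simp [blk, Pi.single_eq_of_ne hk]

lemma blk_ne_zero (hd : ∀ i, d i ≠ 0) (i : ι) : blk φ i ≠ 0 := by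
  intro h
  have : NeZero (d i) := ⟨hd i⟩
  have := congrFun (congrArg φ h) i
  simp [blk] at this

lemma blk_prim (f : H) (hf : f * f = f) (hc : ∀ x, f * x = x * f) (hd : ∀ i, d i ≠ 0) (j : ι) :
    blk φ j * f = 0 ∨ blk φ j * f = blk φ j := by
  have : NeZero (d j) := ⟨hd j⟩
  obtain ⟨x, hx⟩ : φ f j ∈ Set.range (Matrix.scalar (Fin (d j))) := by
    rw [Matrix.mem_range_scalar_iff_commute_single]
    intro a b _
    have := congrFun (congrArg φ (hc (φ.symm (Pi.single j (Matrix.single a b 1))))) j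
    have h := this.symm
    simp only [map_mul, Pi.mul_apply, AlgEquiv.apply_symm_apply, Pi.single_eq_same] at h
    exact h
  have h1 : x * x = x := by
    have := congrFun (congrArg φ hf) j
    rw [map_mul, Pi.mul_apply, ← hx, ← map_mul] at this
    simpa using congrFun (congrFun this 0) 0
  have h2 : x = 0 ∨ x = 1 := by
    have : x * (x - 1) = 0 := by rw [mul_sub, h1]; ring
    rcases mul_eq_zero.1 this with h | h
    · exact Or.inl h
    · exact Or.inr (sub_eq_zero.1 h)
  refine h2.imp ?_ ?_
  · rintro rfl
    apply φ.injective
    ext1 k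
    by_cases hk : k = j
    · subst hk; simp [blk, ← hx]
    · simp [blk, Pi.single_eq_of_ne hk]
  · rintro rfl
    apply φ.injective
    ext1 k
    by_cases hk : k = j
    · subst hk; simp [blk, ← hx]
    · simp [blk, Pi.single_eq_of_ne hk]

lemma exists_blk (f : H) (hf : f * f = f) (hc : ∀ x, f * x = x * f) (hd : ∀ i, d i ≠ 0) (h0 : f ≠ 0) :
    ∃ j, blk φ j * f = blk φ j := by
  by_contra hcon
  push Not at hcon
  apply h0
  rw [← one_mul f, ← blk_sum φ, Finset.sum_mul]
  exact Finset.sum_eq_zero fun j _ => (blk_prim φ f hf hc hd j).resolve_right (hcon j)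

noncomputable def brep (i : ι) : H →ₐ[K] Matrix (Fin (d i)) (Fin (d i)) K :=
  (Pi.evalAlgHom K (fun i => Matrix (Fin (d i)) (Fin (d i)) K) i).comp φ.toAlgHom

lemma brep_apply (i : ι) (x : H) : brep φ i x = φ x i := rfl

lemma brep_surj (i : ι) : Function.Surjective (brep φ i) := fun M => 
  ⟨φ.symm (Pi.single i M), by simp [brep_apply]⟩

lemma blk_mul_eq (i : ι) (x : H) : blk φ i * x = φ.symm (Pi.single i (brep φ i x)) := by
  apply φ.injective
  ext1 k
  by_cases hk : k = i
  · subst hk; simp [blk, brep_apply]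
  · simp [blk, Pi.single_eq_of_ne hk]

end Blocks

section Thm0
variable {K H : Type*} [Field K] [Ring H] [HopfAlgebra K H] [FiniteDimensional K H]
local notation "S" => HopfAlgebra.antipode K (A := H)
local notation "Δ" => comul (R := K) (A := H)
local notation "ε" => counit (R := K) (A := H)

theorem thm0 [IsAlgClosed K] [CharZero K] {ι : Type*} [Fintype ι] {d : ι → ℕ} (hd : ∀ i, d i ≠ 0)
    (φ : H ≃ₐ[K] (Π i, Matrix (Fin (d i)) (Fin (d i)) K))
    (l : H →ₗ[K] K) (hl : ∀ x, lam1 l (Δ x) = l x • (1 : H)) (l1 : l 1 = 1)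
    (hodd : ¬ Even (Module.finrank K H)) (i : ι) : Odd (d i) := by
  classical
  have hss : IsSemisimpleRing H := φ.symm.toRingEquiv.isSemisimpleRing
  obtain ⟨L, hL1, hL2, hL3⟩ := exists_integral (Bialgebra.counitAlgHom K H)
  have hL : IsHopfInt (K := K) L := ⟨hL1, hL2, hL3⟩
  obtain ⟨c, F⟩ := exists_frob hl l1 hL
  have hS := S_sq F
  let e := blk φ
  have hSanti : ∀ x y, S (x * y) = S y * S x := fun x y => HopfAlgebra.antipode_mul_antidistrib _ _
  have hex : ∀ i, ∃ j, S (e i) = e j := by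
    intro i
    have hid : ∀ i, S (e i) * S (e i) = S (e i) := fun i => by rw [← hSanti, blk_mul_self φ i]
    have hc : ∀ i x, S (e i) * x = x * S (e i) := by
      intro i x
      rw [← hS x, ← hSanti, ← hSanti, blk_comm φ i]
    have hn : ∀ i, S (e i) ≠ 0 := by
      intro i h
      apply blk_ne_zero φ hd i
      change e i = 0
      rw [← hS (e i), h, map_zero]
    obtain ⟨j, hj⟩ := exists_blk φ (S (e i)) (hid i) (hc i) hd (hn i)
    refine ⟨j, ?_⟩
    have h1 : e i * S (e j) = S (e j) := by
      have := congrArg S hj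
      rw [hSanti, hS] at this
      exact this
    rcases blk_prim φ (S (e j)) (hid j) (hc j) hd i with h | h
    · exact absurd (h1.symm.trans h) (hn j)
    · have h2 : S (e j) = e i := h1.symm.trans h
      rw [← h2, hS]
  choose σ hσ using hex
  have einj : Function.Injective e := by
    intro i j hij
    by_contra hne
    have h1 := blk_mul_ne φ i j hne
    have : e i * e j = 0 := h1
    rw [← hij] at this
    exact blk_ne_zero φ hd i ((blk_mul_self φ i).symm.trans this)
  have hσσ : ∀ i, σ (σ i) = i := by
    intro i
    apply einj
    rw [← hσ, ← hσ, hS]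
  obtain ⟨j, hj⟩ : ∃ j, e j = L := by
    have hL0 : L ≠ 0 := by rintro rfl; simp at hL3
    obtain ⟨j, hj⟩ := exists_blk φ L (L_mul_L F) (fun x => by rw [hL1, hL2]) hd hL0
    have h1 : blk φ j = ε (blk φ j) • L := by
      rw [← hj]
      conv_lhs => rw [hL1]
      rw [hj]; rfl
    refine ⟨j, ?_⟩
    have h2 : ε (blk φ j) * ε (blk φ j) = ε (blk φ j) := by
      rw [← Bialgebra.counit_mul, blk_mul_self]
    have h3 : ε (blk φ j) ≠ 0 := by
      intro h
      rw [h, zero_smul] at h1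
      exact blk_ne_zero φ hd j h1
    have h4 : ε (blk φ j) = 1 := mul_left_cancel₀ h3 (h2.trans (mul_one _).symm)
    rw [h4, one_smul] at h1
    exact h1
  have hfix : ∀ i, σ i = i → i = j := by
    intro i hi
    by_contra hne
    apply hodd
    have hSe : S (e i) = e i := by rw [hσ, hi]
    have hre : brep φ i (e i) = 1 := by simp [brep_apply, e, blk]
    have hchi : chi (brep φ i) ∘ₗ S = chi (brep φ i) := by
      let τ : Matrix (Fin (d i)) (Fin (d i)) K →ₗ[K] K := chi (brep φ i) ∘ₗ S ∘ₗ φ.symm.toLinearMap ∘ₗ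
        LinearMap.single K (fun i => Matrix (Fin (d i)) (Fin (d i)) K) i
      have hτ : ∀ M, τ M = (brep φ i (S (φ.symm (Pi.single i M)))).trace := fun M => rfl
      have h1 : ∀ x y, τ (x * y) = τ (y * x) := by
        intro x y
        rw [hτ, hτ, Pi.single_mul, Pi.single_mul, map_mul φ.symm, map_mul φ.symm, hSanti, hSanti, map_mul (brep φ i), map_mul (brep φ i), Matrix.trace_mul_comm]
      have h2 : τ 1 = d i := by
        rw [hτ]
        change (brep φ i (S (e i))).trace = _
        rw [hSe, hre, Matrix.trace_one, Fintype.card_fin]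
      ext x
      have h3 := tracial_eq τ h1 h2 (brep φ i x)
      rw [hτ, ← blk_mul_eq, hSanti, map_mul] at h3
      change (_ * brep φ i (S (e i))).trace = _ at h3
      rw [hSe, hre, mul_one] at h3
      exact h3
    refine even_of_selfdual (brep φ i) F ?_ ?_
    · rw [← hj]
      change (φ (φ.symm (Pi.single j 1)) i).trace = 0
      rw [AlgEquiv.apply_symm_apply, Pi.single_eq_of_ne hne, Matrix.trace_zero]
    · have := omega_L (brep φ i) F hS (brep_surj φ i) (hd i)
      rw [omega_eq, hchi] at this
      exact this
  refine odd_of_no_selfdual (brep φ i) F (brep_surj φ i) (hd i) e (blk_mul_self φ) (blk_sum φ) σ hσ hσσ j hj ?_ hfix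
  apply einj
  rw [← hσ, hj, F.S_L]

end Thm0
end HopfEven

open scoped TensorProduct
open WithConv Coalgebra

namespace HopfEven

section Cong
variable {R : Type*} [CommRing R]

/-- congruence modulo `q` -/
def Cg {M : Type*} [AddCommGroup M] [Module R M] (q : R) (x y : M) : Prop := ∃ z : M, x - y = q • z

namespace Cg
variable {M N B : Type*} [AddCommGroup M] [Module R M] [AddCommGroup N] [Module R N] [Ring B] [Algebra R B] {q r : R}

@[refl] lemma refl (x : M) : Cg q x x := ⟨0, by simp⟩
lemma of_eq {x y : M} (h : x = y) : Cg q x y := h ▸ refl x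
lemma symm {x y : M} (h : Cg q x y) : Cg q y x := by
  obtain ⟨z, hz⟩ := h; exact ⟨-z, by rw [smul_neg, ← hz]; abel⟩
lemma trans {x y z : M} (h : Cg q x y) (h' : Cg q y z) : Cg q x z := by
  obtain ⟨u, hu⟩ := h; obtain ⟨v, hv⟩ := h'
  exact ⟨u + v, by rw [smul_add, ← hu, ← hv]; abel⟩
lemma add {x y x' y' : M} (h : Cg q x y) (h' : Cg q x' y') : Cg q (x + x') (y + y') := by
  obtain ⟨u, hu⟩ := h; obtain ⟨v, hv⟩ := h'
  exact ⟨u + v, by rw [smul_add, ← hu, ← hv]; abel⟩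
lemma neg {x y : M} (h : Cg q x y) : Cg q (-x) (-y) := by
  obtain ⟨u, hu⟩ := h
  exact ⟨-u, by rw [smul_neg, ← hu]; abel⟩
lemma sub {x y x' y' : M} (h : Cg q x y) (h' : Cg q x' y') : Cg q (x - x') (y - y') := by
  simpa [sub_eq_add_neg] using h.add h'.neg
lemma smul {x y : M} (c : R) (h : Cg q x y) : Cg q (c • x) (c • y) := by
  obtain ⟨u, hu⟩ := h
  exact ⟨c • u, by rw [← smul_sub, hu, smul_comm]⟩
lemma smul' {x y : M} (c : R) (h : Cg q x y) : Cg (c * q) (c • x) (c • y) := by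
  obtain ⟨u, hu⟩ := h
  exact ⟨u, by rw [← smul_sub, hu, mul_smul]⟩
lemma sum {ι : Type*} (s : Finset ι) {f g : ι → M} (h : ∀ i ∈ s, Cg q (f i) (g i)) :
    Cg q (∑ i ∈ s, f i) (∑ i ∈ s, g i) := by
  classical
  induction s using Finset.induction_on with
  | empty => simpa using refl _
  | insert a s ha ih =>
    rw [Finset.sum_insert ha, Finset.sum_insert ha]
    exact (h a (by simp)).add (ih fun i hi => h i (by simp [hi]))
lemma map {x y : M} (f : M →ₗ[R] N) (h : Cg q x y) : Cg q (f x) (f y) := by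
  obtain ⟨u, hu⟩ := h
  exact ⟨f u, by rw [← map_sub, hu, map_smul]⟩
lemma mul {x y x' y' : B} (h : Cg q x y) (h' : Cg q x' y') : Cg q (x * x') (y * y') := by
  obtain ⟨u, hu⟩ := h; obtain ⟨v, hv⟩ := h'
  refine ⟨u * x' + y * v, ?_⟩
  rw [smul_add, ← smul_mul_assoc, ← mul_smul_comm, ← hu, ← hv]; noncomm_ring
lemma mul_left {x y : B} (a : B) (h : Cg q x y) : Cg q (a * x) (a * y) := (refl a).mul h
lemma mul_right {x y : B} (a : B) (h : Cg q x y) : Cg q (x * a) (y * a) := h.mul (refl a)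
lemma of_dvd {x y : M} (h : Cg r x y) (hd : q ∣ r) : Cg q x y := by
  obtain ⟨u, hu⟩ := h; obtain ⟨c, rfl⟩ := hd
  exact ⟨c • u, by rw [hu, mul_smul]⟩
lemma smul_zero (z : M) : Cg q (q • z) 0 := ⟨z, by simp⟩
lemma cancel [IsDomain R] [Module.Free R M] (hq : q ≠ 0) {x y : M} (h : Cg (q * r) (q • x) (q • y)) : Cg r x y := by
  obtain ⟨u, hu⟩ := h
  exact ⟨u, by rw [← smul_sub, mul_smul] at hu; exact smul_right_injective M hq hu⟩
end Cg

/-- pointwise divisible linear maps are divisible -/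
lemma Cg.lin {M N : Type*} [AddCommGroup M] [Module R M] [AddCommGroup N] [Module R N] [Module.Free R M]
    {q : R} {f g : M →ₗ[R] N} (h : ∀ x, Cg q (f x) (g x)) : Cg q f g := by
  choose z hz using h
  let b := Module.Free.chooseBasis R M
  refine ⟨b.constr R (fun i => z (b i)), b.ext fun i => ?_⟩
  simp [hz]

lemma Cg.app {M N : Type*} [AddCommGroup M] [Module R M] [AddCommGroup N] [Module R N]
    {q : R} {f g : M →ₗ[R] N} (h : Cg q f g) (x : M) : Cg q (f x) (g x) := by
  obtain ⟨z, hz⟩ := h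
  exact ⟨z x, by rw [← LinearMap.sub_apply, hz]; rfl⟩

end Cong

section Unif
set_option linter.unusedSectionVars false
variable {R K : Type*} [CommRing R] [IsDomain R] [Field K]

structure Unif (κ : R →+* K) (ϖ : R) : Prop where
  surj : Function.Surjective κ
  ker : ∀ r, κ r = 0 ↔ ϖ ∣ r
  ne : ϖ ≠ 0
  complete : IsAdicComplete (Ideal.span {ϖ}) R

variable {κ : R →+* K} {ϖ : R}

lemma smod_iff (n : ℕ) (x y : R) : x ≡ y [SMOD ((Ideal.span {ϖ}) ^ n • ⊤ : Ideal R)] ↔ Cg (ϖ ^ n) x y := by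
  rw [SModEq.sub_mem, Ideal.span_singleton_pow, smul_eq_mul, Ideal.mul_top, Ideal.mem_span_singleton]
  rfl

variable {X : Type*} [AddCommGroup X] [Module R X] [Module.Free R X] [Module.Finite R X]

lemma Unif.sep (U : Unif κ ϖ) (x y : X) (h : ∀ n, Cg (ϖ ^ n) x y) : x = y := by
  have := U.complete
  let b := Module.Free.chooseBasis R X
  refine b.ext_elem fun i => ?_
  rw [← sub_eq_zero]
  refine (inferInstance : IsHausdorff (Ideal.span {ϖ}) R).haus' _ fun n => ?_
  rw [smod_iff]
  have h1 := ((h n).map (b.coord i)).sub (Cg.refl (b.coord i y))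
  simpa using h1

lemma Unif.limit (U : Unif κ ϖ) (x : ℕ → X) (h : ∀ n, Cg (ϖ ^ (n+1)) (x (n+1)) (x n)) :
    ∃ y, ∀ n, Cg (ϖ ^ (n+1)) y (x n) := by
  have := U.complete
  let b := Module.Free.chooseBasis R X
  have h2 : ∀ m n, m ≤ n → Cg (ϖ ^ (m+1)) (x n) (x m) := by
    intro m n hmn
    induction n, hmn using Nat.le_induction with
    | base => exact Cg.refl _
    | succ n hmn ih => exact ((h n).of_dvd (pow_dvd_pow _ (by omega))).trans ih
  have h3 : ∀ i, ∃ c : R, ∀ n, Cg (ϖ ^ n) (b.coord i (x n)) c := by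
    intro i
    obtain ⟨c, hc⟩ := (inferInstance : IsPrecomplete (Ideal.span {ϖ}) R).prec' (fun n => b.coord i (x n)) (by
      intro m n hmn
      rw [smod_iff]
      exact (((h2 m n hmn).of_dvd (pow_dvd_pow _ (by omega))).map (b.coord i)).symm)
    exact ⟨c, fun n => (smod_iff n _ _).1 (hc n)⟩
  choose c hc using h3
  refine ⟨∑ i, c i • b i, fun n => ?_⟩
  refine Cg.trans ?_ (h2 n (n+1) (by omega))
  conv => arg 3; rw [← b.sum_repr (x (n+1))]
  refine Cg.sum _ fun i _ => ?_
  obtain ⟨z, hz⟩ := hc i (n+1)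
  have hz' : (b.repr (x (n+1))) i - c i = ϖ ^ (n+1) * z := hz
  refine Cg.symm ⟨z • b i, ?_⟩
  rw [← sub_smul, hz', mul_smul]

lemma Unif.limit' (U : Unif κ ϖ) (P : ℕ → X → Prop) (x0 : X) (h0 : P 0 x0)
    (h : ∀ n x, P n x → ∃ y, P (n+1) y ∧ Cg (ϖ ^ (n+1)) y x) :
    ∃ y, ∀ n, ∃ x, P n x ∧ Cg (ϖ ^ (n+1)) y x := by
  choose! f hf1 hf2 using h
  let s : ℕ → X := fun n => Nat.rec x0 (fun n x => f n x) n
  have hs : ∀ n, P n (s n) := by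
    intro n
    induction n with
    | zero => exact h0
    | succ n ih => exact hf1 n _ ih
  obtain ⟨y, hy⟩ := U.limit s (fun n => hf2 n _ (hs n))
  exact ⟨y, fun n => ⟨s n, hs n, hy n⟩⟩

lemma Unif.bij (U : Unif κ ϖ) (T : X →ₗ[R] X) (h : ∀ x, Cg ϖ (T x) x) : Function.Bijective T := by
  have := U.complete
  have hs : Function.Surjective T := by
    rw [← LinearMap.range_eq_top, ← top_le_iff]
    refine Submodule.le_of_le_smul_of_le_jacobson_bot (I := Ideal.span {ϖ}) (Module.Finite.fg_top) 
      (IsAdicComplete.le_jacobson_bot _) ?_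
    intro x _
    obtain ⟨z, hz⟩ := h x
    have : x = T x + ϖ • (-z) := by rw [smul_neg, ← hz]; abel
    rw [this]
    exact Submodule.add_mem_sup ⟨x, rfl⟩ (Submodule.smul_mem_smul (Ideal.mem_span_singleton_self _) trivial)
  exact ⟨OrzechProperty.injective_of_surjective_endomorphism T hs, hs⟩

lemma Unif.isUnit {B : Type*} [Ring B] [Algebra R B] [Module.Free R B] [Module.Finite R B] (U : Unif κ ϖ)
    (c : B) (h : Cg ϖ c 1) : IsUnit c := by
  obtain ⟨x, hx⟩ := (U.bij (LinearMap.mulLeft R c) (fun x => by simpa using h.mul_right x)).2 1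
  obtain ⟨y, hy⟩ := (U.bij (LinearMap.mulRight R c) (fun x => by simpa using h.mul_left x)).2 1
  have hx' : c * x = 1 := hx
  have hy' : y * c = 1 := hy
  have : y = x := by rw [← mul_one y, ← hx', ← mul_assoc, hy', one_mul]
  exact ⟨⟨c, x, hx', this ▸ hy'⟩, rfl⟩

/-- good reductions -/
def Good (κ : R →+* K) {M N : Type*} [AddCommGroup M] [Module R M] [AddCommGroup N] [Module K N] (f : M →ₛₗ[κ] N) : Prop :=
  ∃ (n : ℕ) (b : Module.Basis (Fin n) R M) (b' : Module.Basis (Fin n) K N), ∀ i, f (b i) = b' i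

variable {M N M' N' : Type*} [AddCommGroup M] [Module R M] [AddCommGroup N] [Module K N]
  [AddCommGroup M'] [Module R M'] [AddCommGroup N'] [Module K N']

lemma Good.tensor {f : M →ₛₗ[κ] N} {g : M' →ₛₗ[κ] N'} (hf : Good κ f) (hg : Good κ g) :
    Good κ (TensorProduct.map f g) := by
  obtain ⟨n, b, b', h⟩ := hf
  obtain ⟨m, c, c', h'⟩ := hg
  refine ⟨n * m, (b.tensorProduct c).reindex finProdFinEquiv, (b'.tensorProduct c').reindex finProdFinEquiv, fun i => ?_⟩
  simp [Module.Basis.tensorProduct_apply, h, h']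

lemma Good.surj (U : Unif κ ϖ) {f : M →ₛₗ[κ] N} (hf : Good κ f) : Function.Surjective f := by
  obtain ⟨n, b, b', h⟩ := hf
  intro y
  choose c hc using fun i => U.surj (b'.repr y i)
  refine ⟨∑ i, c i • b i, ?_⟩
  simp only [map_sum, LinearMap.map_smulₛₗ, h, hc]
  exact b'.sum_repr y

lemma Good.ker (U : Unif κ ϖ) {f : M →ₛₗ[κ] N} (hf : Good κ f) (x y : M) : f x = f y ↔ Cg ϖ x y := by
  constructor
  · intro hxy
    have h0 : f (x - y) = 0 := by rw [map_sub, hxy, sub_self]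
    obtain ⟨n, b, b', h⟩ := hf
    rw [← b.sum_repr (x - y)] at h0
    simp only [map_sum, LinearMap.map_smulₛₗ, h] at h0
    have h1 := fun i => Fintype.linearIndependent_iff.1 b'.linearIndependent _ h0 i
    choose c hc using fun i => (U.ker _).1 (h1 i)
    refine ⟨∑ i, c i • b i, ?_⟩
    rw [Finset.smul_sum]
    conv_lhs => rw [← b.sum_repr (x - y)]
    exact Finset.sum_congr rfl fun i _ => by rw [hc, mul_smul]
  · rintro ⟨z, hz⟩
    rw [← sub_eq_zero, ← map_sub, hz, LinearMap.map_smulₛₗ, (U.ker ϖ).2 dvd_rfl, zero_smul]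

end Unif
end HopfEven

open scoped TensorProduct
open WithConv Coalgebra

namespace HopfEven

section CoMaps
variable {R A : Type*} [CommRing R] [Ring A] [Algebra R A] (D : A →ₐ[R] A ⊗[R] A)
variable (E : Type*) [Ring E] [Algebra R E]

/-- comultiply the first tensor factor -/
noncomputable def c1 : A ⊗[R] E →ₐ[R] A ⊗[R] (A ⊗[R] E) :=
  (Algebra.TensorProduct.assoc R R R A A E).toAlgHom.comp (Algebra.TensorProduct.map D (AlgHom.id R E))

variable {E} in
/-- apply a map to the remaining tensor factors -/
noncomputable def c2 {E' : Type*} [Ring E'] [Algebra R E'] (f : E →ₐ[R] E') : A ⊗[R] E →ₐ[R] A ⊗[R] E' :=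
  Algebra.TensorProduct.map (AlgHom.id R A) f

variable (R A) in
noncomputable def jl : E →ₐ[R] A ⊗[R] E := Algebra.TensorProduct.includeRight

variable (R A) in
noncomputable def jr1 : A →ₐ[R] A ⊗[R] A := Algebra.TensorProduct.includeLeft
variable (R A) in
noncomputable def jr2 : A ⊗[R] A →ₐ[R] A ⊗[R] (A ⊗[R] A) := c2 (jr1 R A)
variable (R A) in
noncomputable def jr3 : A ⊗[R] (A ⊗[R] A) →ₐ[R] A ⊗[R] (A ⊗[R] (A ⊗[R] A)) := c2 (jr2 R A)

noncomputable def dl : A →ₐ[R] A ⊗[R] (A ⊗[R] A) := (c1 D A).comp D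
noncomputable def dr : A →ₐ[R] A ⊗[R] (A ⊗[R] A) := (c2 D).comp D

@[simp] lemma c2_tmul {E E' : Type*} [Ring E] [Algebra R E] [Ring E'] [Algebra R E'] (f : E →ₐ[R] E') (a : A) (e : E) :
    c2 f (a ⊗ₜ[R] e) = a ⊗ₜ f e := by simp [c2]
@[simp] lemma jl_apply (e : E) : jl R A E e = 1 ⊗ₜ e := rfl
@[simp] lemma jr1_apply (e : A) : jr1 R A e = e ⊗ₜ 1 := rfl

lemma c1_tmul (a : A) (e : E) : c1 D E (a ⊗ₜ e) = Algebra.TensorProduct.assoc R R R A A E (D a ⊗ₜ e) := by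
  simp [c1]

variable (R A) in
noncomputable def asr : (A ⊗[R] (A ⊗[R] A)) ⊗[R] A →ₐ[R] A ⊗[R] (A ⊗[R] (A ⊗[R] A)) :=
  (c2 (Algebra.TensorProduct.assoc R R R A A A).toAlgHom).comp (Algebra.TensorProduct.assoc R R R A (A ⊗[R] A) A).toAlgHom

noncomputable def er (f : A →ₐ[R] A ⊗[R] (A ⊗[R] A)) : A ⊗[R] A →ₐ[R] A ⊗[R] (A ⊗[R] (A ⊗[R] A)) :=
  (asr R A).comp (Algebra.TensorProduct.map f (AlgHom.id R A))

lemma er_tmul (f : A →ₐ[R] A ⊗[R] (A ⊗[R] A)) (a b : A) : er f (a ⊗ₜ b) = asr R A (f a ⊗ₜ b) := by simp [er]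

lemma asr_tmul (a b c d : A) : asr R A ((a ⊗ₜ (b ⊗ₜ c)) ⊗ₜ d) = a ⊗ₜ (b ⊗ₜ (c ⊗ₜ d)) := by simp [asr]

lemma jr3_eq (x : A ⊗[R] (A ⊗[R] A)) : jr3 R A x = asr R A (x ⊗ₜ 1) := by
  induction x with
  | zero => simp
  | add x y hx hy => simp [TensorProduct.add_tmul, hx, hy]
  | tmul a y =>
    induction y with
    | zero => simp
    | add x y hx hy => 
      rw [TensorProduct.tmul_add, map_add, hx, hy, TensorProduct.add_tmul, map_add]
    | tmul b c => rw [asr_tmul]; simp [jr3, jr2]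

lemma tw_ten {E C : Type*} [Ring E] [Algebra R E] [Ring C] [Algebra R C] (f g : A ⊗[R] E →ₐ[R] C) (p : C)
    (h : ∀ a b, f (a ⊗ₜ b) * p = p * g (a ⊗ₜ b)) (t : A ⊗[R] E) : f t * p = p * g t := by
  induction t with
  | zero => simp
  | add x y hx hy => rw [map_add, add_mul, hx, hy, map_add, mul_add]
  | tmul a b => exact h a b

lemma er_jr3 (f g : A →ₐ[R] A ⊗[R] (A ⊗[R] A)) (p : A ⊗[R] (A ⊗[R] A)) (h : ∀ x, f x * p = p * g x) (t : A ⊗[R] A) :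
    er f t * jr3 R A p = jr3 R A p * er g t := by
  refine tw_ten (C := A ⊗[R] (A ⊗[R] (A ⊗[R] A))) (er f) (er g) _ (fun a b => ?_) t
  rw [er_tmul, er_tmul, jr3_eq, ← map_mul, ← map_mul]; simp [h]

lemma c2_jl {E E' : Type*} [Ring E] [Algebra R E] [Ring E'] [Algebra R E'] (f g : E →ₐ[R] E') (p : E') (h : ∀ x, f x * p = p * g x) (t : A ⊗[R] E) :
    c2 f t * jl R A E' p = jl R A E' p * c2 g t := by
  induction t with
  | zero => simp
  | add x y hx hy => rw [map_add, add_mul, hx, hy, map_add, mul_add]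
  | tmul a b => simp [h]

lemma c2_c2 {E E' E'' : Type*} [Ring E] [Algebra R E] [Ring E'] [Algebra R E'] [Ring E''] [Algebra R E'']
    (f : E →ₐ[R] E') (g : E' →ₐ[R] E'') (t : A ⊗[R] E) : c2 g (c2 f t) = c2 (g.comp f) t := by
  induction t with
  | zero => simp
  | add x y hx hy => simp only [map_add, hx, hy]
  | tmul a b => simp

lemma c2_c1 {E E' : Type*} [Ring E] [Algebra R E] [Ring E'] [Algebra R E'] (f : E →ₐ[R] E') (t : A ⊗[R] E) :
    c2 (c2 f) (c1 D E t) = c1 D E' (c2 f t) := by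
  induction t with
  | zero => simp
  | add x y hx hy => simp only [map_add, hx, hy]
  | tmul a b =>
    rw [c1_tmul, c2_tmul, c1_tmul]
    generalize D a = s
    induction s with
    | zero => simp
    | add x y hx hy => simp only [TensorProduct.add_tmul, map_add, hx, hy]
    | tmul c d => simp

lemma d1_dl (x : A) : c1 D (A ⊗[R] A) (dl D x) = er (dl D) (D x) := by
  simp only [dl, AlgHom.comp_apply]
  generalize D x = t
  induction t with
  | zero => simp
  | add x y hx hy => simp only [map_add, hx, hy]
  | tmul a b =>
    rw [c1_tmul, er_tmul, AlgHom.comp_apply]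
    generalize D a = s
    induction s with
    | zero => simp
    | add x y hx hy => simp only [TensorProduct.add_tmul, map_add, hx, hy]
    | tmul c d =>
      rw [Algebra.TensorProduct.assoc_tmul, c1_tmul, c1_tmul]
      generalize D c = r
      induction r with
      | zero => simp
      | add x y hx hy => simp only [TensorProduct.add_tmul, map_add, hx, hy]
      | tmul e f => rw [Algebra.TensorProduct.assoc_tmul, Algebra.TensorProduct.assoc_tmul, asr_tmul]

lemma er_dr (x : A) : er (dr D) (D x) = c2 (c1 D A) (dl D x) := by
  simp only [dl, AlgHom.comp_apply]
  generalize D x = t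
  induction t with
  | zero => simp
  | add x y hx hy => simp only [map_add, hx, hy]
  | tmul a b =>
    rw [c1_tmul, er_tmul, dr, AlgHom.comp_apply]
    generalize D a = s
    induction s with
    | zero => simp
    | add x y hx hy => simp only [TensorProduct.add_tmul, map_add, hx, hy]
    | tmul c d =>
      rw [Algebra.TensorProduct.assoc_tmul, c2_tmul, c2_tmul, c1_tmul]
      generalize D d = r
      induction r with
      | zero => simp
      | add x y hx hy => simp only [TensorProduct.add_tmul, TensorProduct.tmul_add, map_add, hx, hy]
      | tmul e f => rw [Algebra.TensorProduct.assoc_tmul, asr_tmul]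

lemma d2_dr (x : A) : c2 (c1 D A) (dr D x) = c2 (dl D) (D x) := by
  simp only [dr, AlgHom.comp_apply]; rw [c2_c2]; rfl
lemma d3_dr (x : A) : c2 (c2 D) (dr D x) = c2 (dr D) (D x) := by
  rw [dr, AlgHom.comp_apply, c2_c2]
lemma d3_dl (x : A) : c2 (c2 D) (dl D x) = c1 D (A ⊗[R] A) (dr D x) := by
  simp only [dr, dl, AlgHom.comp_apply]; rw [c2_c1]

/-- the two sides of the pentagon -/
noncomputable def pent1 (p : A ⊗[R] (A ⊗[R] A)) := c1 D (A ⊗[R] A) p * c2 (c2 D) p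
noncomputable def pent2 (p : A ⊗[R] (A ⊗[R] A)) := jr3 R A p * c2 (c1 D A) p * jl R A _ p

lemma tw {B C : Type*} [Ring B] [Ring C] [Algebra R B] [Algebra R C] (f : B →ₐ[R] C) {a b p : B} (h : a * p = p * b) : f a * f p = f p * f b := by
  rw [← map_mul, h, map_mul]

lemma pent1_tw (p : A ⊗[R] (A ⊗[R] A)) (h : ∀ x, dl D x * p = p * dr D x) (x : A) :
    c1 D (A ⊗[R] A) (dl D x) * pent1 D p = pent1 D p * c2 (dr D) (D x) := by
  rw [pent1, ← mul_assoc, tw (c1 D (A ⊗[R] A)) (h x), mul_assoc, ← d3_dl, tw (c2 (c2 D)) (h x), d3_dr, mul_assoc]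

lemma pent2_tw (p : A ⊗[R] (A ⊗[R] A)) (h : ∀ x, dl D x * p = p * dr D x) (x : A) :
    c1 D (A ⊗[R] A) (dl D x) * pent2 D p = pent2 D p * c2 (dr D) (D x) := by
  rw [pent2, d1_dl, ← mul_assoc, ← mul_assoc, er_jr3 _ _ p h, er_dr, mul_assoc (jr3 R A p), tw (c2 (c1 D A)) (h x), d2_dr,
   ← mul_assoc, mul_assoc, c2_jl _ _ p h, ← mul_assoc]

/-- linearised pentagon -/
noncomputable def pentc (p : A ⊗[R] (A ⊗[R] A)) := c1 D (A ⊗[R] A) p + c2 (c2 D) p - (jr3 R A p + c2 (c1 D A) p + jl R A _ p)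
noncomputable def dcob (p : A ⊗[R] A) := jl R A _ p + c2 D p - (jr2 R A p + c1 D A p)
end CoMaps

end HopfEven

open scoped TensorProduct
open WithConv Coalgebra

namespace HopfEven

section F2
set_option linter.unusedSectionVars false
variable {K H : Type*} [Field K] [Ring H] [HopfAlgebra K H] [FiniteDimensional K H]
local notation "S" => HopfAlgebra.antipode K (A := H)
local notation "Δ" => comul (R := K) (A := H)
local notation "ε" => counit (R := K) (A := H)
variable {E : Type*} [Ring E] [Algebra K E]

lemma e2_id (x : H) : ∑ i ∈ (ℛ K x).index, (S ((ℛ K x).left i) ⊗ₜ[K] (1 : H)) * Δ ((ℛ K x).right i) = 1 ⊗ₜ x := by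
  have h1 := congrArg (fun f => f.ofConv x) (i2_eq (K := K) (H := H))
  have h2 := Coalgebra.Repr.convMul_apply (ℛ K x) (toConv ((i1 K H).toLinearMap ∘ₗ S)) (toConv Δ)
  simp only at h1
  erw [h2] at h1
  simpa [i1, i2] using h1.symm

lemma e1_id {L : H} {l : H →ₗ[K] K} (F : Frob L l) (x : H) :
    ∑ i ∈ (ℛ K x).index, Δ ((ℛ K x).right i) * (S (S (S ((ℛ K x).left i))) ⊗ₜ[K] (1 : H)) = 1 ⊗ₜ x := by
  have hinj : Function.Injective ((S).rTensor H) := by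
    have : Function.LeftInverse ((S ∘ₗ S ∘ₗ S).rTensor H) ((S).rTensor H) := by
      intro t
      induction t with
      | zero => simp
      | add x y hx hy => simp only [map_add, hx, hy]
      | tmul a b => simp [F.S4]
    exact this.injective
  apply hinj
  have e1 : ∀ t : H ⊗[K] H, ∀ a, (S).rTensor H (t * (S (S (S a)) ⊗ₜ[K] (1 : H))) = (a ⊗ₜ 1) * (S).rTensor H t := by
    intro t a
    induction t with
    | zero => simp
    | add x y hx hy => simp only [map_add, hx, hy, mul_add, add_mul]
    | tmul c b => simp [F.S4, HopfAlgebra.antipode_mul_antidistrib]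
  rw [map_sum]
  simp only [e1]
  have e2 : toConv ((S).rTensor H ∘ₗ Δ) = toConv ((i1 K H).toLinearMap ∘ₗ S) * toConv (i2 K H).toLinearMap := by
    ext h
    rw [Coalgebra.Repr.convMul_apply (ℛ K h)]
    conv_lhs => simp; rw [← (ℛ K h).eq]
    simp [i1, i2]
  have e3 : toConv (i1 K H).toLinearMap * toConv ((S).rTensor H ∘ₗ Δ) = toConv (i2 K H).toLinearMap := by
    rw [e2, ← mul_assoc, conv_alg_right, one_mul]
  have h1 := congrArg (fun f => f.ofConv x) e3
  have h2 := Coalgebra.Repr.convMul_apply (ℛ K x) (toConv (i1 K H).toLinearMap) (toConv ((S).rTensor H ∘ₗ Δ))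
  simp only at h1
  erw [h2] at h1
  simpa [i1, i2] using h1

lemma lam1_nak {L : H} {l : H →ₗ[K] K} (F : Frob L l) (t : H ⊗[K] E) (g : H) :
    lam1 l (t * (g ⊗ₜ 1)) = lam1 l ((S (S g) ⊗ₜ 1) * t) := by
  induction t with
  | zero => simp
  | add x y hx hy => simp only [map_add, hx, hy, mul_add, add_mul]
  | tmul c b => simp [F.nakayama c g]

lemma f2_frob {L : H} {l : H →ₗ[K] K} (F : Frob L l) (ρ : H →ₐ[K] E) (c : H ⊗[K] E)
    (hc : ∀ x, c * c2 ρ (Δ x) = c2 ρ (Δ x) * c) (x : H) : lam1 l c * ρ x = ρ x * lam1 l c := by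
  have h1 := congrArg (c2 (R := K) ρ) (e1_id F x)
  have h2 := congrArg (c2 (R := K) ρ) (e2_id x)
  simp only [map_sum, map_mul, c2_tmul, map_one] at h1 h2
  rw [← lam1_mul_right, ← lam1_mul_left]
  conv_lhs => rw [← h1]
  conv_rhs => rw [← h2]
  simp only [Finset.mul_sum, Finset.sum_mul, map_sum]
  refine Finset.sum_congr rfl fun i _ => ?_
  rw [← mul_assoc, lam1_nak F, hc, F.S4, mul_assoc]

/-- averaging an invariant element -/
lemma f2 [IsSemisimpleRing H] {l : H →ₗ[K] K} (hl : ∀ x, lam1 l (Δ x) = l x • (1 : H)) (l1 : l 1 = 1)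
    (ρ : H →ₐ[K] E) (c : H ⊗[K] E)
    (hc : ∀ x, c * c2 ρ (Δ x) = c2 ρ (Δ x) * c) (x : H) : lam1 l c * ρ x = ρ x * lam1 l c := by
  obtain ⟨L, hL1, hL2, hL3⟩ := exists_integral (Bialgebra.counitAlgHom K H)
  obtain ⟨k, F⟩ := exists_frob hl l1 (L := L) ⟨hL1, hL2, hL3⟩
  have hk : k ≠ 0 := by
    rintro rfl
    exact F.one (by simp)
  have h := f2_frob F ρ c hc x
  have e1 : ∀ t : H ⊗[K] E, lam1 (k • l) t = k • lam1 l t := by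
    intro t
    induction t with
    | zero => simp
    | add x y hx hy => simp only [map_add, hx, hy, smul_add]
    | tmul c b => simp [mul_smul]
  rw [e1, smul_mul_assoc, mul_smul_comm] at h
  exact smul_right_injective _ hk h

lemma lam1_c2 {E' : Type*} [Ring E'] [Algebra K E'] (l : H →ₗ[K] K) (f : E →ₐ[K] E') (t : H ⊗[K] E) :
    lam1 l (c2 f t) = f (lam1 l t) := by
  induction t with
  | zero => simp
  | add x y hx hy => simp only [map_add, hx, hy]
  | tmul c b => simp

lemma lam1_c1 {l : H →ₗ[K] K} (hl : ∀ x, lam1 l (Δ x) = l x • (1 : H)) (t : H ⊗[K] E) :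
    lam1 l (c1 (Bialgebra.comulAlgHom K H) E t) = 1 ⊗ₜ lam1 l t := by
  induction t with
  | zero => simp
  | add x y hx hy => simp only [map_add, hx, hy, TensorProduct.tmul_add]
  | tmul a b =>
    have : ∀ s : H ⊗[K] H, lam1 l (Algebra.TensorProduct.assoc K K K H H E (s ⊗ₜ b)) = lam1 l s ⊗ₜ b := by
      intro s
      induction s with
      | zero => simp
      | add x y hx hy => simp only [map_add, hx, hy, TensorProduct.add_tmul]
      | tmul c d => simp [TensorProduct.smul_tmul']
    rw [c1_tmul, this]
    simp [hl, TensorProduct.smul_tmul']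

lemma lam1_pentc {l : H →ₗ[K] K} (hl : ∀ x, lam1 l (Δ x) = l x • (1 : H)) (l1 : l 1 = 1) (p : H ⊗[K] (H ⊗[K] H)) :
    lam1 l (pentc (Bialgebra.comulAlgHom K H) p) = dcob (Bialgebra.comulAlgHom K H) (lam1 l p) - p := by
  rw [pentc, dcob, map_sub, map_add, map_add, map_add, lam1_c1 hl, lam1_c2, lam1_c2, jr3, lam1_c2]
  simp only [jl_apply, lam1_tmul, l1, one_smul]
  abel

/-- `H³`-vanishing -/
lemma exists_cobound [IsSemisimpleRing H] {l : H →ₗ[K] K} (hl : ∀ x, lam1 l (Δ x) = l x • (1 : H)) (l1 : l 1 = 1)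
    (p : H ⊗[K] (H ⊗[K] H))
    (hp : ∀ x, pentc (Bialgebra.comulAlgHom K H) p * c2 (dr (Bialgebra.comulAlgHom K H)) (Bialgebra.comulAlgHom K H x) =
      c2 (dr (Bialgebra.comulAlgHom K H)) (Bialgebra.comulAlgHom K H x) * pentc (Bialgebra.comulAlgHom K H) p) :
    ∃ q, ∀ x, (p - dcob (Bialgebra.comulAlgHom K H) q) * dr (Bialgebra.comulAlgHom K H) x = 
      dr (Bialgebra.comulAlgHom K H) x * (p - dcob (Bialgebra.comulAlgHom K H) q) := by
  refine ⟨lam1 l p, fun x => ?_⟩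
  have := f2 hl l1 (dr (Bialgebra.comulAlgHom K H)) _ hp x
  rw [lam1_pentc hl l1, sub_mul, mul_sub] at this
  rw [sub_mul, mul_sub]
  rw [← neg_sub, this, neg_sub]
end F2
end HopfEven

open scoped TensorProduct
open WithConv Coalgebra

namespace HopfEven

section LiftHom
set_option linter.unusedSectionVars false

/-- a separability element -/
structure SepElt (R A : Type*) [CommRing R] [Ring A] [Algebra R A] where
  n : ℕ
  a : Fin n → A
  b : Fin n → A
  sum : ∑ i, a i * b i = 1
  comm : ∀ x, ∑ i, (x * a i) ⊗ₜ[R] b i = ∑ i, a i ⊗ₜ[R] (b i * x)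

variable {R K A B : Type*} [CommRing R] [IsDomain R] [Field K] [Ring A] [Algebra R A] [Ring B] [Algebra R B]
variable {κ : R →+* K} {ϖ : R}

lemma SepElt.bil (s : SepElt R A) {M : Type*} [AddCommGroup M] [Module R M] (g : A →ₗ[R] A →ₗ[R] M) (x : A) :
    ∑ i, g (x * s.a i) (s.b i) = ∑ i, g (s.a i) (s.b i * x) := by
  have := congrArg (TensorProduct.lift g) (s.comm x)
  simpa using this

/-- multiplicativity defect -/
noncomputable def dfc (f : A →ₗ[R] B) (x : A) : A →ₗ[R] B := f ∘ₗ LinearMap.mulLeft R x - LinearMap.mulLeft R (f x) ∘ₗ f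

lemma dfc_apply (f : A →ₗ[R] B) (x y : A) : dfc f x y = f (x * y) - f x * f y := by simp [dfc]

noncomputable def newt (s : SepElt R A) (f : A →ₗ[R] B) : A →ₗ[R] B :=
  f + ∑ i, LinearMap.mulLeft R (f (s.a i)) ∘ₗ dfc f (s.b i)

lemma newt_apply (s : SepElt R A) (f : A →ₗ[R] B) (x : A) : newt s f x = f x + ∑ i, f (s.a i) * dfc f (s.b i) x := by
  simp [newt]

lemma Cg.of_prod {q r : R} {x y : B} (hx : Cg q x 0) (hy : Cg r y 0) : Cg (q * r) (x * y) 0 := by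
  obtain ⟨u, hu⟩ := hx; obtain ⟨v, hv⟩ := hy
  rw [sub_zero] at hu hv
  exact ⟨u * v, by rw [hu, hv, sub_zero, smul_mul_smul_comm]⟩

lemma Cg.sub_iff {M : Type*} [AddCommGroup M] [Module R M] {q : R} {x y : M} : Cg q (x - y) 0 ↔ Cg q x y := by
  simp [Cg]

lemma newt_mul (s : SepElt R A) (f : A →ₗ[R] B) {q : R} (h : ∀ x y, Cg q (f (x * y)) (f x * f y)) (h1 : Cg q (f 1) 1) (x y : A) :
    Cg (q * q) (newt s f (x * y)) (newt s f x * newt s f y) := by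
  have hE : ∀ x y, Cg q (dfc f x y) 0 := fun x y => by rw [dfc_apply, Cg.sub_iff]; exact h x y
  have coc : ∀ b, dfc f b (x * y) = dfc f (b * x) y + dfc f b x * f y - f b * dfc f x y := by
    intro b; simp only [dfc_apply, mul_assoc]; noncomm_ring
  set G := fun x => ∑ i, f (s.a i) * dfc f (s.b i) x with hG
  have hGq : ∀ x, Cg q (G x) 0 := by
    intro x
    have := Cg.sum (R := R) (q := q) Finset.univ (f := fun i => f (s.a i) * dfc f (s.b i) x) (g := fun i => 0)
      (fun i _ => by simpa using (hE (s.b i) x).mul_left (f (s.a i)))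
    simpa using this
  have e1 : ∑ i, f (s.a i) * dfc f (s.b i * x) y = ∑ i, f (x * s.a i) * dfc f (s.b i) y := by
    let g : A →ₗ[R] A →ₗ[R] B := LinearMap.mk₂ R (fun a b => f a * dfc f b y)
      (by intros; simp [add_mul]) (by intros; simp) (by intros; simp only [dfc_apply, add_mul, map_add]; noncomm_ring)
      (by intros; simp [dfc_apply, smul_sub, mul_sub])
    exact (s.bil g x).symm
  have e2 : G (x * y) = ∑ i, f (x * s.a i) * dfc f (s.b i) y + G x * f y - (∑ i, f (s.a i) * f (s.b i)) * dfc f x y := by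
    rw [← e1]
    simp only [hG, coc, mul_add, mul_sub, Finset.sum_add_distrib, Finset.sum_sub_distrib, Finset.sum_mul, mul_assoc]
  have e3 : newt s f (x * y) - newt s f x * newt s f y =
      ∑ i, dfc f x (s.a i) * dfc f (s.b i) y - (∑ i, f (s.a i) * f (s.b i) - 1) * dfc f x y - G x * G y := by
    rw [newt_apply, newt_apply, newt_apply]
    change f (x * y) + G (x * y) - (f x + G x) * (f y + G y) = _
    rw [e2]
    have : ∑ i, dfc f x (s.a i) * dfc f (s.b i) y = ∑ i, f (x * s.a i) * dfc f (s.b i) y - f x * G y := by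
      simp only [hG, Finset.mul_sum, ← Finset.sum_sub_distrib, ← mul_assoc, ← sub_mul, dfc_apply f x]
    rw [this, dfc_apply f x y]
    noncomm_ring
  rw [← Cg.sub_iff, e3]
  have h4 : Cg q (∑ i, f (s.a i) * f (s.b i) - 1) 0 := by
    rw [Cg.sub_iff]
    refine Cg.trans ?_ h1
    rw [← s.sum, map_sum]
    exact Cg.sum _ fun i _ => (h _ _).symm
  have h5 : Cg (q * q) (∑ i, dfc f x (s.a i) * dfc f (s.b i) y) 0 := by
    have := Cg.sum (R := R) (q := q * q) Finset.univ (f := fun i => dfc f x (s.a i) * dfc f (s.b i) y) (g := fun i => 0)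
      (fun i _ => (hE _ _).of_prod (hE _ _))
    simpa using this
  simpa using (h5.sub (h4.of_prod (hE x y))).sub ((hGq x).of_prod (hGq y))

lemma newt_cg (s : SepElt R A) (f : A →ₗ[R] B) {q : R} (h : ∀ x y, Cg q (f (x * y)) (f x * f y)) (x : A) :
    Cg q (newt s f x) (f x) := by
  rw [newt_apply, ← Cg.sub_iff, add_sub_cancel_left]
  have := Cg.sum (R := R) (q := q) Finset.univ (f := fun i => f (s.a i) * dfc f (s.b i) x) (g := fun i => 0)
      (fun i _ => by
        have : Cg q (dfc f (s.b i) x) 0 := by rw [dfc_apply, Cg.sub_iff]; exact h _ _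
        simpa using this.mul_left (f (s.a i)))
  simpa using this

lemma newt_one (s : SepElt R A) (f : A →ₗ[R] B) {q : R} (h : ∀ x y, Cg q (f (x * y)) (f x * f y)) (h1 : Cg q (f 1) 1) :
    Cg (q * q) (newt s f 1) 1 := by
  have h2 := newt_mul s f h h1 1 1
  have h3 := (newt_cg s f h 1).trans h1
  rw [one_mul] at h2
  set u := newt s f 1
  rw [← Cg.sub_iff] at h3
  have h4 := h3.of_prod h3
  have e : u - 1 = (u * u - u) - (u - 1) * (u - 1) := by noncomm_ring
  rw [← Cg.sub_iff, e]
  have h5 := Cg.sub_iff.2 h2.symm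
  simpa using h5.sub h4

lemma Unif.lift_hom [Module.Free R A] [Module.Finite R A] [Module.Free R B] [Module.Finite R B]
    (U : Unif κ ϖ) (s : SepElt R A) (f0 : A →ₗ[R] B) (h : ∀ x y, Cg ϖ (f0 (x * y)) (f0 x * f0 y)) (h1 : Cg ϖ (f0 1) 1) :
    ∃ f : A →ₐ[R] B, ∀ x, Cg ϖ (f x) (f0 x) := by
  obtain ⟨f, hf⟩ := U.limit' (fun n (f : A →ₗ[R] B) => (∀ x y, Cg (ϖ ^ (n+1)) (f (x * y)) (f x * f y)) ∧ Cg (ϖ ^ (n+1)) (f 1) 1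
    ∧ ∀ x, Cg ϖ (f x) (f0 x))
    f0 ⟨by simpa using h, by simpa using h1, fun x => Cg.refl _⟩ (by
      rintro n f ⟨ha, hb, hc⟩
      have hd : ϖ ^ (n + 1 + 1) ∣ ϖ ^ (n+1) * ϖ ^ (n+1) := by rw [← pow_add]; exact pow_dvd_pow _ (by omega)
      exact ⟨newt s f, ⟨fun x y => (newt_mul s f ha hb x y).of_dvd hd, (newt_one s f ha hb).of_dvd hd, 
        fun x => ((newt_cg s f ha x).of_dvd (dvd_pow_self _ (by omega))).trans (hc x)⟩, Cg.lin fun x => newt_cg s f ha x⟩)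
  have hm : ∀ x y, f (x * y) = f x * f y := by
    intro x y
    refine U.sep _ _ fun n => ?_
    obtain ⟨g, ⟨ha, hb, hc⟩, hg⟩ := hf n
    have := ((hg.app (x * y)).trans (ha x y)).trans ((hg.app x).mul (hg.app y)).symm
    exact this.of_dvd (pow_dvd_pow _ (by omega))
  have ho : f 1 = 1 := by
    refine U.sep _ _ fun n => ?_
    obtain ⟨g, ⟨ha, hb, hc⟩, hg⟩ := hf n
    exact ((hg.app 1).trans hb).of_dvd (pow_dvd_pow _ (by omega))
  refine ⟨AlgHom.ofLinearMap f ho hm, fun x => ?_⟩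
  obtain ⟨g, ⟨ha, hb, hc⟩, hg⟩ := hf 0
  exact (by simpa using hg.app x : Cg ϖ (f x) (g x)).trans (hc x)

end LiftHom
end HopfEven

open scoped TensorProduct
open WithConv Coalgebra

namespace HopfEven

section Reduct
set_option linter.unusedSectionVars false
variable {R K : Type*} [CommRing R] [IsDomain R] [Field K]

/-- a reduction map of algebras -/
structure Red (κ : R →+* K) (A E : Type*) [Ring A] [Algebra R A] [Ring E] [Algebra K E] where
  f : A →ₛₗ[κ] E
  mul : ∀ x y, f (x * y) = f x * f y
  one : f 1 = 1
  good : Good κ f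

variable {κ : R →+* K} {ϖ : R}
variable {A E B F C G : Type*} [Ring A] [Algebra R A] [Ring E] [Algebra K E] [Ring B] [Algebra R B] [Ring F] [Algebra K F]
  [Ring C] [Algebra R C] [Ring G] [Algebra K G]

lemma tmap_mul (f : A →ₛₗ[κ] E) (g : B →ₛₗ[κ] F) (hf : ∀ x y, f (x * y) = f x * f y) (hg : ∀ x y, g (x * y) = g x * g y)
    (s t : A ⊗[R] B) : TensorProduct.map f g (s * t) = TensorProduct.map f g s * TensorProduct.map f g t := by
  induction s with
  | zero => simp
  | add x y hx hy => simp only [add_mul, map_add, hx, hy]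
  | tmul a b =>
    induction t with
    | zero => simp
    | add x y hx hy => simp only [mul_add, map_add, hx, hy]
    | tmul c d => simp [hf, hg]

noncomputable def Red.tensor (p : Red κ A E) (r : Red κ B F) : Red κ (A ⊗[R] B) (E ⊗[K] F) where
  f := TensorProduct.map p.f r.f
  mul := tmap_mul p.f r.f p.mul r.mul
  one := by simp [Algebra.TensorProduct.one_def, p.one, r.one]
  good := p.good.tensor r.good

lemma Red.tensor_tmul (p : Red κ A E) (r : Red κ B F) (a : A) (b : B) : (p.tensor r).f (a ⊗ₜ b) = p.f a ⊗ₜ r.f b := rfl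

lemma Red.c2 (p : Red κ A E) (r : Red κ B F) (r' : Red κ C G) (g : B →ₐ[R] C) (g' : F →ₐ[K] G)
    (h : ∀ x, r'.f (g x) = g' (r.f x)) (t : A ⊗[R] B) : (p.tensor r').f (c2 g t) = HopfEven.c2 g' ((p.tensor r).f t) := by
  induction t with
  | zero => simp
  | add x y hx hy => simp only [map_add, hx, hy]
  | tmul a b => simp [Red.tensor_tmul, h]

lemma Red.c1 (p : Red κ A E) (r : Red κ B F) (D : A →ₐ[R] A ⊗[R] A) (D' : E →ₐ[K] E ⊗[K] E)
    (h : ∀ x, (p.tensor p).f (D x) = D' (p.f x)) (t : A ⊗[R] B) :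
    (p.tensor (p.tensor r)).f (c1 D B t) = HopfEven.c1 D' F ((p.tensor r).f t) := by
  induction t with
  | zero => simp
  | add x y hx hy => simp only [map_add, hx, hy]
  | tmul a b =>
    rw [c1_tmul, Red.tensor_tmul, c1_tmul, ← h]
    generalize D a = s
    induction s with
    | zero => simp
    | add x y hx hy => simp only [map_add, TensorProduct.add_tmul, hx, hy]
    | tmul c d => simp [Red.tensor_tmul]

lemma Red.jl (p : Red κ A E) (r : Red κ B F) (t : B) : (p.tensor r).f (jl R A B t) = HopfEven.jl K E F (r.f t) := by
  simp [Red.tensor_tmul, p.one]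
lemma Red.jr1 (p : Red κ A E) (t : A) : (p.tensor p).f (jr1 R A t) = HopfEven.jr1 K E (p.f t) := by
  simp [Red.tensor_tmul, p.one]
lemma Red.jr2 (p : Red κ A E) (t) : (p.tensor (p.tensor p)).f (jr2 R A t) = HopfEven.jr2 K E ((p.tensor p).f t) :=
  p.c2 p (p.tensor p) _ _ p.jr1 t
lemma Red.jr3 (p : Red κ A E) (t) : (p.tensor (p.tensor (p.tensor p))).f (jr3 R A t) = HopfEven.jr3 K E ((p.tensor (p.tensor p)).f t) :=
  p.c2 (p.tensor p) (p.tensor (p.tensor p)) _ _ p.jr2 t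

lemma Red.dl (p : Red κ A E) (D : A →ₐ[R] A ⊗[R] A) (D' : E →ₐ[K] E ⊗[K] E)
    (h : ∀ x, (p.tensor p).f (D x) = D' (p.f x)) (x : A) : (p.tensor (p.tensor p)).f (dl D x) = HopfEven.dl D' (p.f x) := by
  rw [HopfEven.dl, HopfEven.dl, AlgHom.comp_apply, AlgHom.comp_apply, p.c1 p D D' h, h]
lemma Red.dr (p : Red κ A E) (D : A →ₐ[R] A ⊗[R] A) (D' : E →ₐ[K] E ⊗[K] E)
    (h : ∀ x, (p.tensor p).f (D x) = D' (p.f x)) (x : A) : (p.tensor (p.tensor p)).f (dr D x) = HopfEven.dr D' (p.f x) := by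
  rw [HopfEven.dr, HopfEven.dr, AlgHom.comp_apply, AlgHom.comp_apply, p.c2 p (p.tensor p) D D' h, h]
lemma Red.pentc (p : Red κ A E) (D : A →ₐ[R] A ⊗[R] A) (D' : E →ₐ[K] E ⊗[K] E)
    (h : ∀ x, (p.tensor p).f (D x) = D' (p.f x)) (t) : 
    (p.tensor (p.tensor (p.tensor p))).f (pentc D t) = HopfEven.pentc D' ((p.tensor (p.tensor p)).f t) := by
  rw [HopfEven.pentc, HopfEven.pentc, map_sub, map_add, map_add, map_add, p.c1 (p.tensor p) D D' h, p.jr3, p.jl,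
    p.c2 (p.tensor p) (p.tensor (p.tensor p)) _ _ (p.c2 p (p.tensor p) _ _ h),
    p.c2 (p.tensor p) (p.tensor (p.tensor p)) _ _ (p.c1 p _ _ h)]
lemma Red.dcob (p : Red κ A E) (D : A →ₐ[R] A ⊗[R] A) (D' : E →ₐ[K] E ⊗[K] E)
    (h : ∀ x, (p.tensor p).f (D x) = D' (p.f x)) (t) : 
    (p.tensor (p.tensor p)).f (dcob D t) = HopfEven.dcob D' ((p.tensor p).f t) := by
  rw [HopfEven.dcob, HopfEven.dcob, map_sub, map_add, map_add, p.c1 p D D' h, p.jr2, p.jl,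
    p.c2 p (p.tensor p) _ _ h]

lemma exp5 (q : R) (a b c d e : A) : (1 + q • a) * (1 + q • b) - (1 + q • c) * (1 + q • d) * (1 + q • e) = 
    q • ((a + b - (c + d + e)) + q • (a * b - c * d - c * e - d * e - q • (c * d * e))) := by
  simp only [mul_add, add_mul, smul_add, smul_sub, mul_smul_comm, smul_mul_assoc, mul_one, one_mul, mul_assoc]
  abel

lemma exp5' (q : R) (j k p m n : A) : (1 + q • j) * (1 + q • k) * (1 + q • p) - (1 + q • m) * (1 + q • n) =
    q • ((p - (m + n - (j + k))) + q • (-(m * n - j * k - j * p - k * p - q • (j * k * p)))) := by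
  rw [← neg_sub, exp5, ← smul_neg]
  congr 1
  rw [smul_neg]
  abel

lemma jr2_eq (u : A ⊗[R] A) : jr2 R A u = Algebra.TensorProduct.assoc R R R A A A (u ⊗ₜ 1) := by
  induction u with
  | zero => simp
  | add x y hx hy => simp only [map_add, TensorProduct.add_tmul, hx, hy]
  | tmul c d => simp [jr2]

lemma c1_jr2 (D D' : A →ₐ[R] A ⊗[R] A) (u : A ⊗[R] A) (h : ∀ x, D' x * u = u * D x) (t : A ⊗[R] A) :
    c1 D' A t * jr2 R A u = jr2 R A u * c1 D A t := by
  refine tw_ten (C := A ⊗[R] (A ⊗[R] A)) (c1 D' A) (c1 D A) _ (fun a b => ?_) t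
  rw [c1_tmul, c1_tmul, jr2_eq, ← map_mul, ← map_mul]; simp [h]

lemma dl_tw (D D' : A →ₐ[R] A ⊗[R] A) (u : A ⊗[R] A) (h : ∀ x, D' x * u = u * D x) (x : A) :
    dl D' x * (jr2 R A u * c1 D A u) = (jr2 R A u * c1 D A u) * dl D x := by
  simp only [dl, AlgHom.comp_apply]
  rw [← mul_assoc, c1_jr2 D D' u h, mul_assoc, ← map_mul, h, map_mul, mul_assoc]

lemma dr_tw (D D' : A →ₐ[R] A ⊗[R] A) (u : A ⊗[R] A) (h : ∀ x, D' x * u = u * D x) (x : A) :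
    dr D' x * (jl R A _ u * c2 D u) = (jl R A _ u * c2 D u) * dr D x := by
  simp only [dr, AlgHom.comp_apply]
  rw [← mul_assoc, c2_jl D' D u h, mul_assoc, ← map_mul, h, map_mul, mul_assoc]

lemma map_one_add {B : Type*} [Ring B] [Algebra R B] (f : A →ₐ[R] B) (q : R) (x : A) : f (1 + q • x) = 1 + q • f x := by
  simp

/-- conjugating an algebra map -/
noncomputable def conjHom {B : Type*} [Ring B] [Algebra R B] (D : A →ₐ[R] B) (u : Bˣ) : A →ₐ[R] B :=
  AlgHom.ofLinearMap (LinearMap.mulLeft R (u : B) ∘ₗ LinearMap.mulRight R (↑u⁻¹ : B) ∘ₗ D.toLinearMap)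
    (by simp) (by intro x y; simp [mul_assoc])

lemma conjHom_mul {B : Type*} [Ring B] [Algebra R B] (D : A →ₐ[R] B) (u : Bˣ) (x : A) : conjHom D u x * u = u * D x := by
  simp [conjHom, mul_assoc]

end Reduct

end HopfEven

open scoped TensorProduct
open WithConv Coalgebra

namespace HopfEven

section Step
set_option linter.unusedSectionVars false
variable {R K : Type*} [CommRing R] [IsDomain R] [Field K]
variable {κ : R →+* K} {ϖ : R}
variable {A H : Type*} [Ring A] [Algebra R A] [Module.Free R A] [Module.Finite R A]

lemma exp5_ex {B : Type*} [Ring B] [Algebra R B] {q : R} (hq : ϖ ∣ q) (a b c d e : B) :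
    ∃ z, (1 + q • a) * (1 + q • b) - (1 + q • c) * (1 + q • d) * (1 + q • e) = q • z ∧ Cg ϖ z (a + b - (c + d + e)) :=
  ⟨_, exp5 q a b c d e, by
    rw [← Cg.sub_iff, add_sub_cancel_left]
    exact (Cg.smul_zero _).of_dvd hq⟩

lemma exp5_ex' {B : Type*} [Ring B] [Algebra R B] {q : R} (hq : ϖ ∣ q) (j k p m n : B) :
    ∃ z, (1 + q • j) * (1 + q • k) * (1 + q • p) - (1 + q • m) * (1 + q • n) = q • z ∧ Cg ϖ z (p - (m + n - (j + k))) :=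
  ⟨_, exp5' q j k p m n, by
    rw [← Cg.sub_iff, add_sub_cancel_left]
    exact (Cg.smul_zero _).of_dvd hq⟩

/-- the intertwiner -/
noncomputable def itw (s : SepElt R A) {B : Type*} [Ring B] [Algebra R B] (f g : A →ₐ[R] B) : B := ∑ i, f (s.a i) * g (s.b i)

lemma itw_tw (s : SepElt R A) {B : Type*} [Ring B] [Algebra R B] (f g : A →ₐ[R] B) (x : A) : f x * itw s f g = itw s f g * g x := by
  let b : A →ₗ[R] A →ₗ[R] B := LinearMap.mk₂ R (fun a b => f a * g b)
      (by intros; simp [add_mul]) (by intros; simp) (by intros; simp [mul_add])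
      (by intros; simp)
  have := s.bil b x
  simp only [b, LinearMap.mk₂_apply, map_mul] at this
  simp only [itw, Finset.mul_sum, Finset.sum_mul, ← mul_assoc] at this ⊢
  exact this

lemma itw_cg (s : SepElt R A) {B : Type*} [Ring B] [Algebra R B] (f g : A →ₐ[R] B) {q : R} (h : ∀ x, Cg q (f x) (g x)) :
    Cg q (itw s f g) 1 := by
  have : Cg q (itw s f g) (∑ i, f (s.a i) * f (s.b i)) := Cg.sum _ fun i _ => (h _).symm.mul_left _
  simp only [← map_mul, ← map_sum, s.sum, map_one] at this
  exact this

variable [Ring H] [HopfAlgebra K H] [FiniteDimensional K H] [IsSemisimpleRing H]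
local notation "Δ" => Bialgebra.comulAlgHom K H

lemma coassH (x : H) : dl (Δ) x = dr (Δ) x := by
  have h := Coalgebra.coassoc_apply (R := K) x
  have e1 : ∀ t : H ⊗[K] H, c1 (Δ) H t = TensorProduct.assoc K H H H ((comul (R := K) (A := H)).rTensor H t) := by
    intro t
    induction t with
    | zero => simp
    | add x y hx hy => simp only [map_add, hx, hy]
    | tmul a b => rw [c1_tmul]; rfl
  have e2 : ∀ t : H ⊗[K] H, c2 (Δ) t = ((comul (R := K) (A := H)).lTensor H t) := by
    intro t
    induction t with
    | zero => simp
    | add x y hx hy => simp only [map_add, hx, hy]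
    | tmul a b => simp
  rw [dl, dr, AlgHom.comp_apply, AlgHom.comp_apply, e1, e2]
  exact h

lemma topH (x : H) : c1 (Δ) (H ⊗[K] H) (dl (Δ) x) = c2 (dr (Δ)) ((Δ) x) := by
  rw [coassH, ← d3_dl, coassH, d3_dr]

lemma coass_step (U : Unif κ ϖ) (s : SepElt R A) (p : Red κ A H)
    {l : H →ₗ[K] K} (hl : ∀ x, lam1 l (comul (R := K) x) = l x • (1 : H)) (l1 : l 1 = 1)
    (D : A →ₐ[R] A ⊗[R] A) (hD : ∀ x, (p.tensor p).f (D x) = (Δ) (p.f x)) {q : R} (hq0 : q ≠ 0) (hqϖ : ϖ ∣ q)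
    (hc : ∀ x, Cg q (dl D x) (dr D x)) :
    ∃ D' : A →ₐ[R] A ⊗[R] A, (∀ x, Cg q (D' x) (D x)) ∧ (∀ x, Cg (q * ϖ) (dl D' x) (dr D' x)) := by
  set φ := itw s (dl D) (dr D) with hφ
  have tφ : ∀ x, dl D x * φ = φ * dr D x := itw_tw s (dl D) (dr D)
  obtain ⟨φ', hφ'⟩ := itw_cg s (dl D) (dr D) hc
  have hφ1 : φ = 1 + q • φ' := by rw [← hφ', add_sub_cancel]
  -- pentagon defect
  obtain ⟨c', hc', hcc⟩ : ∃ c', pent1 D φ - pent2 D φ = q • c' ∧ Cg ϖ c' (pentc D φ') := by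
    rw [pent1, pent2, hφ1, map_one_add (A := A ⊗[R] (A ⊗[R] A)) (B := A ⊗[R] (A ⊗[R] (A ⊗[R] A))) (jr3 R A), map_one_add, map_one_add, map_one_add, map_one_add]
    exact exp5_ex hqϖ _ _ _ _ _
  have hcomm : ∀ x, c1 D (A ⊗[R] A) (dl D x) * c' = c' * c2 (dr D) (D x) := by
    intro x
    have h1 := pent1_tw D φ tφ x
    have h2 := pent2_tw D φ tφ x
    have h3 : c1 D (A ⊗[R] A) (dl D x) * (q • c') = (q • c') * c2 (dr D) (D x) := by
      rw [← hc', mul_sub, sub_mul, h1, h2]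
    rw [mul_smul_comm, smul_mul_assoc] at h3
    exact smul_right_injective _ hq0 h3
  set p3 := p.tensor (p.tensor p) with hp3
  set p4 := p.tensor p3 with hp4
  have hc4 : p4.f c' = pentc (Δ) (p3.f φ') := by
    rw [(p4.good.ker U c' _).2 hcc, p.pentc D (Δ) hD]
  have hcommH : ∀ y, pentc (Δ) (p3.f φ') * c2 (dr (Δ)) ((Δ) y) = c2 (dr (Δ)) ((Δ) y) * pentc (Δ) (p3.f φ') := by
    intro y
    obtain ⟨x, rfl⟩ := p.good.surj U y
    have h1 := congrArg p4.f (hcomm x)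
    rw [p4.mul, p4.mul, hc4, p.c1 (p.tensor p) D (Δ) hD, p.dl D (Δ) hD, p.c2 p p3 _ _ (p.dr D (Δ) hD), hD, topH] at h1
    exact h1.symm
  obtain ⟨ψH, hψH⟩ := exists_cobound hl l1 (p3.f φ') hcommH
  obtain ⟨ψ, rfl⟩ := (p.tensor p).good.surj U ψH
  have hu1 : Cg q (1 + q • ψ) 1 := ⟨ψ, by simp⟩
  obtain ⟨u, hu⟩ := U.isUnit (1 + q • ψ) (hu1.of_dvd hqϖ)
  rw [← hu] at hu1
  have hD' := conjHom_mul D u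
  set D' := conjHom D u with hD'def
  have hDD : ∀ x, Cg q (D' x) (D x) := by
    intro x
    have h1 : Cg q (D' x * u) (D x * u) := by
      rw [hD']
      simpa using (hu1.mul_right (D x)).trans (by simpa using (hu1.mul_left (D x)).symm)
    simpa using h1.mul_right (↑u⁻¹)
  refine ⟨D', hDD, fun x => ?_⟩
  have hD'r : ∀ x, (p.tensor p).f (D' x) = (Δ) (p.f x) := by
    intro x
    rw [← hD, (p.tensor p).good.ker U]
    exact (hDD x).of_dvd hqϖ
  set Un := jr2 R A (u : A ⊗[R] A) * c1 D A (u : A ⊗[R] A) with hUn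
  set V := jl R A _ (u : A ⊗[R] A) * c2 D (u : A ⊗[R] A) with hV
  obtain ⟨Z, hZ, hZc⟩ : ∃ Z, Un * φ - V = q • Z ∧ Cg ϖ Z (φ' - dcob D ψ) := by
    rw [hUn, hV, hφ1, hu, map_one_add, map_one_add, map_one_add, map_one_add]
    exact exp5_ex' hqϖ _ _ _ _ _
  have hZH : p3.f Z = p3.f φ' - dcob (Δ) ((p.tensor p).f ψ) := by
    rw [(p3.good.ker U _ _).2 hZc, map_sub, p.dcob D (Δ) hD]
  have e1 : dl D' x * (Un * φ) = (Un * φ) * dr D x := by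
    rw [← mul_assoc, show dl D' x * Un = Un * dl D x from dl_tw D D' u hD' x, mul_assoc Un, tφ, mul_assoc Un]
  have e2 : dr D' x * V = V * dr D x := dr_tw D D' u hD' x
  have e3 : dl D' x * V - dr D' x * V = q • (Z * dr D x - dl D' x * Z) := by
    have : Un * φ = V + q • Z := by rw [← hZ, add_sub_cancel]
    rw [this, mul_add, add_mul, mul_smul_comm, smul_mul_assoc] at e1
    rw [e2, smul_sub]
    rw [sub_eq_sub_iff_add_eq_add, e1, add_comm]
  have e4 : Cg ϖ (Z * dr D x) (dl D' x * Z) := by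
    rw [← p3.good.ker U, p3.mul, p3.mul, p.dl D' (Δ) hD'r, p.dr D (Δ) hD, hZH, hψH, coassH]
  obtain ⟨z, hz⟩ := e4
  have e5 : Cg (q * ϖ) (dl D' x * V) (dr D' x * V) := ⟨z, by rw [e3, hz, smul_smul]⟩
  have hVu : IsUnit V := (u.isUnit.map (jl R A _)).mul (u.isUnit.map (c2 D))
  obtain ⟨v, hv⟩ := hVu
  rw [← hv] at e5
  simpa using e5.mul_right (↑v⁻¹)

end Step
end HopfEven

open scoped TensorProduct
open WithConv Coalgebra

namespace HopfEven

section CoLift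
set_option linter.unusedSectionVars false
variable {R K : Type*} [CommRing R] [IsDomain R] [Field K]
variable {κ : R →+* K} {ϖ : R}

lemma Good.lift_lin (U : Unif κ ϖ) {M N N' : Type*} [AddCommGroup M] [Module R M] [Module.Free R M] [AddCommGroup N] [Module R N]
    [AddCommGroup N'] [Module K N'] {g : N →ₛₗ[κ] N'} (hg : Good κ g) (h : M →ₛₗ[κ] N') : 
    ∃ f : M →ₗ[R] N, ∀ x, g (f x) = h x := by
  let b := Module.Free.chooseBasis R M
  choose z hz using fun i => hg.surj U (h (b i))
  refine ⟨b.constr R z, fun x => ?_⟩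
  have : g.comp (b.constr R z) = h := b.ext fun i => by simp [hz]
  exact congrArg (fun f => f x) this

variable {A H : Type*} [Ring A] [Algebra R A]

lemma cg_tensor {E C : Type*} [Ring E] [Algebra R E] [Ring C] [Algebra R C] {q : R} (f g : A ⊗[R] E →ₐ[R] C)
    (h : ∀ a b, Cg q (f (a ⊗ₜ b)) (g (a ⊗ₜ b))) (t : A ⊗[R] E) : Cg q (f t) (g t) := by
  induction t with
  | zero => simpa using Cg.refl _
  | add x y hx hy => simpa using hx.add hy
  | tmul a b => exact h a b

lemma c2_cg {E E' : Type*} [Ring E] [Algebra R E] [Ring E'] [Algebra R E'] {q : R} (f g : E →ₐ[R] E') (h : ∀ x, Cg q (f x) (g x))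
    (t : A ⊗[R] E) : Cg q (c2 f t) (c2 g t) := by
  refine cg_tensor _ _ (fun a b => ?_) t
  rw [c2_tmul, c2_tmul]
  exact (h b).map (TensorProduct.mk R A E' a)

lemma c1_cg {E : Type*} [Ring E] [Algebra R E] {q : R} (f g : A →ₐ[R] A ⊗[R] A) (h : ∀ x, Cg q (f x) (g x))
    (t : A ⊗[R] E) : Cg q (c1 f E t) (c1 g E t) := by
  refine cg_tensor (c1 f E) (c1 g E) (fun a b => ?_) t
  rw [c1_tmul, c1_tmul]
  exact (h a).map ((TensorProduct.assoc R A A E).toLinearMap ∘ₗ (TensorProduct.mk R (A ⊗[R] A) E).flip b)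

lemma dl_cg {q : R} (f g : A →ₐ[R] A ⊗[R] A) (h : ∀ x, Cg q (f x) (g x)) (x : A) : Cg q (dl f x) (dl g x) := by
  simp only [dl, AlgHom.comp_apply]
  exact ((h x).map (c1 f A).toLinearMap).trans (c1_cg f g h _)

lemma dr_cg {q : R} (f g : A →ₐ[R] A ⊗[R] A) (h : ∀ x, Cg q (f x) (g x)) (x : A) : Cg q (dr f x) (dr g x) := by
  simp only [dr, AlgHom.comp_apply]
  exact ((h x).map (c2 f).toLinearMap).trans (c2_cg f g h _)

variable [Module.Free R A] [Module.Finite R A]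
variable [Ring H] [HopfAlgebra K H] [FiniteDimensional K H] [IsSemisimpleRing H]
local notation "Δ" => Bialgebra.comulAlgHom K H

lemma exists_coass_lift (U : Unif κ ϖ) (s : SepElt R A) (p : Red κ A H)
    {l : H →ₗ[K] K} (hl : ∀ x, lam1 l (comul (R := K) x) = l x • (1 : H)) (l1 : l 1 = 1) :
    ∃ D : A →ₐ[R] A ⊗[R] A, (∀ x, (p.tensor p).f (D x) = (Δ) (p.f x)) ∧ ∀ x, dl D x = dr D x := by
  set p2 := p.tensor p with hp2
  obtain ⟨D0, hD0⟩ := p2.good.lift_lin U ((Δ).toLinearMap.comp p.f)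
  have hD0' : ∀ x, p2.f (D0 x) = (Δ) (p.f x) := hD0
  obtain ⟨D1, hD1⟩ := U.lift_hom s D0
    (by intro x y; rw [← p2.good.ker U, p2.mul, hD0', hD0', hD0', p.mul, map_mul])
    (by rw [← p2.good.ker U, hD0', p2.one, p.one, map_one])
  have hD1' : ∀ x, p2.f (D1 x) = (Δ) (p.f x) := fun x => by rw [(p2.good.ker U _ _).2 (hD1 x), hD0']
  obtain ⟨f, hf⟩ := U.limit' (fun n (f : A →ₗ[R] A ⊗[R] A) => ∃ D : A →ₐ[R] A ⊗[R] A, (∀ x, D x = f x) ∧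
      (∀ x, p2.f (D x) = (Δ) (p.f x)) ∧ ∀ x, Cg (ϖ ^ (n+1)) (dl D x) (dr D x)) D1.toLinearMap
    ⟨D1, fun x => rfl, hD1', fun x => by
      rw [zero_add, pow_one, ← (p.tensor p2).good.ker U, p.dl D1 (Δ) hD1', p.dr D1 (Δ) hD1', coassH]⟩
    (by
      rintro n f ⟨D, hDf, hD, hc⟩
      obtain ⟨D', h1, h2⟩ := coass_step U s p hl l1 D hD (pow_ne_zero _ U.ne) (dvd_pow_self _ (by omega)) hc
      refine ⟨D'.toLinearMap, ⟨D', fun x => rfl, fun x => ?_, by simpa only [pow_succ] using h2⟩, Cg.lin fun x => ?_⟩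
      · rw [← hD, p2.good.ker U]
        exact (h1 x).of_dvd (dvd_pow_self _ (by omega))
      · rw [← hDf]; exact h1 x)
  have hm : ∀ x y, f (x * y) = f x * f y := by
    intro x y
    refine U.sep _ _ fun n => ?_
    obtain ⟨g, ⟨D, hDg, -, -⟩, hg⟩ := hf n
    have h1 := ((hg.app x).mul (hg.app y)).symm
    rw [← hDg, ← hDg, ← map_mul, hDg] at h1
    exact ((hg.app (x * y)).trans h1).of_dvd (pow_dvd_pow _ (by omega))
  have ho : f 1 = 1 := by
    refine U.sep _ _ fun n => ?_
    obtain ⟨g, ⟨D, hDg, -, -⟩, hg⟩ := hf n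
    have h1 := hg.app 1
    rw [← hDg, map_one D] at h1
    exact h1.of_dvd (pow_dvd_pow _ (by omega))
  let D := AlgHom.ofLinearMap f ho hm
  refine ⟨D, fun x => ?_, fun x => ?_⟩
  · obtain ⟨g, ⟨D', hDg, h1, -⟩, hg⟩ := hf 0
    rw [← h1, p2.good.ker U, hDg]
    exact (hg.app x).of_dvd (dvd_pow_self _ (by omega))
  · refine U.sep _ _ fun n => ?_
    obtain ⟨g, ⟨D', hDg, -, h2⟩, hg⟩ := hf n
    have h3 : ∀ x, Cg (ϖ ^ (n+1)) (D x) (D' x) := fun x => by rw [hDg]; exact hg.app x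
    exact (((dl_cg D D' h3 x).trans (h2 x)).trans (dr_cg D D' h3 x).symm).of_dvd (pow_dvd_pow _ (by omega))

end CoLift
end HopfEven

open scoped TensorProduct
open WithConv Coalgebra

namespace HopfEven

section Counit
set_option linter.unusedSectionVars false
variable {R A : Type*} [CommRing R] [Ring A] [Algebra R A] 

/-- contract the first factor -/
noncomputable def k1 {M : Type*} [AddCommGroup M] [Module R M] (f : A →ₗ[R] R) : A ⊗[R] M →ₗ[R] M :=
  (TensorProduct.lid R M).toLinearMap ∘ₗ f.rTensor M
noncomputable def k2 {M : Type*} [AddCommGroup M] [Module R M] (f : A →ₗ[R] R) : M ⊗[R] A →ₗ[R] M :=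
  (TensorProduct.rid R M).toLinearMap ∘ₗ f.lTensor M
@[simp] lemma k1_tmul {M : Type*} [AddCommGroup M] [Module R M] (f : A →ₗ[R] R) (a : A) (m : M) : k1 f (a ⊗ₜ m) = f a • m := by
  simp [k1]
@[simp] lemma k2_tmul {M : Type*} [AddCommGroup M] [Module R M] (f : A →ₗ[R] R) (a : A) (m : M) : k2 f (m ⊗ₜ a) = f a • m := by
  simp [k2]

noncomputable def lf (D : A →ₐ[R] A ⊗[R] A) (f : A →ₗ[R] R) : A →ₗ[R] A := k1 f ∘ₗ D.toLinearMap
noncomputable def rf (D : A →ₐ[R] A ⊗[R] A) (f : A →ₗ[R] R) : A →ₗ[R] A := k2 f ∘ₗ D.toLinearMap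

variable {D : A →ₐ[R] A ⊗[R] A}

lemma lf_lf (hD : ∀ x, dl D x = dr D x) (f g : A →ₗ[R] R) (x : A) : lf D g (lf D f x) = lf D (g ∘ₗ lf D f) x := by
  let B : A ⊗[R] (A ⊗[R] A) →ₗ[R] A := k1 g ∘ₗ k1 f
  have e1 : ∀ t, lf D g (k1 f t) = B (c2 D t) := by
    intro t
    induction t with
    | zero => simp
    | add x y hx hy => simp only [map_add, hx, hy]
    | tmul a b => simp [B, lf]
  have e2 : ∀ t, k1 (g ∘ₗ lf D f) t = B (c1 D A t) := by
    intro t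
    induction t with
    | zero => simp
    | add x y hx hy => simp only [map_add, hx, hy]
    | tmul a b =>
      rw [c1_tmul, k1_tmul, LinearMap.comp_apply, lf, LinearMap.comp_apply, AlgHom.toLinearMap_apply]
      generalize D a = s
      induction s with
      | zero => simp
      | add x y hx hy => simp only [map_add, hx, hy, TensorProduct.add_tmul, add_smul]
      | tmul c d => simp [B, mul_smul]
  have h := congrArg B (hD x)
  rw [dl, dr, AlgHom.comp_apply, AlgHom.comp_apply, ← e1, ← e2] at h
  exact h.symm

lemma rf_rf (hD : ∀ x, dl D x = dr D x) (f g : A →ₗ[R] R) (x : A) : rf D f (rf D g x) = rf D (f ∘ₗ rf D g) x := by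
  let B : A ⊗[R] (A ⊗[R] A) →ₗ[R] A := k2 f ∘ₗ (k2 g).lTensor A
  have e1 : ∀ t, k2 (f ∘ₗ rf D g) t = B (c2 D t) := by
    intro t
    induction t with
    | zero => simp
    | add x y hx hy => simp only [map_add, hx, hy]
    | tmul a b => simp [B, rf]
  have e2 : ∀ t, rf D f (k2 g t) = B (c1 D A t) := by
    intro t
    induction t with
    | zero => simp
    | add x y hx hy => simp only [map_add, hx, hy]
    | tmul a b =>
      rw [c1_tmul, k2_tmul, map_smul, rf, LinearMap.comp_apply, AlgHom.toLinearMap_apply]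
      generalize D a = s
      induction s with
      | zero => simp
      | add x y hx hy => simp only [map_add, hx, hy, TensorProduct.add_tmul, smul_add]
      | tmul c d => simp [B, mul_smul]
  have h := congrArg B (hD x)
  rw [dl, dr, AlgHom.comp_apply, AlgHom.comp_apply, ← e1, ← e2] at h
  exact h

lemma lf_rf (f g : A →ₗ[R] R) (x : A) : g (lf D f x) = f (rf D g x) := by
  simp only [lf, rf, LinearMap.comp_apply]
  generalize D.toLinearMap x = t
  induction t with
  | zero => simp
  | add x y hx hy => simp only [map_add, hx, hy]
  | tmul a b => simp [mul_comm]

variable {K : Type*} [IsDomain R] [Field K] {κ : R →+* K} {ϖ : R} [Module.Free R A] [Module.Finite R A]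
variable {H : Type*} [Ring H] [HopfAlgebra K H]

lemma red_k1 (p : Red κ A H) {B F : Type*} [Ring B] [Algebra R B] [Ring F] [Algebra K F] (r : Red κ B F) (f : A →ₗ[R] R) (f' : H →ₗ[K] K) (h : ∀ x, κ (f x) = f' (p.f x))
    (t : A ⊗[R] B) : r.f (k1 f t) = lam1 f' ((p.tensor r).f t) := by
  induction t with
  | zero => simp
  | add x y hx hy => simp only [map_add, hx, hy]
  | tmul a b => simp [Red.tensor_tmul, h, LinearMap.map_smulₛₗ]

lemma red_k2 (p : Red κ A H) {B F : Type*} [Ring B] [Algebra R B] [Ring F] [Algebra K F] (r : Red κ B F) (f : A →ₗ[R] R) (f' : H →ₗ[K] K) (h : ∀ x, κ (f x) = f' (p.f x))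
    (t : B ⊗[R] A) : r.f (k2 f t) = lam2 f' ((r.tensor p).f t) := by
  induction t with
  | zero => simp
  | add x y hx hy => simp only [map_add, hx, hy]
  | tmul a b => simp [Red.tensor_tmul, h, LinearMap.map_smulₛₗ]

/-- lift a functional -/
lemma lift_fun (U : Unif κ ϖ) (p : Red κ A H) (f' : H →ₗ[K] K) : ∃ f : A →ₗ[R] R, ∀ x, κ (f x) = f' (p.f x) := by
  have hg : Good κ (κ.toSemilinearMap) := ⟨1, Module.Basis.singleton (Fin 1) R, Module.Basis.singleton (Fin 1) K, by simp⟩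
  exact hg.lift_lin U (f'.comp p.f)

lemma exists_counit (U : Unif κ ϖ) (p : Red κ A H) (hDH : ∀ x, (p.tensor p).f (D x) = comul (R := K) (p.f x))
    (hD : ∀ x, dl D x = dr D x) :
    ∃ e : A →ₗ[R] R, (∀ x, κ (e x) = counit (R := K) (p.f x)) ∧ (∀ x, lf D e x = x) ∧ (∀ x, rf D e x = x) := by
  obtain ⟨E0, hE0⟩ := lift_fun U p (counit (R := K) (A := H))
  have hl : ∀ x, p.f (lf D E0 x) = p.f x := by
    intro x
    have := red_k1 p p E0 counit hE0 (D x)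
    rw [hDH] at this
    refine this.trans ?_
    have h2 := Coalgebra.rTensor_counit_comul (R := K) (p.f x)
    simp [lam1, h2]
  have hr : ∀ x, p.f (rf D E0 x) = p.f x := by
    intro x
    have := red_k2 p p E0 counit hE0 (D x)
    rw [hDH] at this
    refine this.trans ?_
    have h2 := Coalgebra.lTensor_counit_comul (R := K) (p.f x)
    simp [lam2, h2]
  have bl := U.bij (lf D E0) (fun x => (p.good.ker U _ _).1 (hl x))
  have br := U.bij (rf D E0) (fun x => (p.good.ker U _ _).1 (hr x))
  let Tl := LinearEquiv.ofBijective _ bl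
  let Tr := LinearEquiv.ofBijective _ br
  let e : A →ₗ[R] R := E0 ∘ₗ Tl.symm.toLinearMap
  let e' : A →ₗ[R] R := E0 ∘ₗ Tr.symm.toLinearMap
  have he : e ∘ₗ lf D E0 = E0 := by
    ext x; change E0 (Tl.symm (Tl x)) = E0 x; simp
  have he' : e' ∘ₗ rf D E0 = E0 := by
    ext x; change E0 (Tr.symm (Tr x)) = E0 x; simp
  have h1 : ∀ x, lf D e x = x := by
    intro x
    obtain ⟨y, rfl⟩ := bl.2 x
    rw [lf_lf hD, he]
  have h2 : ∀ x, rf D e' x = x := by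
    intro x
    obtain ⟨y, rfl⟩ := br.2 x
    rw [rf_rf hD, he']
  have h3 : e = e' := by
    ext x
    have := lf_rf (D := D) e e' x
    rw [h1, h2] at this
    exact this.symm
  refine ⟨e, fun x => ?_, h1, h3 ▸ h2⟩
  obtain ⟨y, rfl⟩ := bl.2 x
  rw [hl, ← hE0, show e (lf D E0 y) = E0 y from congrArg (fun f => f y) he]

lemma exists_counit_hom (U : Unif κ ϖ) (p : Red κ A H) (hDH : ∀ x, (p.tensor p).f (D x) = comul (R := K) (p.f x))
    (hD : ∀ x, dl D x = dr D x) :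
    ∃ e : A →ₐ[R] R, (∀ x, κ (e x) = counit (R := K) (p.f x)) ∧ (∀ x, lf D e.toLinearMap x = x) ∧ (∀ x, rf D e.toLinearMap x = x) := by
  obtain ⟨e, he, hl, hr⟩ := exists_counit U p hDH hD
  have h1 : e 1 = 1 := by
    have h := congrArg e (hl 1)
    have h2 : κ (e 1) = 1 := by rw [he, p.one]; simp
    simp only [lf, LinearMap.comp_apply, AlgHom.toLinearMap_apply, map_one, Algebra.TensorProduct.one_def, k1_tmul, map_smul,
      smul_eq_mul] at h
    refine mul_left_cancel₀ (a := e 1) (fun h0 => ?_) (by rw [h, mul_one])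
    rw [h0] at h2; simp at h2
  let w : A ⊗[R] A →ₗ[R] R := e ∘ₗ LinearMap.mul' R A
  let ee : A ⊗[R] A →ₗ[R] R := e ∘ₗ k1 e
  let Q : (A ⊗[R] A) ⊗[R] (A ⊗[R] A) →ₗ[R] A ⊗[R] A := k1 w ∘ₗ (TensorProduct.tensorTensorTensorComm R A A A A).toLinearMap
  have q1 : ∀ s t : A ⊗[R] A, Q (s ⊗ₜ t) = Q (s ⊗ₜ t) := fun _ _ => rfl
  have q2 : ∀ s t : A ⊗[R] A, w (Q (s ⊗ₜ t)) = ee (s * t) := by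
    intro s t
    induction s with
    | zero => simp
    | add x y hx hy => simp only [map_add, hx, hy, TensorProduct.add_tmul, add_mul]
    | tmul a b =>
      induction t with
      | zero => simp
      | add x y hx hy => simp only [map_add, hx, hy, TensorProduct.tmul_add, mul_add]
      | tmul c d => simp [Q, w, ee]
  have q3 : ∀ s t : A ⊗[R] A, ee (Q (s ⊗ₜ t)) = e (k2 e s * k2 e t) := by
    intro s t
    induction s with
    | zero => simp
    | add x y hx hy => simp only [map_add, hx, hy, TensorProduct.add_tmul, add_mul]
    | tmul a b =>
      induction t with
      | zero => simp
      | add x y hx hy => simp only [map_add, hx, hy, TensorProduct.tmul_add, mul_add]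
      | tmul c d => simp [Q, w, ee]; ring
  have q4 : ∀ s t : A ⊗[R] A, (p.tensor p).f (Q (s ⊗ₜ t)) = p.f (k1 e s) ⊗ₜ p.f (k1 e t) := by
    intro s t
    induction s with
    | zero => simp
    | add x y hx hy => simp only [map_add, hx, hy, TensorProduct.add_tmul, add_mul]
    | tmul a b =>
      induction t with
      | zero => simp
      | add x y hx hy => simp only [map_add, hx, hy, TensorProduct.tmul_add, mul_add]
      | tmul c d =>
        simp [Q, w, he, LinearMap.map_smulₛₗ, p.mul, Red.tensor_tmul, mul_smul, TensorProduct.smul_tmul']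
        rw [smul_comm]
  let Om : A ⊗[R] A →ₗ[R] A ⊗[R] A := Q ∘ₗ TensorProduct.map D.toLinearMap D.toLinearMap
  have om : ∀ x y, Om (x ⊗ₜ y) = Q (D x ⊗ₜ D y) := fun x y => rfl
  have omb : Function.Bijective Om := by
    refine U.bij Om fun t => ((p.tensor p).good.ker U _ _).1 ?_
    induction t with
    | zero => simp
    | add x y hx hy => simp only [map_add, hx, hy]
    | tmul a b =>
      rw [om, q4, Red.tensor_tmul]
      congr 1
      · exact congrArg p.f (hl a)
      · exact congrArg p.f (hl b)
  have hw : w ∘ₗ Om = ee ∘ₗ Om := by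
    ext x y
    simp only [TensorProduct.AlgebraTensorModule.curry_apply, TensorProduct.curry_apply, LinearMap.restrictScalars_apply, LinearMap.comp_apply, LinearMap.restrictScalars_self]
    rw [om, q2, q3, ← map_mul]
    have a1 : ee (D (x * y)) = e (x * y) := congrArg e (hl (x * y))
    have a2 : k2 e (D x) = x := hr x
    have a3 : k2 e (D y) = y := hr y
    rw [a1, a2, a3]
  have hw' : w = ee := by
    ext1; ext x y
    obtain ⟨t, ht⟩ := omb.2 (x ⊗ₜ y)
    have := congrArg (fun f => f t) hw
    simp only [LinearMap.comp_apply, ht] at this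
    exact this
  refine ⟨AlgHom.ofLinearMap e h1 (fun x y => ?_), he, hl, hr⟩
  have := congrArg (fun f => f (x ⊗ₜ y)) hw'
  simpa [w, ee] using this

lemma exists_lam (U : Unif κ ϖ) (p : Red κ A H) (hDH : ∀ x, (p.tensor p).f (D x) = comul (R := K) (p.f x))
    (hD : ∀ x, dl D x = dr D x)
    {l : H →ₗ[K] K} (hl : ∀ x, lam1 l (comul (R := K) x) = l x • (1 : H)) (l1 : l 1 = 1) :
    ∃ m : A →ₗ[R] R, (∀ x, lf D m x = m x • 1) ∧ m 1 = 1 := by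
  obtain ⟨m0, hm0⟩ := lift_fun U p l
  have hu : Cg ϖ (m0 1) 1 := by
    obtain ⟨c, hc⟩ := (U.ker (m0 1 - 1)).1 (by rw [map_sub, hm0, p.one, l1, map_one, sub_self])
    exact ⟨c, hc⟩
  obtain ⟨u, hu'⟩ := U.isUnit (m0 1) hu
  have hm0' : ∀ x, Cg ϖ (lf D m0 x) (m0 x • 1) := by
    intro x
    have := red_k1 p p m0 l hm0 (D x)
    rw [hDH, hl, ← hm0, ← p.one, ← LinearMap.map_smulₛₗ] at this
    exact (p.good.ker U _ _).1 this
  have lf_smul : ∀ (c : R) (f : A →ₗ[R] R) (x : A), lf D (c • f) x = c • lf D f x := by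
    intro c f x
    simp [lf, k1, LinearMap.rTensor_smul]
  have lf1 : ∀ f : A →ₗ[R] R, lf D f 1 = f 1 • 1 := by
    intro f
    simp [lf, Algebra.TensorProduct.one_def]
  obtain ⟨m, hm⟩ := U.limit' (fun n (m : A →ₗ[R] R) => m 1 = 1 ∧ ∀ x, Cg (ϖ ^ (n+1)) (lf D m x) (m x • 1)) ((↑u⁻¹ : R) • m0)
    ⟨by simp [← hu'], fun x => by
      rw [zero_add, pow_one, lf_smul, LinearMap.smul_apply, smul_assoc]
      exact (hm0' x).smul _⟩ (by
    rintro n m ⟨h1, h2⟩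
    have h3 : Cg (ϖ ^ (n+1)) (lf D m) (m.smulRight 1) := Cg.lin h2
    obtain ⟨e, he⟩ := h3
    have he' : ∀ x, lf D m x = m x • 1 + ϖ ^ (n+1) • e x := by
      intro x
      have := congrArg (fun f => f x) he
      simp only [LinearMap.sub_apply, LinearMap.smulRight_apply, LinearMap.smul_apply] at this
      rw [← this, add_sub_cancel]
    refine ⟨m ∘ₗ lf D m, ⟨?_, fun x => ?_⟩, Cg.lin fun x => ?_⟩
    · simp [lf1, h1]
    · rw [← lf_lf hD]
      refine ⟨ϖ ^ n • e (e x), ?_⟩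
      have a1 : lf D m (lf D m x) = (m x + ϖ ^ (n+1) * m (e x)) • 1 + ϖ ^ (n+1) • ϖ ^ (n+1) • e (e x) := by
        rw [he' x, map_add, map_smul, map_smul, he' (e x), lf1, h1]
        module
      have a2 : (m ∘ₗ lf D m) x = m x + ϖ ^ (n+1) * m (e x) := by
        rw [LinearMap.comp_apply, he' x]; simp [h1]
      rw [a1, a2, add_sub_cancel_left, smul_smul, smul_smul]
      congr 1; ring
    · exact ⟨m (e x), by rw [LinearMap.comp_apply, he' x]; simp [h1]⟩)
  refine ⟨m, fun x => ?_, ?_⟩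
  · refine U.sep _ _ fun n => ?_
    obtain ⟨g, ⟨-, h2⟩, hg⟩ := hm n
    have lfg : Cg (ϖ ^ (n+1)) (lf D m x) (lf D g x) := by
      obtain ⟨z, hz⟩ := hg
      refine ⟨lf D z x, ?_⟩
      rw [← lf_smul, ← hz]
      simp [lf, k1, LinearMap.rTensor_sub]
    have mg : Cg (ϖ ^ (n+1)) (m x • (1:A)) (g x • 1) := (hg.app x).map (LinearMap.toSpanSingleton R A 1)
    exact ((lfg.trans (h2 x)).trans mg.symm).of_dvd (pow_dvd_pow _ (by omega))
  · refine U.sep _ _ fun n => ?_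
    obtain ⟨g, ⟨h1, -⟩, hg⟩ := hm n
    have := hg.app 1
    rw [h1] at this
    exact this.of_dvd (pow_dvd_pow _ (by omega))

end Counit
end HopfEven

open scoped TensorProduct
open WithConv Coalgebra

namespace HopfEven

section Antipode
set_option linter.unusedSectionVars false
variable {R A K H : Type*} [CommRing R] [IsDomain R] [Ring A] [Bialgebra R A] [Module.Free R A] [Module.Finite R A]
  [Field K] [Ring H] [HopfAlgebra K H]
variable {κ : R →+* K} {ϖ : R}

lemma exists_antipode (U : Unif κ ϖ) (p : Red κ A H)
    (hc : ∀ x, (p.tensor p).f (comul (R := R) x) = comul (R := K) (p.f x))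
    (he : ∀ x, κ (counit (R := R) x) = counit (R := K) (p.f x)) :
    ∃ s : A →ₗ[R] A, toConv s * toConv LinearMap.id = 1 ∧ toConv LinearMap.id * toConv s = 1 := by
  obtain ⟨s, hs⟩ := Good.lift_lin U p.good ((HopfAlgebra.antipode K (A := H)).comp p.f)
  have key : ∀ (f g : A →ₗ[R] A) (f' g' : H →ₗ[K] H), (∀ x, p.f (f x) = f' (p.f x)) → (∀ x, p.f (g x) = g' (p.f x)) → 
      (toConv f' * toConv g' = 1) → ∀ x, Cg ϖ ((toConv f * toConv g : WithConv (A →ₗ[R] A)).ofConv x) (algebraMap R A (counit x)) := by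
    intro f g f' g' hf hg h x
    refine (p.good.ker U _ _).1 ?_
    have h1 : ∀ t : A ⊗[R] A, p.f (LinearMap.mul' R A (TensorProduct.map f g t)) = LinearMap.mul' K H (TensorProduct.map f' g' ((p.tensor p).f t)) := by
      intro t
      induction t with
      | zero => simp
      | add x y hx hy => simp only [map_add, hx, hy]
      | tmul a b => simp [Red.tensor_tmul, p.mul, hf, hg]
    have h2 := h1 (comul x)
    rw [hc] at h2
    have h3 := congrArg (fun F => F.ofConv (p.f x)) h
    have h4 : (toConv f' * toConv g' : WithConv (H →ₗ[K] H)).ofConv (p.f x) = LinearMap.mul' K H (TensorProduct.map f' g' (comul (p.f x))) := rfl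
    have h5 : (1 : WithConv (H →ₗ[K] H)).ofConv (p.f x) = algebraMap K H (counit (p.f x)) := rfl
    simp only [h4, h5] at h3
    rw [h3] at h2
    rw [Algebra.algebraMap_eq_smul_one, LinearMap.map_smulₛₗ, p.one, he, ← Algebra.algebraMap_eq_smul_one]
    exact h2
  have hfree : Module.Free R (WithConv (A →ₗ[R] A)) := Module.Free.of_equiv (WithConv.linearEquiv R (A →ₗ[R] A)).symm
  have hfin : Module.Finite R (WithConv (A →ₗ[R] A)) := Module.Finite.equiv (WithConv.linearEquiv R (A →ₗ[R] A)).symm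
  have unit_of : ∀ c : WithConv (A →ₗ[R] A), (∀ x, Cg ϖ (c.ofConv x) (algebraMap R A (counit x))) → IsUnit c := by
    intro c h
    refine U.isUnit c ?_
    have : Cg ϖ c.ofConv (1 : WithConv (A →ₗ[R] A)).ofConv := Cg.lin h
    exact this.map (WithConv.linearEquiv R (A →ₗ[R] A)).symm.toLinearMap
  have u1 := unit_of _ (key s LinearMap.id _ LinearMap.id hs (fun _ => rfl) (by ext x; simp))
  have u2 := unit_of _ (key LinearMap.id s LinearMap.id _ (fun _ => rfl) hs (by ext x; simp))
  have u : IsUnit (toConv LinearMap.id : WithConv (A →ₗ[R] A)) := by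
    obtain ⟨⟨a, a', ha, ha'⟩, rfl : a = _⟩ := u1
    obtain ⟨⟨b, b', hb, hb'⟩, rfl : b = _⟩ := u2
    rw [isUnit_iff_exists_and_exists]
    exact ⟨⟨_, by rw [← mul_assoc]; exact hb⟩, ⟨_, by rw [mul_assoc]; exact ha'⟩⟩
  obtain ⟨u, hu⟩ := u
  refine ⟨(↑u⁻¹ : WithConv (A →ₗ[R] A)).ofConv, ?_, ?_⟩
  · rw [← hu]; exact u.inv_mul
  · rw [← hu]; exact u.mul_inv
end Antipode

section Hopf
set_option linter.unusedSectionVars false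
variable {R A : Type*} [CommRing R] [Ring A] [Algebra R A] {D : A →ₐ[R] A ⊗[R] A}

noncomputable abbrev mkBialg (D : A →ₐ[R] A ⊗[R] A) (e : A →ₐ[R] R) (hD : ∀ x, dl D x = dr D x)
    (hl : ∀ x, lf D e.toLinearMap x = x) (hr : ∀ x, rf D e.toLinearMap x = x) : Bialgebra R A :=
  Bialgebra.ofAlgHom D e
    (by
      ext x
      have h1 : ∀ t, (Algebra.TensorProduct.assoc R R R A A A) (Algebra.TensorProduct.map D (.id R A) t) = c1 D A t := by
        intro t
        induction t with
        | zero => simp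
        | add x y hx hy => simp only [map_add, hx, hy]
        | tmul a b =>
          rw [c1_tmul, Algebra.TensorProduct.map_tmul]
          generalize D a = s
          induction s with
          | zero => simp
          | add x y hx hy => simp only [map_add, TensorProduct.add_tmul, hx, hy]
          | tmul c d => simp
      have h2 : ∀ t, (Algebra.TensorProduct.map (.id R A) D t) = c2 D t := by
        intro t
        induction t with
        | zero => simp
        | add x y hx hy => simp only [map_add, hx, hy]
        | tmul a b => simp
      have := hD x
      rw [dl, dr, AlgHom.comp_apply, AlgHom.comp_apply, ← h1, ← h2] at this
      exact this)
    (by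
      ext x
      have h1 : ∀ t, (Algebra.TensorProduct.map e (.id R A) t) = 1 ⊗ₜ k1 e.toLinearMap t := by
        intro t
        induction t with
        | zero => simp
        | add x y hx hy => simp only [map_add, TensorProduct.tmul_add, hx, hy]
        | tmul a b => simp [TensorProduct.smul_tmul']
      exact (h1 _).trans (congrArg (fun y => (1:R) ⊗ₜ[R] y) (hl x)))
    (by
      ext x
      have h1 : ∀ t, (Algebra.TensorProduct.map (.id R A) e t) = k2 e.toLinearMap t ⊗ₜ 1 := by
        intro t
        induction t with
        | zero => simp
        | add x y hx hy => simp only [map_add, TensorProduct.add_tmul, hx, hy]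
        | tmul a b => simp [TensorProduct.smul_tmul]
      exact (h1 _).trans (congrArg (fun y => y ⊗ₜ[R] (1:R)) (hr x)))
end Hopf
end HopfEven

open scoped TensorProduct
open WithConv Coalgebra

namespace HopfEven

section Descent
set_option linter.unusedSectionVars false
variable (R L : Type*) [CommRing R] [Field L] [Algebra R L]

noncomputable def matBC (n : ℕ) : L ⊗[R] Matrix (Fin n) (Fin n) R ≃ₐ[L] Matrix (Fin n) (Fin n) L :=
  AlgEquiv.ofRingEquiv (f := (matrixEquivTensor (Fin n) R L).symm.toRingEquiv) (by
    intro c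
    change (matrixEquivTensor (Fin n) R L).symm (c ⊗ₜ 1) = _
    rw [matrixEquivTensor_apply_symm, Matrix.map_one _ (map_zero _) (map_one _), Algebra.algebraMap_eq_smul_one])

variable {R} {A : Type*} [Ring A] 

noncomputable def piBC [Algebra R A] {ι : Type*} [Fintype ι] [DecidableEq ι] {d : ι → ℕ} (φ : A ≃ₐ[R] Π i, Matrix (Fin (d i)) (Fin (d i)) R) :
    L ⊗[R] A ≃ₐ[L] Π i, Matrix (Fin (d i)) (Fin (d i)) L :=
  (Algebra.TensorProduct.congr (AlgEquiv.refl (R := L) (A₁ := L)) φ).trans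
    ((Algebra.TensorProduct.piRight R L L _).trans (AlgEquiv.piCongrRight fun i => matBC R L (d i)))

noncomputable def lBC [Algebra R A] (l : A →ₗ[R] R) : L ⊗[R] A →ₗ[L] L :=
  (TensorProduct.AlgebraTensorModule.rid R L L).toLinearMap ∘ₗ l.baseChange L

lemma lBC_tmul [Algebra R A] (l : A →ₗ[R] R) (c : L) (x : A) : lBC L l (c ⊗ₜ x) = l x • c := by
  simp [lBC]

variable [HopfAlgebra R A]

lemma lBC_inv (l : A →ₗ[R] R) (hl : ∀ x, k1 l (comul (R := R) x) = l x • (1 : A)) (x : L ⊗[R] A) :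
    lam1 (lBC L l) (comul (R := L) x) = lBC L l x • (1 : L ⊗[R] A) := by
  induction x with
  | zero => simp
  | add x y hx hy => simp only [map_add, hx, hy, add_smul]
  | tmul c x =>
    have h : ∀ t : A ⊗[R] A, lam1 (lBC L l) (TensorProduct.AlgebraTensorModule.tensorTensorTensorComm R L R L L L A A ((comul (R := L) c) ⊗ₜ t)) = c ⊗ₜ[R] k1 l t := by
      intro t
      induction t with
      | zero => simp
      | add x y hx hy => simp only [map_add, TensorProduct.tmul_add, hx, hy]
      | tmul a b =>
        rw [CommSemiring.comul_apply]
        simp only [TensorProduct.AlgebraTensorModule.tensorTensorTensorComm_tmul, lam1_tmul, k1_tmul, lBC_tmul]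
        rw [TensorProduct.tmul_smul, TensorProduct.smul_tmul', smul_assoc, TensorProduct.smul_tmul']
        simp
    rw [TensorProduct.comul_tmul, h, hl, lBC_tmul, TensorProduct.tmul_smul, smul_assoc, Algebra.TensorProduct.one_def,
      TensorProduct.smul_tmul', TensorProduct.smul_tmul' c (1:L), TensorProduct.smul_tmul', smul_eq_mul, mul_one]

theorem descent [IsDomain R] [CharZero R] [Module.Free R A] [Module.Finite R A] {ι : Type*} [Fintype ι] {d : ι → ℕ} (hd : ∀ i, d i ≠ 0)
    (φ : A ≃ₐ[R] Π i, Matrix (Fin (d i)) (Fin (d i)) R) (l : A →ₗ[R] R) (hl : ∀ x, k1 l (comul (R := R) x) = l x • (1 : A))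
    (l1 : l 1 = 1) (hodd : ¬ Even (Module.finrank R A)) (i : ι) : Odd (d i) := by
  classical
  let L := AlgebraicClosure (FractionRing R)
  have hinj : Function.Injective (algebraMap R L) := by
    rw [IsScalarTower.algebraMap_eq R (FractionRing R) L]
    exact (algebraMap (FractionRing R) L).injective.comp (IsFractionRing.injective R _)
  have : CharZero L := charZero_of_injective_algebraMap hinj
  refine thm0 (K := L) hd (piBC L φ) (lBC L l) (lBC_inv L l hl) ?_ ?_ i
  · rw [Algebra.TensorProduct.one_def, lBC_tmul, l1, one_smul]
  · rwa [Module.finrank_baseChange]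
end Descent
end HopfEven

open scoped TensorProduct
open WithConv Coalgebra

namespace HopfEven

section Concrete
set_option linter.unusedSectionVars false

noncomputable def SepElt.ofFintype {R A J : Type*} [CommRing R] [Ring A] [Algebra R A] [Fintype J] (a b : J → A)
    (hs : ∑ i, a i * b i = 1)  (hc : ∀ x, ∑ i, (x * a i) ⊗ₜ[R] b i = ∑ i, a i ⊗ₜ[R] (b i * x)) : SepElt R A where
  n := Fintype.card J
  a i := a ((Fintype.equivFin J).symm i)
  b i := b ((Fintype.equivFin J).symm i)
  sum := by rw [← hs]; exact Equiv.sum_comp (Fintype.equivFin J).symm (fun i => a i * b i)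
  comm x := by
    have h1 := Equiv.sum_comp (Fintype.equivFin J).symm (fun i => (x * a i) ⊗ₜ[R] b i)
    have h2 := Equiv.sum_comp (Fintype.equivFin J).symm (fun i => a i ⊗ₜ[R] (b i * x))
    exact (h1.trans (hc x)).trans h2.symm

variable {R : Type*} [CommRing R] {ι : Type*} [Fintype ι] [DecidableEq ι] {d : ι → ℕ}

lemma mul_single_k (d : ℕ) (z : Fin d) (M : Matrix (Fin d) (Fin d) R) (k : Fin d) :
    M * Matrix.single k z 1 = ∑ m, M m k • Matrix.single m z (1:R) := by
  ext a b
  simp [Matrix.sum_apply, Matrix.mul_apply, Matrix.single_apply, Finset.sum_ite_eq, ite_and]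

lemma single_mul_k (d : ℕ) (z : Fin d) (M : Matrix (Fin d) (Fin d) R) (k : Fin d) :
    Matrix.single z k 1 * M = ∑ m, M k m • Matrix.single z m (1:R) := by
  ext a b
  simp [Matrix.sum_apply, Matrix.mul_apply, Matrix.single_apply, ite_and]

noncomputable def sepPi (hd : ∀ i, d i ≠ 0) : SepElt R (Π i, Matrix (Fin (d i)) (Fin (d i)) R) :=
  SepElt.ofFintype (J := Σ i, Fin (d i))
    (fun j => Pi.single j.1 (Matrix.single j.2 (⟨0, Nat.pos_of_ne_zero (hd j.1)⟩) 1))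
    (fun j => Pi.single j.1 (Matrix.single (⟨0, Nat.pos_of_ne_zero (hd j.1)⟩) j.2 1))
    (by
      rw [Fintype.sum_sigma]
      have : ∀ i, ∑ k : Fin (d i), Pi.single (M := fun i => Matrix (Fin (d i)) (Fin (d i)) R) i (Matrix.single k (⟨0, Nat.pos_of_ne_zero (hd i)⟩) 1) * 
          Pi.single i (Matrix.single (⟨0, Nat.pos_of_ne_zero (hd i)⟩) k 1) = Pi.single i 1 := by
        intro i
        simp only [← Pi.single_mul, Matrix.single_mul_single_same, mul_one]
        rw [← Matrix.sum_single_one]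
        exact (map_sum (AddMonoidHom.single (fun i => Matrix (Fin (d i)) (Fin (d i)) R) i) _ _).symm
      simp only [this]
      exact Finset.univ_sum_single (1 : Π i, Matrix (Fin (d i)) (Fin (d i)) R))
    (by
      intro x
      rw [Fintype.sum_sigma, Fintype.sum_sigma]
      refine Finset.sum_congr rfl fun i _ => ?_
      let s := LinearMap.single R (fun i => Matrix (Fin (d i)) (Fin (d i)) R) i
      have hs : ∀ M, Pi.single (M := fun i => Matrix (Fin (d i)) (Fin (d i)) R) i M = s M := fun _ => rfl
      have e1 : ∀ M, x * s M = s (x i * M) := fun M => by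
        rw [← hs, ← hs]; ext j : 1
        rcases eq_or_ne j i with rfl | h
        · simp
        · simp [h]
      have e2 : ∀ M, s M * x = s (M * x i) := fun M => by
        rw [← hs, ← hs]; ext j : 1
        rcases eq_or_ne j i with rfl | h
        · simp
        · simp [h]
      simp only [hs, e1, e2, mul_single_k, single_mul_k, map_sum, map_smul, TensorProduct.sum_tmul, TensorProduct.tmul_sum,
        TensorProduct.tmul_smul, ← TensorProduct.smul_tmul']
      rw [Finset.sum_comm])

variable {K H : Type*} [Field K] [Ring H] [Algebra K H] [IsDomain R]

noncomputable def redPi (κ : R →+* K) (φ : H ≃ₐ[K] Π i, Matrix (Fin (d i)) (Fin (d i)) K) :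
    Red κ (Π i, Matrix (Fin (d i)) (Fin (d i)) R) H where
  f := { toFun := fun x => φ.symm (fun i => (x i).map κ)
         map_add' := fun x y => by
          rw [← map_add]; congr 1; ext i a b; simp
         map_smul' := fun c x => by
          rw [← map_smul]; congr 1; ext i a b; simp }
  mul x y := by
    change φ.symm _ = φ.symm _ * φ.symm _
    rw [← map_mul]; congr 1; ext i : 1; simp [Matrix.map_mul]
  one := by
    change φ.symm _ = 1
    rw [← map_one φ.symm]; congr 1; ext i : 1; simp [Matrix.map_one]
  good := by
    let J := Σ i, Fin (d i) × Fin (d i)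
    refine ⟨Fintype.card J, (Pi.basis fun i => Matrix.stdBasis R _ _).reindex (Fintype.equivFin J),
      ((Pi.basis fun i => Matrix.stdBasis K _ _).reindex (Fintype.equivFin J)).map φ.symm.toLinearEquiv, fun j => ?_⟩
    obtain ⟨⟨i, a, b⟩, rfl⟩ := (Fintype.equivFin J).surjective j
    simp only [Module.Basis.reindex_apply, Equiv.symm_apply_apply, Module.Basis.map_apply, Pi.basis_apply, Matrix.stdBasis_eq_single]
    change φ.symm _ = φ.symm _
    congr 1
    ext j : 1
    rcases eq_or_ne j i with rfl | h
    · ext; simp [Matrix.single_apply, apply_ite κ]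
    · ext; simp [h]
end Concrete

section Lift
set_option linter.unusedSectionVars false
variable {R K H : Type*} [CommRing R] [IsDomain R] [CharZero R] [Field K] [Ring H] [HopfAlgebra K H] [FiniteDimensional K H]
  [IsSemisimpleRing H]

theorem lift_thm {κ : R →+* K} {ϖ : R} (U : Unif κ ϖ) {ι : Type*} [Fintype ι] {d : ι → ℕ} (hd : ∀ i, d i ≠ 0)
    (φ : H ≃ₐ[K] Π i, Matrix (Fin (d i)) (Fin (d i)) K)
    {l : H →ₗ[K] K} (hl : ∀ x, lam1 l (comul (R := K) x) = l x • (1 : H)) (l1 : l 1 = 1) 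
    (hodd : ¬ Even (Module.finrank K H)) (i : ι) : Odd (d i) := by
  classical
  let A := Π i, Matrix (Fin (d i)) (Fin (d i)) R
  let p : Red κ A H := redPi κ φ
  obtain ⟨D, hDH, hD⟩ := exists_coass_lift U (sepPi hd) p hl l1
  obtain ⟨e, he, hel, her⟩ := exists_counit_hom U p hDH hD
  obtain ⟨m, hm, m1⟩ := exists_lam U p hDH hD hl l1
  letI B : Bialgebra R A := mkBialg D e hD hel her
  obtain ⟨s, hs, hs'⟩ := exists_antipode U p hDH he
  letI Ho : HopfAlgebra R A := HopfAlgebra.ofConvInverse s hs hs'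
  refine descent (A := A) hd AlgEquiv.refl m hm m1 ?_ i
  have : Module.finrank R A = Module.finrank K H := by
    rw [φ.toLinearEquiv.finrank_eq, Module.finrank_pi_fintype, Module.finrank_pi_fintype]
    simp [Module.finrank_matrix]
  rwa [this]

open WittVector in
theorem odd_charp (q : ℕ) [Fact q.Prime] [CharP K q] [IsAlgClosed K] {ι : Type*} [Fintype ι] {d : ι → ℕ} (hd : ∀ i, d i ≠ 0)
    (φ : H ≃ₐ[K] Π i, Matrix (Fin (d i)) (Fin (d i)) K)
    {l : H →ₗ[K] K} (hl : ∀ x, lam1 l (comul (R := K) x) = l x • (1 : H)) (l1 : l 1 = 1) 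
    (hodd : ¬ Even (Module.finrank K H)) (i : ι) : Odd (d i) := by
  have hq0 : (q : WittVector q K) ≠ 0 := WittVector.p_nonzero q K
  have U : Unif (WittVector.constantCoeff : WittVector q K →+* K) (q : WittVector q K) :=
    { surj := WittVector.constantCoeff_surjective q
      ker := fun r => by
        rw [← Ideal.mem_span_singleton, WittVector.mem_span_p_iff_coeff_zero_eq_zero]; rfl
      ne := hq0
      complete := WittVector.isAdicCompleteIdealSpanP }
  have : CharZero (WittVector q K) := by
    obtain ⟨r, hr⟩ := CharP.exists (WittVector q K)
    rcases CharP.char_is_prime_or_zero (WittVector q K) r with h | h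
    · exfalso
      have h0 : ((r : ℕ) : WittVector q K) = 0 := CharP.cast_eq_zero _ r
      have h1 : ((r : ℕ) : K) = 0 := by
        rw [← map_natCast (WittVector.constantCoeff : WittVector q K →+* K), h0, map_zero]
      rw [CharP.cast_eq_zero_iff K q, Nat.prime_dvd_prime_iff_eq Fact.out h] at h1
      subst h1
      exact hq0 h0
    · subst h
      exact CharP.charP_to_charZero _
  exact lift_thm U hd φ hl l1 hodd i
end Lift
end HopfEven

open scoped TensorProduct
open WithConv Coalgebra

namespace HopfEven

section Final
set_option linter.unusedSectionVars false

lemma finrank_simple {K H : Type*} [Field K] [Ring H] [Algebra K H] {ι : Type*} [Fintype ι] {d : ι → ℕ}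
    (φ : H ≃ₐ[K] Π i, Matrix (Fin (d i)) (Fin (d i)) K)
    (V : Type*) [AddCommGroup V] [Module K V] [Module H V] [IsScalarTower K H V] [IsSimpleModule H V] :
    ∃ i, Module.finrank K V = d i := by
  classical
  have : Nontrivial V := IsSimpleModule.nontrivial H V
  obtain ⟨v, hv⟩ := exists_ne (0 : V)
  let s : ∀ i, Matrix (Fin (d i)) (Fin (d i)) K →ₗ[K] H := fun i =>
    φ.symm.toLinearMap ∘ₗ LinearMap.single K (fun i => Matrix (Fin (d i)) (Fin (d i)) K) i
  have hs : ∀ i M, s i M = φ.symm (Pi.single i M) := fun _ _ => rfl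
  have s1 : ∑ i, ∑ a, s i (Matrix.single a a 1) = 1 := by
    simp_rw [← map_sum, Matrix.sum_single_one, hs]
    rw [← map_sum, ← map_one φ.symm]
    congr 1
    exact Finset.univ_sum_single (1 : Π i, Matrix (Fin (d i)) (Fin (d i)) K)
  have hm : ∀ i h M, h * s i M = s i (φ h i * M) := by
    intro i h M
    apply φ.injective
    rw [map_mul, hs, hs, φ.apply_symm_apply, φ.apply_symm_apply]
    ext j : 1
    rcases eq_or_ne j i with rfl | h
    · simp
    · simp [h]
  have hss : ∀ i M N, s i M * s i N = s i (M * N) := by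
    intro i M N
    rw [hm, hs i M, φ.apply_symm_apply, Pi.single_eq_same]
  have hex : ∃ i, ∃ a, s i (Matrix.single a a 1) • v ≠ 0 := by
    by_contra! hcon
    apply hv
    rw [← one_smul H v, ← s1, Finset.sum_smul]
    refine Finset.sum_eq_zero fun i _ => ?_
    rw [Finset.sum_smul]
    exact Finset.sum_eq_zero fun a _ => hcon i a
  obtain ⟨i, a, hw⟩ := hex
  set w := s i (Matrix.single a a 1) • v with hwd
  have hww : s i (Matrix.single a a 1) • w = w := by
    rw [hwd, smul_smul, hss, Matrix.single_mul_single_same, one_mul]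
  refine ⟨i, ?_⟩
  let g : (Fin (d i) → K) →ₗ[K] V := 
    ∑ b, (LinearMap.proj (R := K) (φ := fun _ : Fin (d i) => K) b).smulRight (s i (Matrix.single b a 1) • w)
  have hg : ∀ c, g c = ∑ b, c b • s i (Matrix.single b a 1) • w := by
    intro c; simp [g]
  have hb : Function.Bijective g := by
    constructor
    · rw [← LinearMap.ker_eq_bot, LinearMap.ker_eq_bot']
      intro c hc
      funext b
      have h1 : s i (Matrix.single a b 1) • g c = c b • w := by
        rw [hg, Finset.smul_sum, Finset.sum_eq_single b]
        · rw [← smul_assoc (c b), smul_smul, mul_smul_comm, hss, Matrix.single_mul_single_same, one_mul, smul_assoc, hww]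
        · intro b' _ hb'
          rw [← smul_assoc (c b'), smul_smul, mul_smul_comm, hss, Matrix.single_mul_single_of_ne _ _ _ _ hb'.symm, map_zero, smul_zero, zero_smul]
        · simp
      rw [hc, smul_zero] at h1
      exact (smul_eq_zero.1 h1.symm).resolve_right hw
    · intro u
      have := IsSimpleModule.toSpanSingleton_surjective H hw
      obtain ⟨h, hh⟩ := this u
      rw [LinearMap.toSpanSingleton_apply] at hh
      refine ⟨fun b => φ h i b a, ?_⟩
      rw [hg, ← hh]
      conv_rhs => rw [← hww, smul_smul, hm, mul_single_k, map_sum, Finset.sum_smul]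
      simp only [map_smul, smul_assoc]
  rw [← (LinearEquiv.ofBijective g hb).finrank_eq]
  simp

lemma exists_haar {K H : Type*} [Field K] [Ring H] [HopfAlgebra K H] 
    (Hd : Type*) [Ring Hd] [Algebra K Hd] [IsSemisimpleRing Hd]
    (Φ : Hd ≃ₗ[K] Module.Dual K H)
    (hΦone : Φ 1 = Coalgebra.counit)
    (hΦmul : ∀ a b : Hd, (Φ (a * b) : Module.Dual K H) =
      LinearMap.mul' K K ∘ₗ TensorProduct.map (Φ a) (Φ b) ∘ₗ Coalgebra.comul) :
    ∃ l : H →ₗ[K] K, (∀ x, lam1 l (comul (R := K) x) = l x • (1 : H)) ∧ l 1 = 1 := by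
  let η : Hd →ₐ[K] K := AlgHom.ofLinearMap (LinearMap.applyₗ (1 : H) ∘ₗ Φ.toLinearMap) (by simp [hΦone]) (by
    intro a b
    simp [hΦmul, Algebra.TensorProduct.one_def])
  have hη : ∀ a, η a = Φ a 1 := fun _ => rfl
  obtain ⟨L, -, hL, hL1⟩ := exists_integral η
  refine ⟨Φ L, fun x => ?_, hL1⟩
  rw [← sub_eq_zero, ← Module.forall_dual_apply_eq_zero_iff K]
  intro f
  obtain ⟨b, rfl⟩ := Φ.surjective f
  have h1 := congrArg (fun f => f x) (hΦmul L b)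
  rw [hL] at h1
  have h2 : ∀ t : H ⊗[K] H, LinearMap.mul' K K (TensorProduct.map (Φ L) (Φ b) t) = Φ b (lam1 (Φ L) t) := by
    intro t
    induction t with
    | zero => simp
    | add x y hx hy => simp only [map_add, hx, hy]
    | tmul a b => simp
  simp only [LinearMap.comp_apply, h2, map_smul, LinearMap.smul_apply, hη, smul_eq_mul] at h1
  rw [map_sub, map_smul, ← h1, smul_eq_mul, mul_comm, sub_self]
end Final
end HopfEven

theorem even_dim_simple_module_even_dim_hopf_cosemisimple
    {K H : Type*} [Field K] [IsAlgClosed K]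
    [Ring H] [HopfAlgebra K H] [FiniteDimensional K H]
    [IsSemisimpleRing H]
    -- cosemisimplicity: the dual algebra `Hd` is semisimple
    (Hd : Type*) [Ring Hd] [Algebra K Hd] [IsSemisimpleRing Hd]
    (Φ : Hd ≃ₗ[K] Module.Dual K H)
    (hΦone : Φ 1 = Coalgebra.counit)
    (hΦmul : ∀ a b : Hd, (Φ (a * b) : Module.Dual K H) =
      LinearMap.mul' K K ∘ₗ TensorProduct.map (Φ a) (Φ b) ∘ₗ Coalgebra.comul)
    -- a simple module of even dimension
    (V : Type*) [AddCommGroup V] [Module K V] [Module H V]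
    [IsScalarTower K H V] [FiniteDimensional K V]
    [IsSimpleModule H V]
    (hV : Even (Module.finrank K V)) :
    Even (Module.finrank K H) := by
  obtain ⟨l, hl, l1⟩ := HopfEven.exists_haar Hd Φ hΦone hΦmul
  obtain ⟨n, d, hd, ⟨φ⟩⟩ := IsSemisimpleRing.exists_algEquiv_pi_matrix_of_isAlgClosed K H
  obtain ⟨i, hi⟩ := HopfEven.finrank_simple φ V
  by_contra hodd
  have hodd_i : Odd (d i) := by
    obtain ⟨q, hq⟩ := CharP.exists K
    rcases CharP.char_is_prime_or_zero K q with h | h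
    · have : Fact q.Prime := ⟨h⟩
      exact HopfEven.odd_charp q (fun i => (hd i).out) φ hl l1 hodd i
    · subst h
      have : CharZero K := CharP.charP_to_charZero K
      exact HopfEven.thm0 (fun i => (hd i).out) φ l hl l1 hodd i
  rw [hi] at hV
  exact Nat.not_even_iff_odd.2 hodd_i hV
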